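/- Let q be an odd prime and k ≥ 1 an integer. Put r = gcd(k, q−1) and h = (q−1)/r, and assume h is even. Let C > 0 be the constant with S_{k,q}(x) ∼ C·x/(log x)^{1/h}. Then, as x → ∞, S'_{k,q}(x) = ((1−1/q)·C·x/(log x)^{1/h})·(1 + (1 − γ'_{k,q})/(h·log x)) + O(x/(log x)^{2+1/h}), where γ'_{k,q} = γ_{k,q} + log q/(q−1). -/

import Mathlib

open Filter Topology

/-- The `k`-th divisor sum function `σ_k(n) = ∑_{d ∣ n} d^k`. -/
def sigmak (k n : ℕ) : ℕ := ∑ d ∈ n.divisors, d ^ k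

/-- The multiplicative order `g_p` of `p^m` modulo `q`. -/
noncomputable def gp (q m p : ℕ) : ℕ := orderOf ((p : ZMod q) ^ m)

/-- The local term at a prime `p` of the prime sum `S(m,q)` of the paper. -/
noncomputable def Sterm (q m p : ℕ) : ℝ :=
  if p = q then 0 else
    (if gp q m p = 1 then
        (q : ℝ) * Real.log p / ((p : ℝ) ^ q - 1)
          - ((q : ℝ) - 1) * Real.log p / ((p : ℝ) ^ (q - 1) - 1)
      else 0)
    + (if 3 ≤ gp q m p then
        (gp q m p : ℝ) * Real.log p / ((p : ℝ) ^ gp q m p - 1)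
          - ((gp q m p : ℝ) - 1) * Real.log p / ((p : ℝ) ^ (gp q m p - 1) - 1)
      else 0)
    + (if gp q m p = 2 then Real.log p / ((p : ℝ) ^ 2 - 1) else 0)
    + (if 4 ≤ gp q m p ∧ 2 ∣ gp q m p then
        Real.log p / ((p : ℝ) ^ (gp q m p / 2) - ((p : ℝ) ^ (gp q m p / 2))⁻¹)
      else 0)

/-- The prime sum `S(m,q)` of the paper (a sum over all primes `p ≠ q`). -/
noncomputable def Smq (q m : ℕ) : ℝ := ∑' p : Nat.Primes, Sterm q m (p : ℕ)

/-- The Dirichlet L-function attached to a Dirichlet character mod `q` (junk value for `q = 0`). -/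
noncomputable def Lfun {q : ℕ} (χ : DirichletCharacter ℂ q) (s : ℂ) : ℂ :=
  if h : q = 0 then 0 else
    haveI : NeZero q := ⟨h⟩
    DirichletCharacter.LFunction χ s

/-- `γ_{K_m} = γ + ∑_{χ ∈ X_m^*} (L'/L)(1,χ)`, the Euler–Kronecker constant of the unique
subfield of `ℚ(ζ_q)` of degree `(q-1)/m`; here `X_m^*` is the set of nonprincipal Dirichlet
characters mod `q` that are trivial on the group `C_m` of `m`-th roots of unity mod `q`. -/
noncomputable def gammaK (q m : ℕ) : ℝ :=
  Real.eulerMascheroniConstant +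
    (∑ᶠ χ ∈ {χ : DirichletCharacter ℂ q | χ ≠ 1 ∧ ∀ a : ZMod q, a ^ m = 1 → χ a = 1},
      deriv (Lfun χ) 1 / Lfun χ 1).re

/-- The Euler–Kronecker constant `γ_{k,q}`, for `q` an odd prime, `r = gcd(k, q-1)` and
`h = (q-1)/r` even:  `γ_{k,q} = γ − (1/h)(2γ_{K_{2r}} − γ_{K_r}) − log q/(h(q−1)) − S(r,q)`. -/
noncomputable def gammakq (q k : ℕ) : ℝ :=
  Real.eulerMascheroniConstant
    - (1 / (((q - 1) / Nat.gcd k (q - 1) : ℕ) : ℝ)) *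
        (2 * gammaK q (2 * Nat.gcd k (q - 1)) - gammaK q (Nat.gcd k (q - 1)))
    - Real.log q / ((((q - 1) / Nat.gcd k (q - 1) : ℕ) : ℝ) * ((q : ℝ) - 1))
    - Smq q (Nat.gcd k (q - 1))

/-- `γ'_{k,q} = γ_{k,q} + log q/(q-1)`. -/
noncomputable def gammakq' (q k : ℕ) : ℝ := gammakq q k + Real.log q / ((q : ℝ) - 1)

/-- `S_{k,q}(x) = #{1 ≤ n ≤ x : q ∤ σ_k(n)}`. -/
noncomputable def Skq (k q : ℕ) (x : ℝ) : ℕ :=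
  Nat.card {n : ℕ | 1 ≤ n ∧ (n : ℝ) ≤ x ∧ ¬ q ∣ sigmak k n}

/-- `S'_{k,q}(x) = #{1 ≤ n ≤ x : q ∤ n·σ_k(n)}`. -/
noncomputable def Skq' (k q : ℕ) (x : ℝ) : ℕ :=
  Nat.card {n : ℕ | 1 ≤ n ∧ (n : ℝ) ≤ x ∧ ¬ q ∣ n * sigmak k n}

section Tauberian
open MeasureTheory Set

lemma integral_Ioi_primitive_mul_cpow {φ : ℝ → ℂ} (hmeas : Measurable φ) {C r : ℝ}
    (hφ : ∀ v > 1, ‖φ v‖ ≤ C * v ^ r) {s : ℂ} (hs0 : 0 < s.re) (hs : r + 1 < s.re) :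
    ∫ u in Ioi (1 : ℝ), (∫ v in (1 : ℝ)..u, φ v) * (u : ℂ) ^ (-(s + 1)) =
      (1 / s) * ∫ v in Ioi (1 : ℝ), φ v * (v : ℂ) ^ (-s) := by
  set μ : Measure ℝ := volume.restrict (Ioi (1 : ℝ)) with hμ
  have hs_ne : s ≠ 0 := by rintro rfl; simp at hs0
  let k : ℝ → ℝ → ℂ := fun u v => if v < u then φ v * (u : ℂ) ^ (-(s + 1)) else 0
  have hk_meas : Measurable (Function.uncurry k) := by
    refine Measurable.ite (measurableSet_lt measurable_snd measurable_fst) ?_ measurable_const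
    exact (hmeas.comp measurable_snd).mul
      ((Complex.measurable_ofReal.comp measurable_fst).pow_const _)
  have hsec : ∀ v > (1 : ℝ), (fun u => k u v) =
      (Ioi v).indicator (fun u : ℝ => φ v * (u : ℂ) ^ (-(s + 1))) := by
    intro v _
    ext u
    simp [k, Set.indicator, mem_Ioi]
  have hre : (-(s + 1)).re < -1 := by simp; linarith
  have hint0 : ∀ v > (1 : ℝ), IntegrableOn (fun u : ℝ => φ v * (u : ℂ) ^ (-(s + 1))) (Ioi v) :=
    fun v hv => (integrableOn_Ioi_cpow_of_lt hre (by linarith)).const_mul _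
  have hres : ∀ v > (1 : ℝ), μ.restrict (Ioi v) = volume.restrict (Ioi v) := by
    intro v hv
    rw [hμ, Measure.restrict_restrict measurableSet_Ioi,
      inter_eq_left.mpr (Ioi_subset_Ioi hv.le)]
  have hint : Integrable (Function.uncurry k) (μ.prod μ) := by
    rw [integrable_prod_iff' hk_meas.aestronglyMeasurable]
    refine ⟨?_, ?_⟩
    · filter_upwards [ae_restrict_mem measurableSet_Ioi] with v hv
      have hv1 : (1 : ℝ) < v := hv
      change Integrable (fun u => k u v) μ
      rw [hsec v hv, integrable_indicator_iff measurableSet_Ioi, IntegrableOn, hres v hv1]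
      exact hint0 v hv1
    · have hdom : Integrable (fun v : ℝ => C / s.re * v ^ (r - s.re)) μ :=
        (integrableOn_Ioi_rpow_of_lt (by linarith) one_pos).const_mul _
      refine hdom.mono' hk_meas.norm.stronglyMeasurable.integral_prod_left.aestronglyMeasurable ?_
      filter_upwards [ae_restrict_mem measurableSet_Ioi] with v hv
      have hv1 : (1 : ℝ) < v := hv
      have hv0 : 0 < v := by linarith
      rw [Real.norm_of_nonneg (integral_nonneg fun _ => norm_nonneg _)]
      have : (fun u => ‖Function.uncurry k (u, v)‖) =
          (Ioi v).indicator (fun u : ℝ => ‖φ v‖ * ‖(u : ℂ) ^ (-(s + 1))‖) := by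
        ext u
        simp only [Function.uncurry, k, Set.indicator, mem_Ioi]
        split_ifs <;> simp
      rw [this, integral_indicator measurableSet_Ioi, hres v hv1]
      have h2 : ∫ u in Ioi v, ‖φ v‖ * ‖(u : ℂ) ^ (-(s + 1))‖ =
          ∫ u in Ioi v, ‖φ v‖ * u ^ (-(s.re + 1)) := by
        refine setIntegral_congr_fun measurableSet_Ioi fun u hu => ?_
        have hu0 : 0 < u := hv0.trans hu
        simp [Complex.norm_cpow_eq_rpow_re_of_pos hu0]
      rw [h2, integral_const_mul, integral_Ioi_rpow_of_lt (by linarith) hv0]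
      have : ‖φ v‖ * (-v ^ (-(s.re + 1) + 1) / (-(s.re + 1) + 1)) =
          ‖φ v‖ * (v ^ (-s.re) / s.re) := by
        rw [show -(s.re + 1) + 1 = -s.re by ring, neg_div_neg_eq]
      rw [this]
      calc ‖φ v‖ * (v ^ (-s.re) / s.re) ≤ C * v ^ r * (v ^ (-s.re) / s.re) := by
            gcongr; exact hφ v hv1
        _ = _ := by rw [sub_eq_add_neg, Real.rpow_add hv0]; ring
  have key := integral_integral_swap hint
  have hL : ∫ u, ∫ v, k u v ∂μ ∂μ =
      ∫ u in Ioi (1 : ℝ), (∫ v in (1 : ℝ)..u, φ v) * (u : ℂ) ^ (-(s + 1)) := by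
    refine setIntegral_congr_fun measurableSet_Ioi fun u hu => ?_
    have hu1 : (1 : ℝ) < u := hu
    have : (fun v => k u v) = (Iio u).indicator (fun v : ℝ => φ v * (u : ℂ) ^ (-(s + 1))) := by
      ext v
      simp [k, Set.indicator, mem_Iio]
    rw [this, integral_indicator measurableSet_Iio, hμ,
      Measure.restrict_restrict measurableSet_Iio, inter_comm, Ioi_inter_Iio,
      integral_mul_const, intervalIntegral.integral_of_le hu1.le, integral_Ioc_eq_integral_Ioo]
  have hR : ∫ v, ∫ u, k u v ∂μ ∂μ = ∫ v in Ioi (1 : ℝ), (1 / s) * (φ v * (v : ℂ) ^ (-s)) := by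
    refine setIntegral_congr_fun measurableSet_Ioi fun v hv => ?_
    have hv1 : (1 : ℝ) < v := hv
    rw [hsec v hv1, integral_indicator measurableSet_Ioi, hres v hv1, integral_const_mul,
      integral_Ioi_cpow_of_lt hre (by linarith)]
    rw [show -(s + 1) + 1 = -s by ring]
    field_simp
  rw [← hL, key, hR, integral_const_mul]

end Tauberian

section Tauberian
open MeasureTheory Set

lemma exists_norm_primitive_le_of_mellin_bound : ∃ c : ℝ, 0 ≤ c ∧
    ∀ (E : ℝ → ℂ) (D : ℂ → ℂ) (σ B : ℝ), Measurable E → (∀ v ≤ 1, E v = 0) → 1 < σ →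
    (∀ r : ℝ, 1 < r → ∃ C : ℝ, ∀ v : ℝ, 1 < v → ‖E v‖ ≤ C * v ^ r) →
    (∀ t : ℝ, D (σ + t * Complex.I) = (σ + t * Complex.I) *
      ∫ v in Ioi (1 : ℝ), E v * (v : ℂ) ^ (-((σ + t * Complex.I) + 1))) →
    (Continuous fun t : ℝ => D (σ + t * Complex.I)) →
    (∀ t : ℝ, ‖D (σ + t * Complex.I)‖ ≤ B * (1 + |t|) ^ (1 / 2 : ℝ)) →
    ∀ x > 0, ‖∫ v in (1 : ℝ)..x, E v‖ ≤ c * B * x ^ (σ + 1) := by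
  have hi32 : Integrable fun t : ℝ => (1 + ‖t‖) ^ (-(3 / 2) : ℝ) :=
    integrable_one_add_norm (by simp; norm_num)
  refine ⟨1 / (2 * Real.pi) * (2 * ∫ t : ℝ, (1 + ‖t‖) ^ (-(3 / 2) : ℝ)),
    mul_nonneg (by positivity) (mul_nonneg (by norm_num) (integral_nonneg fun t => by positivity)), ?_⟩
  intro E D σ B hE hE0 hσ hgrow hD hDc hDB x hx
  obtain ⟨C, hC⟩ := hgrow ((1 + σ) / 2) (by linarith)
  set r := (1 + σ) / 2 with hr
  have hC0 : 0 ≤ C := by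
    have := (norm_nonneg _).trans (hC 2 (by norm_num))
    by_contra! h
    exact absurd this (not_le.mpr (mul_neg_of_neg_of_pos h (by positivity)))
  have hbd : ∀ u : ℝ, ∀ v ≤ u, 1 ≤ u → ‖E v‖ ≤ C * u ^ r := by
    intro u v hvu hu
    rcases le_or_gt v 1 with hv | hv
    · rw [hE0 v hv, norm_zero]; positivity
    · exact (hC v hv).trans (by gcongr)
  have hii : ∀ a b, IntervalIntegrable E volume a b := by
    intro a b
    rw [intervalIntegrable_iff]
    refine Measure.integrableOn_of_bounded (M := C * (max 1 (max a b)) ^ r) (by simp) 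
      hE.aestronglyMeasurable ?_
    filter_upwards [ae_restrict_mem measurableSet_uIoc] with v hv
    refine hbd _ _ ?_ (le_max_left _ _)
    exact hv.2.trans (le_max_right _ _)
  set E1 : ℝ → ℂ := fun u => ∫ v in (1 : ℝ)..u, E v with hE1
  have hcont : Continuous E1 := intervalIntegral.continuous_primitive hii 1
  have hE1_0 : ∀ u ≤ 1, E1 u = 0 := by
    intro u hu
    simp only [hE1]
    rw [intervalIntegral.integral_zero_ae]
    refine Eventually.of_forall fun v hv => hE0 v ?_
    rw [uIoc_comm, uIoc_of_le hu] at hv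
    exact hv.2
  have hE1_b : ∀ u > 1, ‖E1 u‖ ≤ C * u ^ (r + 1) := by
    intro u hu
    have : ‖E1 u‖ ≤ C * u ^ r * |u - 1| := by
      refine intervalIntegral.norm_integral_le_of_norm_le_const fun v hv => ?_
      rw [uIoc_of_le hu.le] at hv
      exact hbd u v hv.2 hu.le
    refine this.trans ?_
    rw [Real.rpow_add (by linarith), Real.rpow_one, ← mul_assoc, abs_of_pos (by linarith)]
    have : 0 ≤ u ^ r := by positivity
    gcongr
    linarith
  have hmel : ∀ t : ℝ, mellin E1 (((-(σ + 1) : ℝ) : ℂ) + t * Complex.I) =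
      D (σ + (-t : ℝ) * Complex.I) / ((σ + (-t : ℝ) * Complex.I) * (σ + (-t : ℝ) * Complex.I + 1)) := by
    intro t
    set s : ℂ := σ + (-t : ℝ) * Complex.I with hs
    have hsre : s.re = σ := by simp [hs]
    have hsne : s ≠ 0 := by intro h; rw [h] at hsre; simp at hsre; linarith
    rw [hD (-t), ← hs]
    have h1 : mellin E1 (((-(σ + 1) : ℝ) : ℂ) + t * Complex.I) =
        ∫ u in Ioi (1 : ℝ), E1 u * (u : ℂ) ^ (-((s + 1) + 1)) := by
      have hexp : ((-(σ + 1) : ℝ) : ℂ) + t * Complex.I - 1 = -((s + 1) + 1) := by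
        simp [hs]; ring
      rw [mellin, hexp]
      simp only [smul_eq_mul]
      rw [← setIntegral_eq_of_subset_of_forall_sdiff_eq_zero measurableSet_Ioi
        (Ioi_subset_Ioi (zero_le_one (α := ℝ)))]
      · simp only [mul_comm]
      · intro u hu
        rw [hE1_0 u (not_lt.mp hu.2), zero_mul]
    rw [h1, integral_Ioi_primitive_mul_cpow hE hC (by simp [hsre]; linarith) 
      (by simp [hsre, hr]; linarith)]
    field_simp
  have hbound : ∀ t : ℝ, ‖mellin E1 (((-(σ + 1) : ℝ) : ℂ) + t * Complex.I)‖ ≤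
      2 * B * (1 + ‖t‖) ^ (-(3 / 2) : ℝ) := by
    intro t
    rw [hmel, norm_div, norm_mul]
    set s : ℂ := σ + (-t : ℝ) * Complex.I with hs
    have hsq : ∀ a : ℝ, 1 ≤ a → (1 + |t|) ^ 2 ≤ 2 * Complex.normSq (a + (-t : ℝ) * Complex.I) := by
      intro a ha
      simp only [Complex.normSq_apply]
      simp
      nlinarith [sq_abs t, sq_nonneg (|t| - 1), abs_nonneg t]
    have h1 : (1 + |t|) ^ 2 ≤ 2 * ‖s‖ ^ 2 := by
      rw [← Complex.normSq_eq_norm_sq]; exact hsq σ hσ.le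
    have h2 : (1 + |t|) ^ 2 ≤ 2 * ‖s + 1‖ ^ 2 := by
      rw [← Complex.normSq_eq_norm_sq]
      have := hsq (σ + 1) (by linarith)
      convert! this using 3
      simp [hs]; ring
    have h0 : 0 < 1 + |t| := by positivity
    have h3 : (1 + |t|) ^ 2 ≤ 2 * (‖s‖ * ‖s + 1‖) := by
      refine le_of_sq_le_sq ?_ (by positivity)
      nlinarith [mul_le_mul h1 h2 (by positivity) (by positivity)]
    have hs1 : 0 < ‖s‖ * ‖s + 1‖ := by nlinarith [pow_pos h0 2]
    have hB := hDB (-t)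
    rw [← hs, abs_neg] at hB
    rw [div_le_iff₀ hs1]
    have hpow : (1 + |t|) ^ (1 / 2 : ℝ) = (1 + |t|) ^ (-(3 / 2) : ℝ) * (1 + |t|) ^ 2 := by
      rw [← Real.rpow_natCast, ← Real.rpow_add h0]; norm_num
    have hB0 : 0 ≤ B := by
      by_contra! h
      exact absurd ((norm_nonneg _).trans hB) (not_le.mpr (mul_neg_of_neg_of_pos h (by positivity)))
    calc ‖D s‖ ≤ B * ((1 + |t|) ^ (-(3 / 2) : ℝ) * (1 + |t|) ^ 2) := by rw [← hpow]; exact hB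
      _ ≤ B * ((1 + |t|) ^ (-(3 / 2) : ℝ) * (2 * (‖s‖ * ‖s + 1‖))) := by gcongr
      _ = _ := by rw [Real.norm_eq_abs]; ring
  have hmc : MellinConvergent E1 ((-(σ + 1) : ℝ) : ℂ) := by
    rw [MellinConvergent]
    have hdom : IntegrableOn (fun u : ℝ => C * u ^ (r - σ - 1)) (Ioi 1) :=
      (integrableOn_Ioi_rpow_of_lt (by linarith) one_pos).const_mul _
    have hms : AEStronglyMeasurable (fun t : ℝ => (t : ℂ) ^ (((-(σ + 1) : ℝ) : ℂ) - 1) • E1 t) :=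
      ((Complex.measurable_ofReal.pow_const _).smul hcont.measurable).aestronglyMeasurable
    have h1 : IntegrableOn (fun t : ℝ => (t : ℂ) ^ (((-(σ + 1) : ℝ) : ℂ) - 1) • E1 t) (Ioi 1) := by
      refine Integrable.mono' hdom hms.restrict ?_
      filter_upwards [ae_restrict_mem measurableSet_Ioi] with u hu
      have hu1 : (1 : ℝ) < u := hu
      have hu0 : 0 < u := by linarith
      rw [norm_smul, Complex.norm_cpow_eq_rpow_re_of_pos hu0]
      have : (((-(σ + 1) : ℝ) : ℂ) - 1).re = -σ - 2 := by simp; ring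
      rw [this]
      calc u ^ (-σ - 2) * ‖E1 u‖ ≤ u ^ (-σ - 2) * (C * u ^ (r + 1)) := by
            gcongr; exact hE1_b u hu1
        _ = C * (u ^ (-σ - 2) * u ^ (r + 1)) := by ring
        _ = _ := by rw [← Real.rpow_add hu0]; congr 2; ring
    refine h1.of_forall_sdiff_eq_zero measurableSet_Ioi ?_
    intro u hu
    rw [hE1_0 u (not_lt.mp hu.2), smul_zero]
  have hvi : Complex.VerticalIntegrable (mellin E1) (-(σ + 1)) := by
    refine Integrable.mono' (hi32.const_mul (2 * B)) ?_ (Eventually.of_forall hbound)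
    refine Continuous.aestronglyMeasurable ?_
    simp_rw [hmel]
    refine Continuous.div (hDc.comp continuous_neg) (by fun_prop) ?_
    intro t h
    have : ∀ a : ℝ, 0 < a → (a : ℂ) + (-t : ℝ) * Complex.I ≠ 0 := by
      intro a ha h
      have := congrArg Complex.re h
      simp at this
      linarith
    rcases mul_eq_zero.mp h with h | h
    · exact this σ (by linarith) h
    · refine this (σ + 1) (by linarith) ?_
      rw [← h]; push_cast; ring
  have hinv := mellinInv_mellin_eq (-(σ + 1)) E1 hx hmc hvi hcont.continuousAt
  change ‖E1 x‖ ≤ _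
  rw [← hinv, mellinInv, norm_smul]
  have h2 : ‖∫ y : ℝ, (x : ℂ) ^ (-(((-(σ + 1) : ℝ) : ℂ) + y * Complex.I)) •
      mellin E1 (((-(σ + 1) : ℝ) : ℂ) + y * Complex.I)‖ ≤
      ∫ y : ℝ, x ^ (σ + 1) * (2 * B * (1 + ‖y‖) ^ (-(3 / 2) : ℝ)) := by
    refine norm_integral_le_of_norm_le ((hi32.const_mul _).const_mul _) 
      (Eventually.of_forall fun y => ?_)
    rw [norm_smul, Complex.norm_cpow_eq_rpow_re_of_pos hx]
    have : (-(((-(σ + 1) : ℝ) : ℂ) + y * Complex.I)).re = σ + 1 := by simp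
    rw [this]
    gcongr
    exact hbound y
  rw [integral_const_mul, integral_const_mul] at h2
  have h3 : ‖(1 / (2 * Real.pi) : ℝ)‖ = 1 / (2 * Real.pi) := by
    rw [Real.norm_of_nonneg]; positivity
  rw [h3]
  calc _ ≤ _ := mul_le_mul_of_nonneg_left h2 (by positivity)
    _ = _ := by ring

end Tauberian

section Tauberian
open MeasureTheory Set

lemma exists_log_rpow_le {β r : ℝ} (hβ : 0 ≤ β) (hr : 0 < r) :
    ∃ C : ℝ, ∀ v : ℝ, 1 ≤ v → Real.log v ^ β ≤ C * v ^ r := by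
  rcases hβ.eq_or_lt with rfl | hβ
  · refine ⟨1, fun v hv => ?_⟩
    rw [Real.rpow_zero, one_mul]
    exact Real.one_le_rpow hv hr.le
  · refine ⟨((r / β)⁻¹) ^ β, fun v hv => ?_⟩
    have h := Real.log_le_rpow_div (x := v) (by linarith) (div_pos hr hβ)
    calc Real.log v ^ β ≤ (v ^ (r / β) / (r / β)) ^ β :=
          Real.rpow_le_rpow (Real.log_nonneg hv) h hβ.le
      _ = _ := by
        rw [div_eq_mul_inv, Real.mul_rpow (by positivity) (by positivity), ← Real.rpow_mul (by linarith),
          div_mul_cancel₀ _ hβ.ne', mul_comm]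

lemma integral_log_rpow_mul_cpow_ofReal {β : ℝ} (hβ : 0 < β) {s : ℝ} (hs : 1 < s) :
    ∫ u in Ioi (1 : ℝ), ((Real.log u ^ (β - 1) : ℝ) : ℂ) * (u : ℂ) ^ (-(s : ℂ)) =
      Complex.Gamma β * ((s : ℂ) - 1) ^ (-(β : ℂ)) := by
  have hs1 : 0 < s - 1 := by linarith
  have himg : Real.exp '' Ioi 0 = Ioi 1 := by
    ext u
    constructor
    · rintro ⟨t, ht, rfl⟩
      exact Real.one_lt_exp_iff.mpr ht
    · intro hu
      exact ⟨Real.log u, Real.log_pos hu, Real.exp_log (zero_lt_one.trans hu)⟩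
  rw [← himg, integral_image_eq_integral_abs_deriv_smul measurableSet_Ioi
    (fun x _ => (Real.hasDerivAt_exp x).hasDerivWithinAt) Real.exp_injective.injOn]
  have := Complex.integral_cpow_mul_exp_neg_mul_Ioi (a := β) (r := s - 1) (by simpa using hβ) hs1
  have harg : (((s - 1 : ℝ) : ℂ)).arg ≠ Real.pi := by
    rw [Complex.arg_ofReal_of_nonneg hs1.le]
    exact Real.pi_pos.ne
  rw [one_div, Complex.inv_cpow _ _ harg, ← Complex.cpow_neg, mul_comm] at this
  rw [show (s : ℂ) - 1 = ((s - 1 : ℝ) : ℂ) by push_cast; rfl, ← this]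
  refine setIntegral_congr_fun measurableSet_Ioi fun t ht => ?_
  have ht0 : (0 : ℝ) < t := ht
  simp only [Real.log_exp, abs_of_pos (Real.exp_pos t), Complex.real_smul]
  rw [Complex.ofReal_cpow ht0.le, Complex.cpow_def_of_ne_zero (by simp) (-(s : ℂ)),
    ← Complex.ofReal_log (Real.exp_pos t).le, Real.log_exp]
  push_cast
  rw [mul_left_comm, ← Complex.exp_add, ]
  congr 2
  ring

lemma frequently_ofReal_mem_nhdsNE {P : ℂ → Prop} (a : ℝ) (h : ∀ᶠ x : ℝ in 𝓝 a, P x) :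
    ∃ᶠ z : ℂ in 𝓝[≠] (a : ℂ), P z := by
  have ht : Tendsto (fun x : ℝ => (x : ℂ)) (𝓝[≠] a) (𝓝[≠] (a : ℂ)) := by
    refine tendsto_nhdsWithin_iff.mpr ⟨Complex.continuous_ofReal.continuousAt.mono_left
      nhdsWithin_le_nhds, ?_⟩
    filter_upwards [self_mem_nhdsWithin] with x hx
    simpa using hx
  exact ht.frequently (h.filter_mono nhdsWithin_le_nhds).frequently

lemma integral_log_rpow_mul_cpow {β : ℝ} (hβ : 1 ≤ β) {s : ℂ} (hs : 1 < s.re) :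
    ∫ u in Ioi (1 : ℝ), ((Real.log u ^ (β - 1) : ℝ) : ℂ) * (u : ℂ) ^ (-s) =
      Complex.Gamma β * (s - 1) ^ (-(β : ℂ)) := by
  set f : ℝ → ℂ := (Ioi (1 : ℝ)).indicator fun u => ((Real.log u ^ (β - 1) : ℝ) : ℂ) with hf
  have hfm : Measurable f := by
    refine Measurable.indicator ?_ measurableSet_Ioi
    exact Complex.measurable_ofReal.comp (Real.measurable_log.pow_const _)
  have hmel : ∀ z : ℂ, ∫ u in Ioi (1 : ℝ), ((Real.log u ^ (β - 1) : ℝ) : ℂ) * (u : ℂ) ^ (-z) =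
      mellin f (1 - z) := by
    intro z
    rw [mellin, setIntegral_eq_of_subset_of_forall_sdiff_eq_zero measurableSet_Ioi
        (Ioi_subset_Ioi (zero_le_one (α := ℝ)))]
    · refine setIntegral_congr_fun measurableSet_Ioi fun u hu => ?_
      simp only [hf, indicator_of_mem hu, smul_eq_mul]
      rw [mul_comm, show 1 - z - 1 = -z by ring]
    · intro u hu
      simp [hf, indicator_of_notMem hu.2]
  have hgrow : ∀ r : ℝ, 0 < r → ∃ C : ℝ, ∀ u : ℝ, 0 < u → ‖f u‖ ≤ C * u ^ r := by
    intro r hr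
    obtain ⟨C, hC⟩ := exists_log_rpow_le (β := β - 1) (by linarith) hr
    have hC0 : 0 ≤ C := by
      have := hC 1 le_rfl
      rw [Real.log_one, Real.one_rpow, mul_one] at this
      exact (Real.rpow_nonneg le_rfl _).trans this
    refine ⟨C, fun u hu => ?_⟩
    by_cases h : u ∈ Ioi (1 : ℝ)
    · have h1 : (1 : ℝ) < u := h
      rw [hf, indicator_of_mem h, Complex.norm_real, Real.norm_of_nonneg
        (Real.rpow_nonneg (Real.log_nonneg h1.le) _)]
      exact hC u h1.le
    · rw [hf, indicator_of_notMem h, norm_zero]; positivity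
  have hfl : LocallyIntegrableOn f (Ioi 0) := by
    refine LocallyIntegrable.locallyIntegrableOn ?_ _
    rw [locallyIntegrable_iff]
    intro k hk
    obtain ⟨C, hC⟩ := hgrow 1 one_pos
    obtain ⟨M, hM⟩ := hk.isBounded.exists_norm_le
    refine Measure.integrableOn_of_bounded (M := max 0 (|C| * M)) hk.measure_lt_top.ne 
      hfm.aestronglyMeasurable ?_
    filter_upwards [ae_restrict_mem hk.measurableSet] with u hu
    by_cases h : 0 < u
    · refine (hC u h).trans (le_max_of_le_right ?_)
      rw [Real.rpow_one]
      exact mul_le_mul (le_abs_self C) ((le_abs_self u).trans (hM u hu)) h.le (abs_nonneg _)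
    · rw [hf, indicator_of_notMem, norm_zero]
      · exact le_max_left _ _
      · simp; linarith
  have hdiff : ∀ z : ℂ, 1 < z.re → DifferentiableAt ℂ (fun z => mellin f (1 - z)) z := by
    intro z hz
    have : DifferentiableAt ℂ (mellin f) (1 - z) := by
      obtain ⟨C, hC⟩ := hgrow ((z.re - 1) / 2) (by linarith)
      refine mellin_differentiableAt_of_isBigO_rpow (a := -((z.re - 1) / 2)) (b := (1 - z).re - 1)
        hfl ?_ (by simp; linarith) ?_ (by linarith)
      · refine Asymptotics.IsBigO.of_bound C ?_
        filter_upwards [eventually_gt_atTop 0] with u hu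
        rw [neg_neg, Real.norm_of_nonneg (by positivity)]
        exact hC u hu
      · refine Asymptotics.IsBigO.of_bound 0 ?_
        filter_upwards [nhdsWithin_le_nhds (Iio_mem_nhds zero_lt_one)] with u hu
        have : u ∉ Ioi (1 : ℝ) := by simpa using (mem_Iio.mp hu).le
        simp [hf, indicator_of_notMem this]
    exact this.comp z ((differentiableAt_const _).sub differentiableAt_id)
  have hopen : IsOpen {z : ℂ | 1 < z.re} := isOpen_lt continuous_const Complex.continuous_re
  have hconn : IsPreconnected {z : ℂ | 1 < z.re} := (convex_halfSpace_re_gt 1).isPreconnected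
  have h1 : AnalyticOnNhd ℂ (fun z => mellin f (1 - z)) {z : ℂ | 1 < z.re} :=
    DifferentiableOn.analyticOnNhd (fun z hz => (hdiff z hz).differentiableWithinAt) hopen
  have h2 : AnalyticOnNhd ℂ (fun z : ℂ => Complex.Gamma β * (z - 1) ^ (-(β : ℂ)))
      {z : ℂ | 1 < z.re} := by
    refine DifferentiableOn.analyticOnNhd (fun z hz => ?_) hopen
    have : z - 1 ∈ Complex.slitPlane := Or.inl (by simpa using hz)
    exact (((differentiableAt_id.sub_const _).cpow_const this).const_mul _).differentiableWithinAt
  rw [hmel]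
  refine h1.eqOn_of_preconnected_of_frequently_eq h2 hconn (z₀ := ((2 : ℝ) : ℂ)) (by simp) ?_ hs
  refine frequently_ofReal_mem_nhdsNE _ ?_
  filter_upwards [Ioi_mem_nhds (show (1 : ℝ) < 2 by norm_num)] with x hx
  rw [← hmel]
  exact integral_log_rpow_mul_cpow_ofReal (by linarith) hx

end Tauberian

section Tauberian
open MeasureTheory Set

/-- A primitive of `(log u) ^ β` on `[1, ∞)`. -/
noncomputable def logPrimitive (β u : ℝ) : ℝ := ∫ v in (1 : ℝ)..u, Real.log (max 1 v) ^ β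

lemma continuous_log_max_rpow {β : ℝ} (hβ : 0 ≤ β) :
    Continuous fun v : ℝ => Real.log (max 1 v) ^ β :=
  ((continuous_const.max continuous_id).log fun v => by
    have : (1 : ℝ) ≤ max 1 v := le_max_left _ _
    exact (by simp; positivity)).rpow_const fun _ => Or.inr hβ

lemma hasDerivAt_logPrimitive {β : ℝ} (hβ : 0 ≤ β) (u : ℝ) :
    HasDerivAt (logPrimitive β) (Real.log (max 1 u) ^ β) u :=
  intervalIntegral.integral_hasDerivAt_right
    ((continuous_log_max_rpow hβ).intervalIntegrable _ _)
    ((continuous_log_max_rpow hβ).stronglyMeasurableAtFilter _ _) (continuous_log_max_rpow hβ).continuousAt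

lemma continuous_logPrimitive {β : ℝ} (hβ : 0 ≤ β) : Continuous (logPrimitive β) :=
  continuous_iff_continuousAt.mpr fun u => (hasDerivAt_logPrimitive hβ u).continuousAt

lemma logPrimitive_nonneg {β u : ℝ} (hu : 1 ≤ u) : 0 ≤ logPrimitive β u :=
  intervalIntegral.integral_nonneg hu fun _ _ =>
    Real.rpow_nonneg (Real.log_nonneg (le_max_left _ _)) _

lemma logPrimitive_le {β u : ℝ} (hβ : 0 ≤ β) (hu : 1 ≤ u) :
    logPrimitive β u ≤ u * Real.log u ^ β := by
  have h : logPrimitive β u ≤ ∫ _ in (1 : ℝ)..u, Real.log u ^ β := by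
    refine intervalIntegral.integral_mono_on hu
      ((continuous_log_max_rpow hβ).intervalIntegrable _ _) (by simp) fun v hv => ?_
    rw [max_eq_right hv.1]
    exact Real.rpow_le_rpow (Real.log_nonneg hv.1) (Real.log_le_log (by linarith [hv.1]) hv.2) hβ
  refine h.trans ?_
  rw [intervalIntegral.integral_const, smul_eq_mul]
  have := Real.rpow_nonneg (Real.log_nonneg hu) β
  nlinarith

lemma integral_logPrimitive_mul_cpow {β : ℝ} (hβ : 1 ≤ β) {s : ℂ} (hs : 1 < s.re) :
    s * ∫ u in Ioi (1 : ℝ), (logPrimitive (β - 1) u : ℂ) * (u : ℂ) ^ (-(s + 1)) =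
      Complex.Gamma β * (s - 1) ^ (-(β : ℂ)) := by
  have hs_ne : s ≠ 0 := by rintro rfl; norm_num at hs
  obtain ⟨C, hC⟩ := exists_log_rpow_le (β := β - 1) (r := (s.re - 1) / 2) (by linarith) (by linarith)
  have hc := continuous_log_max_rpow (β := β - 1) (by linarith)
  have h := integral_Ioi_primitive_mul_cpow
    (φ := fun v => ((Real.log (max 1 v) ^ (β - 1) : ℝ) : ℂ)) (C := C) (r := (s.re - 1) / 2) (s := s)
    (Complex.continuous_ofReal.comp hc).measurable
    (fun v hv => by
      have hv1 : (1 : ℝ) ≤ v := le_of_lt hv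
      rw [Complex.norm_real, max_eq_right hv1, Real.norm_of_nonneg
        (Real.rpow_nonneg (Real.log_nonneg hv1) _)]
      exact hC v hv1) (by linarith) (by linarith)
  have h2 : ∫ v in Ioi (1 : ℝ), ((Real.log (max 1 v) ^ (β - 1) : ℝ) : ℂ) * (v : ℂ) ^ (-s) =
      ∫ v in Ioi (1 : ℝ), ((Real.log v ^ (β - 1) : ℝ) : ℂ) * (v : ℂ) ^ (-s) := by
    refine setIntegral_congr_fun measurableSet_Ioi fun v hv => ?_
    simp only [max_eq_right (le_of_lt (mem_Ioi.mp hv))]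
  rw [h2, integral_log_rpow_mul_cpow hβ hs] at h
  simp only [intervalIntegral.integral_ofReal] at h
  rw [show (∫ u in Ioi (1 : ℝ), (logPrimitive (β - 1) u : ℂ) * (u : ℂ) ^ (-(s + 1))) = _ from h,
    ← mul_assoc, mul_one_div_cancel hs_ne, one_mul]

lemma integrableOn_mul_cpow_of_le {f : ℝ → ℂ} (hf : Measurable f) {C r : ℝ}
    (hC : ∀ v : ℝ, 1 < v → ‖f v‖ ≤ C * v ^ r) {s : ℂ} (hs : r < s.re) :
    IntegrableOn (fun v : ℝ => f v * (v : ℂ) ^ (-(s + 1))) (Ioi 1) := by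
  have hi : IntegrableOn (fun v : ℝ => C * v ^ (r - s.re - 1)) (Ioi 1) :=
    (integrableOn_Ioi_rpow_of_lt (by linarith) one_pos).const_mul C
  refine hi.mono' ?_ ?_
  · exact (hf.mul (Complex.measurable_ofReal.pow_const _)).aestronglyMeasurable
  · filter_upwards [ae_restrict_mem measurableSet_Ioi] with v hv
    have hv0 : (0 : ℝ) < v := zero_lt_one.trans hv
    rw [norm_mul, Complex.norm_cpow_eq_rpow_re_of_pos hv0]
    calc ‖f v‖ * v ^ (-(s + 1)).re ≤ C * v ^ r * v ^ (-(s + 1)).re := by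
          gcongr; exact hC v hv
      _ = _ := by
        rw [mul_assoc, ← Real.rpow_add hv0]
        congr 2
        simp; ring

lemma exists_norm_integral_sub_logPrimitive_le {a : ℕ → ℝ} (ha : ∀ n, 0 ≤ a n)
    (hO : ∀ r : ℝ, 1 < r → ∃ C : ℝ, ∀ v : ℝ, 1 < v →
      ∑ n ∈ Finset.Icc 1 ⌊v⌋₊, a n ≤ C * v ^ r)
    {K : ℕ} {b : ℕ → ℂ} {β : ℕ → ℝ} (hβ : ∀ j < K, 1 ≤ β j) {τ B : ℝ} (hτ : 0 < τ)
    (hD : ∀ σ t : ℝ, 1 < σ → σ ≤ 1 + τ → ‖LSeries (fun n => (a n : ℂ)) (σ + t * Complex.I) -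
      ∑ j ∈ Finset.range K, b j * (Complex.Gamma (β j) *
        ((σ + t * Complex.I) - 1) ^ (-(β j : ℂ)))‖ ≤ B / (σ - 1) * (1 + |t|) ^ (1 / 2 : ℝ)) :
    ∃ C : ℝ, 0 ≤ C ∧ ∀ x : ℝ, Real.exp (1 / τ) ≤ x →
      ‖∫ v in (1 : ℝ)..x, (((∑ n ∈ Finset.Icc 1 ⌊v⌋₊, a n : ℝ) : ℂ) -
        ∑ j ∈ Finset.range K, b j * logPrimitive (β j - 1) v)‖ ≤ C * x ^ 2 * Real.log x := by
  obtain ⟨c, hc0, hc⟩ := exists_norm_primitive_le_of_mellin_bound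
  set A : ℝ → ℂ := fun v => ((∑ n ∈ Finset.Icc 1 ⌊v⌋₊, a n : ℝ) : ℂ) with hA
  set M : ℝ → ℂ := fun v => ∑ j ∈ Finset.range K, b j * (logPrimitive (β j - 1) v : ℂ) with hM
  set D : ℂ → ℂ := fun s => LSeries (fun n => (a n : ℂ)) s -
      ∑ j ∈ Finset.range K, b j * (Complex.Gamma (β j) * (s - 1) ^ (-(β j : ℂ))) with hDdef
  have hAm : Measurable A := by
    refine Complex.measurable_ofReal.comp ?_
    exact (measurable_from_nat (f := fun m => ∑ n ∈ Finset.Icc 1 m, a n)).comp Nat.measurable_floor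
  have hMm : Measurable M := by
    refine Finset.measurable_sum _ fun j hj => Measurable.const_mul ?_ _
    have := hβ j (Finset.mem_range.mp hj)
    exact (Complex.continuous_ofReal.comp (continuous_logPrimitive (by linarith))).measurable
  have hAO : ∀ r : ℝ, 1 < r → ∃ C : ℝ, ∀ v : ℝ, 1 < v → ‖A v‖ ≤ C * v ^ r := by
    intro r hr
    obtain ⟨C, hC⟩ := hO r hr
    refine ⟨C, fun v hv => ?_⟩
    rw [hA, Complex.norm_real, Real.norm_of_nonneg (Finset.sum_nonneg fun n _ => ha n)]
    exact hC v hv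
  have hPO : ∀ j ∈ Finset.range K, ∀ r : ℝ, 1 < r → ∃ C : ℝ, ∀ v : ℝ, 1 < v →
      ‖b j * (logPrimitive (β j - 1) v : ℂ)‖ ≤ C * v ^ r := by
    intro j hj r hr
    have hβj := hβ j (Finset.mem_range.mp hj)
    obtain ⟨C, hC⟩ := exists_log_rpow_le (β := β j - 1) (r := r - 1) (by linarith) (by linarith)
    refine ⟨‖b j‖ * C, fun v hv => ?_⟩
    rw [norm_mul, Complex.norm_real, Real.norm_of_nonneg (logPrimitive_nonneg hv.le), mul_assoc]
    refine mul_le_mul_of_nonneg_left ?_ (norm_nonneg _)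
    calc logPrimitive (β j - 1) v ≤ v * (C * v ^ (r - 1)) :=
          (logPrimitive_le (by linarith) hv.le).trans
            (mul_le_mul_of_nonneg_left (hC v hv.le) (by linarith))
      _ = C * v ^ r := by
        rw [mul_left_comm, ← Real.rpow_one_add' (by linarith) (by linarith)]
        congr 2; ring
  have hMO : ∀ r : ℝ, 1 < r → ∃ C : ℝ, ∀ v : ℝ, 1 < v → ‖M v‖ ≤ C * v ^ r := by
    intro r hr
    choose! C hC using fun j hj => hPO j hj r hr
    refine ⟨∑ j ∈ Finset.range K, C j, fun v hv => ?_⟩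
    rw [hM, Finset.sum_mul]
    exact norm_sum_le_of_le _ fun j hj => hC j hj v hv
  set E : ℝ → ℂ := (Ioi (1 : ℝ)).indicator fun v => A v - M v with hE
  have hEm : Measurable E := (hAm.sub hMm).indicator measurableSet_Ioi
  have hmel : ∀ s : ℂ, 1 < s.re → D s = s * ∫ v in Ioi (1 : ℝ), E v * (v : ℂ) ^ (-(s + 1)) := by
    intro s hs
    obtain ⟨CA, hCA⟩ := hAO ((1 + s.re) / 2) (by linarith)
    have hIA := integrableOn_mul_cpow_of_le (s := s) hAm hCA (by linarith)
    have hIP : ∀ j ∈ Finset.range K, IntegrableOn (fun v : ℝ =>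
        b j * (logPrimitive (β j - 1) v : ℂ) * (v : ℂ) ^ (-(s + 1))) (Ioi 1) := by
      intro j hj
      obtain ⟨C, hC⟩ := hPO j hj ((1 + s.re) / 2) (by linarith)
      have hβj := hβ j (Finset.mem_range.mp hj)
      refine integrableOn_mul_cpow_of_le (s := s) ?_ hC (by linarith)
      exact ((Complex.continuous_ofReal.comp
        (continuous_logPrimitive (by linarith))).measurable).const_mul _
    have h1 : ∫ v in Ioi (1 : ℝ), E v * (v : ℂ) ^ (-(s + 1)) =
        (∫ v in Ioi (1 : ℝ), A v * (v : ℂ) ^ (-(s + 1))) - ∑ j ∈ Finset.range K,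
          b j * ∫ v in Ioi (1 : ℝ), (logPrimitive (β j - 1) v : ℂ) * (v : ℂ) ^ (-(s + 1)) := by
      simp_rw [← integral_const_mul, ← mul_assoc]
      rw [← integral_finsetSum _ hIP, ← integral_sub hIA (integrable_finsetSum _ hIP)]
      refine setIntegral_congr_fun measurableSet_Ioi fun v hv => ?_
      simp only [hE, indicator_of_mem hv, hM, sub_mul, Finset.sum_mul]
    have h2 := LSeries_eq_mul_integral_of_nonneg a (r := (1 + s.re) / 2) (s := s) (by linarith)
      (by linarith) (by
        obtain ⟨C, hC⟩ := hO ((1 + s.re) / 2) (by linarith)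
        refine Asymptotics.IsBigO.of_bound C ?_
        filter_upwards [eventually_gt_atTop 1] with n hn
        have := hC n (by exact_mod_cast hn)
        rw [Nat.floor_natCast] at this
        rwa [Real.norm_of_nonneg (Finset.sum_nonneg fun n _ => ha n),
          Real.norm_of_nonneg (by positivity)]) ha
    rw [h1, mul_sub, Finset.mul_sum]
    simp only [hDdef, hA]
    rw [h2]
    push_cast
    congr 1
    refine Finset.sum_congr rfl fun j hj => ?_
    rw [mul_left_comm s, integral_logPrimitive_mul_cpow (hβ j (Finset.mem_range.mp hj)) hs]
  have habs : LSeries.abscissaOfAbsConv (fun n => (a n : ℂ)) ≤ 1 := by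
    refine LSeries.abscissaOfAbsConv_le_of_forall_lt_LSeriesSummable fun y hy => ?_
    obtain ⟨C, hC⟩ := hO ((1 + y) / 2) (by linarith)
    refine LSeriesSummable_of_sum_norm_bigO (r := (1 + y) / 2) ?_ (by linarith) (by simp; linarith)
    refine Asymptotics.IsBigO.of_bound C ?_
    filter_upwards [eventually_gt_atTop 1] with n hn
    have := hC n (by exact_mod_cast hn)
    rw [Nat.floor_natCast] at this
    simp_rw [Complex.norm_real, Real.norm_of_nonneg (ha _)]
    rwa [Real.norm_of_nonneg (Finset.sum_nonneg fun n _ => ha n),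
          Real.norm_of_nonneg (by positivity)]
  refine ⟨c * B * Real.exp 1, ?_, ?_⟩
  · have hB : 0 ≤ B := by
      have := (norm_nonneg _).trans (hD (1 + τ) 0 (by linarith) le_rfl)
      simp at this
      rwa [le_div_iff₀ hτ, zero_mul] at this
    positivity
  intro x hx
  have hx1 : 1 < x := (Real.one_lt_exp_iff.mpr (by positivity)).trans_le hx
  have hlog : 1 / τ ≤ Real.log x := (Real.le_log_iff_exp_le (by linarith)).mpr hx
  have hL : 0 < Real.log x := Real.log_pos hx1
  set σ : ℝ := 1 + 1 / Real.log x with hσ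
  have hσ1 : 1 < σ := by rw [hσ]; linarith [one_div_pos.mpr hL]
  have hre : ∀ t : ℝ, (σ + t * Complex.I : ℂ).re = σ := by simp
  have hcont : Continuous fun t : ℝ => D (σ + t * Complex.I) := by
    have hline : Continuous fun t : ℝ => (σ + t * Complex.I : ℂ) := by fun_prop
    refine Continuous.sub ?_ ?_
    · rw [continuous_iff_continuousAt]
      intro t
      have : DifferentiableAt ℂ (LSeries fun n => (a n : ℂ)) (σ + t * Complex.I) :=
        (LSeries_hasDerivAt (habs.trans_lt (by rw [hre]; exact_mod_cast hσ1))).differentiableAt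
      exact ContinuousAt.comp (f := fun t : ℝ => (σ + t * Complex.I : ℂ)) this.continuousAt
        hline.continuousAt
    · refine continuous_finsetSum _ fun j _ => continuous_const.mul (continuous_const.mul ?_)
      refine Continuous.cpow (by fun_prop) continuous_const fun t => Or.inl ?_
      simp; linarith
  have := hc E D σ (B / (σ - 1)) hEm (fun v hv => indicator_of_notMem (by simpa using hv) _) hσ1
    (fun r hr => by
      obtain ⟨C₁, h₁⟩ := hAO r hr
      obtain ⟨C₂, h₂⟩ := hMO r hr
      refine ⟨C₁ + C₂, fun v hv => ?_⟩
      rw [hE, indicator_of_mem (show v ∈ Ioi (1 : ℝ) from hv), add_mul]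
      exact (norm_sub_le _ _).trans (add_le_add (h₁ v hv) (h₂ v hv)))
    (fun t => hmel _ (by rw [hre]; exact hσ1)) hcont
    (fun t => hD σ t hσ1 (by
      rw [hσ]
      have := one_div_le_one_div_of_le (by positivity) hlog
      rw [one_div_one_div] at this
      linarith)) x (by linarith)
  have hI : ∫ v in (1 : ℝ)..x, E v = ∫ v in (1 : ℝ)..x, (A v - M v) := by
    rw [intervalIntegral.integral_of_le hx1.le, intervalIntegral.integral_of_le hx1.le]
    refine setIntegral_congr_fun measurableSet_Ioc fun v hv => ?_
    rw [hE, indicator_of_mem (show v ∈ Ioi (1 : ℝ) from hv.1)]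
  rw [hI] at this
  refine this.trans (le_of_eq ?_)
  have hxe : x ^ (σ + 1) = x ^ 2 * Real.exp 1 := by
    rw [hσ, show 1 + 1 / Real.log x + 1 = 2 + 1 / Real.log x by ring, Real.rpow_add (by linarith),
      Real.rpow_two]
    congr 1
    rw [Real.rpow_def_of_pos (by linarith), mul_one_div_cancel hL.ne']
  rw [hxe, hσ]
  field_simp
  ring

end Tauberian

section Tauberian
open MeasureTheory Set

lemma abs_sub_le_of_abs_integral_sub_le {A M : ℝ → ℝ} (hA : Monotone A) (hM : Continuous M)
    {C C₁ κ x₀ : ℝ} (hκ : 5 ≤ κ) (hC : 0 ≤ C) (hC₁ : 0 ≤ C₁)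
    (hLip : ∀ u v : ℝ, x₀ ≤ u → u ≤ v → |M v - M u| ≤ C₁ * Real.log v ^ κ * (v - u))
    (hI : ∀ x : ℝ, x₀ ≤ x → |∫ v in (1 : ℝ)..x, (A v - M v)| ≤ C * x ^ 2 * Real.log x) :
    ∃ C₂ x₁ : ℝ, ∀ x : ℝ, x₁ ≤ x → |A x - M x| ≤ C₂ * (x * Real.log x ^ (κ - 2)) := by
  refine ⟨9 * C + C₁ * 2 ^ κ, max (2 * x₀) (Real.exp 2), fun x hx => ?_⟩
  have hxe : Real.exp 2 ≤ x := (le_max_right _ _).trans hx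
  have hx0 : 0 < x := (Real.exp_pos 2).trans_le hxe
  have hx1 : 1 ≤ x := (Real.one_le_exp (by norm_num)).trans hxe
  have hx₀ : 2 * x₀ ≤ x := (le_max_left _ _).trans hx
  have hx₀' : x₀ ≤ x / 2 := by linarith
  set L := Real.log x with hL
  have hL2 : 2 ≤ L := (Real.le_log_iff_exp_le hx0).mpr hxe
  set δ : ℝ := (L ^ 2)⁻¹ with hδ
  have hδ0 : 0 < δ := by positivity
  have hδ2 : δ ≤ 1 / 2 := by
    rw [hδ, inv_le_comm₀ (by positivity) (by norm_num)]
    nlinarith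
  have hδL : δ * L ^ 2 = 1 := inv_mul_cancel₀ (by positivity)
  have hint : ∀ u v : ℝ, IntervalIntegrable (fun t => A t - M t) volume u v := fun u v =>
    (hA.intervalIntegrable).sub (hM.intervalIntegrable _ _)
  have hlog2x : ∀ v : ℝ, 1 ≤ v → v ≤ 2 * x → Real.log v ≤ 2 * L := by
    intro v hv1 hv
    calc Real.log v ≤ Real.log (x * x) := by
          refine Real.log_le_log (by linarith) (hv.trans ?_)
          nlinarith [Real.add_one_le_exp (2 : ℝ)]
      _ = 2 * L := by rw [Real.log_mul hx0.ne' hx0.ne']; ring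
  have hx2 : 1 ≤ x / 2 := by nlinarith [Real.add_one_le_exp (2 : ℝ)]
  have hlog0 : ∀ v, x / 2 ≤ v → 0 ≤ Real.log v := fun v hv => Real.log_nonneg (hx2.trans hv)
  have hdiff : ∀ u v : ℝ, x / 2 ≤ u → u ≤ v → v ≤ 2 * x → (u ≤ x ∨ v ≤ x) →
      |∫ t in u..v, (A t - M t)| ≤ 9 * C * x ^ 2 * L := by
    intro u v hu huv hv hor
    rw [← intervalIntegral.integral_interval_sub_left (hint 1 v) (hint 1 u)]
    refine (abs_sub _ _).trans ?_
    have h1 := hI u (hx₀'.trans hu)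
    have h2 := hI v (hx₀'.trans (hu.trans huv))
    have hlu := hlog0 u hu
    have hlv := hlog0 v (hu.trans huv)
    have hlv2 := hlog2x v (hx2.trans (hu.trans huv)) hv
    have hux : u ≤ x := by rcases hor with h | h <;> linarith
    have hlu2 : Real.log u ≤ L := Real.log_le_log (by linarith) hux
    have hv2 : C * v ^ 2 * Real.log v ≤ C * (2 * x) ^ 2 * (2 * L) := by
      gcongr
      linarith
    have hu2 : C * u ^ 2 * Real.log u ≤ C * x ^ 2 * L := by
      gcongr
      linarith
    nlinarith
  have hLκ : L ^ κ = L ^ (κ - 2) * L ^ 2 := by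
    rw [← Real.rpow_natCast, ← Real.rpow_add (by linarith)]; norm_num
  have hL3 : L ^ 3 ≤ L ^ (κ - 2) := by
    rw [← Real.rpow_natCast]
    exact Real.rpow_le_rpow_of_exponent_le (by linarith) (by push_cast; linarith)
  have hlip : ∀ u v : ℝ, x / 2 ≤ u → u ≤ v → v ≤ 2 * x →
      |M v - M u| ≤ C₁ * 2 ^ κ * L ^ κ * (v - u) := by
    intro u v hu huv hv
    refine (hLip u v (hx₀'.trans hu) huv).trans ?_
    refine mul_le_mul_of_nonneg_right ?_ (by linarith)
    rw [mul_assoc, ← Real.mul_rpow (by norm_num) (by linarith)]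
    exact mul_le_mul_of_nonneg_left (Real.rpow_le_rpow (hlog0 v (hu.trans huv))
      (hlog2x v (hx2.trans (hu.trans huv)) hv) (by linarith)) hC₁
  have hfinal : ∀ d : ℝ, d * (x * δ) ≤ 9 * C * x ^ 2 * L + C₁ * 2 ^ κ * L ^ κ * (x * δ) * (x * δ) →
      d ≤ (9 * C + C₁ * 2 ^ κ) * (x * L ^ (κ - 2)) := by
    intro d hd
    have h1 : 9 * C * x ^ 2 * L = 9 * C * x * L ^ 3 * (x * δ) := by
      linear_combination (- 9 * C * x ^ 2 * L) * hδL
    have h2 : C₁ * 2 ^ κ * L ^ κ * (x * δ) * (x * δ) = C₁ * 2 ^ κ * x * L ^ (κ - 2) * (x * δ) := by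
      rw [hLκ]
      linear_combination (C₁ * 2 ^ κ * L ^ (κ - 2) * x ^ 2 * δ) * hδL
    rw [h1, h2, ← add_mul] at hd
    have := le_of_mul_le_mul_right hd (by positivity)
    refine this.trans ?_
    have : 9 * C * x * L ^ 3 ≤ 9 * C * x * L ^ (κ - 2) := by gcongr
    linarith
  have hδx : x * δ ≤ x / 2 := by nlinarith
  have hδx0 : 0 < x * δ := by positivity
  rw [abs_le']
  constructor
  · refine hfinal _ ?_
    have hb := hdiff x (x + x * δ) (by linarith) (by linarith) (by linarith) (Or.inl le_rfl)
    have hmono : ∫ t in x..(x + x * δ), (A x - M x - C₁ * 2 ^ κ * L ^ κ * (x * δ)) ≤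
        ∫ t in x..(x + x * δ), (A t - M t) := by
      refine intervalIntegral.integral_mono_on (by linarith) (by simp) (hint _ _) fun t ht => ?_
      have h1 := hA ht.1
      have h2 := (abs_le.mp (hlip x t (by linarith) ht.1 (by linarith [ht.2]))).2
      have h3 : C₁ * 2 ^ κ * L ^ κ * (t - x) ≤ C₁ * 2 ^ κ * L ^ κ * (x * δ) := by
        gcongr; linarith [ht.2]
      linarith
    rw [intervalIntegral.integral_const, smul_eq_mul] at hmono
    have := le_of_abs_le hb
    linarith
  · refine hfinal _ ?_
    have hb := hdiff (x - x * δ) x (by linarith) (by linarith) (by linarith) (Or.inr le_rfl)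
    have hmono : ∫ t in (x - x * δ)..x, (A t - M t) ≤ 
        ∫ t in (x - x * δ)..x, (A x - M x + C₁ * 2 ^ κ * L ^ κ * (x * δ)) := by
      refine intervalIntegral.integral_mono_on (by linarith) (hint _ _) (by simp) fun t ht => ?_
      have h1 := hA ht.2
      have h2 := (abs_le.mp (hlip t x (by linarith [ht.1]) ht.2 (by linarith))).2
      have h3 : C₁ * 2 ^ κ * L ^ κ * (x - t) ≤ C₁ * 2 ^ κ * L ^ κ * (x * δ) := by
        gcongr; linarith [ht.1]
      linarith
    rw [intervalIntegral.integral_const, smul_eq_mul] at hmono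
    have := neg_le_of_abs_le hb
    linarith

lemma abs_logPrimitive_sub_le {β u v : ℝ} (hβ : 0 ≤ β) (hu : 1 ≤ u) (huv : u ≤ v) :
    |logPrimitive β v - logPrimitive β u| ≤ Real.log v ^ β * (v - u) := by
  have hc := continuous_log_max_rpow hβ
  rw [logPrimitive, logPrimitive, intervalIntegral.integral_interval_sub_left
    (hc.intervalIntegrable _ _) (hc.intervalIntegrable _ _), ← Real.norm_eq_abs]
  have := intervalIntegral.norm_integral_le_of_norm_le_const (a := u) (b := v)
    (f := fun w => Real.log (max 1 w) ^ β) (C := Real.log v ^ β) fun w hw => by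
      rw [uIoc_of_le huv] at hw
      have hw1 : 1 ≤ w := hu.trans hw.1.le
      rw [max_eq_right hw1, Real.norm_of_nonneg (Real.rpow_nonneg (Real.log_nonneg hw1) _)]
      exact Real.rpow_le_rpow (Real.log_nonneg hw1) (Real.log_le_log (by linarith) hw.2) hβ
  rwa [abs_of_nonneg (by linarith : 0 ≤ v - u)] at this

lemma logPrimitive_eq {β u : ℝ} (hβ : 1 ≤ β) (hu : 1 ≤ u) :
    logPrimitive β u = u * Real.log u ^ β - β * logPrimitive (β - 1) u := by
  have h : ∫ v in (1 : ℝ)..u, (Real.log (max 1 v) ^ β + β * Real.log (max 1 v) ^ (β - 1)) =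
      u * Real.log u ^ β - 1 * Real.log 1 ^ β := by
    refine intervalIntegral.integral_eq_sub_of_hasDerivAt_of_le (f := fun v => v * Real.log v ^ β)
      hu ?_ (fun v hv => ?_) ?_
    · refine continuousOn_id.mul (ContinuousOn.rpow_const ?_ fun _ _ => Or.inr (by linarith))
      exact Real.continuousOn_log.mono fun v hv => by simp; linarith [hv.1]
    · have hv0 : v ≠ 0 := by linarith [hv.1]
      refine ((hasDerivAt_id v).mul (((Real.hasDerivAt_log hv0)).rpow_const
        (p := β) (Or.inr hβ))).congr_deriv ?_
      rw [max_eq_right hv.1.le]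
      simp only [id_eq]
      field_simp
    · exact ((continuous_log_max_rpow (by linarith)).add
        (continuous_const.mul (continuous_log_max_rpow (by linarith)))).intervalIntegrable _ _
  rw [intervalIntegral.integral_add, intervalIntegral.integral_const_mul] at h
  · rw [Real.log_one, Real.zero_rpow (by linarith)] at h
    simp only [logPrimitive]
    linarith
  · exact (continuous_log_max_rpow (by linarith)).intervalIntegrable _ _
  · exact (continuous_const.mul (continuous_log_max_rpow (by linarith))).intervalIntegrable _ _

lemma logPrimitive_isBigO {β γ : ℝ} (hβ : 0 ≤ β) (h : β ≤ γ) :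
    logPrimitive β =O[atTop] fun x => x * Real.log x ^ γ := by
  refine Asymptotics.IsBigO.of_bound 1 ?_
  filter_upwards [eventually_ge_atTop (Real.exp 1)] with x hx
  have hx1 : 1 ≤ x := (Real.one_le_exp (by norm_num)).trans hx
  have hL : 1 ≤ Real.log x := (Real.le_log_iff_exp_le (by linarith)).mpr hx
  rw [Real.norm_of_nonneg (logPrimitive_nonneg hx1), Real.norm_of_nonneg (by positivity), one_mul]
  exact (logPrimitive_le hβ hx1).trans (mul_le_mul_of_nonneg_left
    (Real.rpow_le_rpow_of_exponent_le hL h) (by linarith))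

lemma logPrimitive_sub_isBigO {β : ℝ} (hβ : 1 ≤ β) :
    (fun x => logPrimitive β x - x * Real.log x ^ β) =O[atTop]
      fun x => x * Real.log x ^ (β - 1) := by
  refine ((logPrimitive_isBigO (β := β - 1) (by linarith) le_rfl).const_mul_left (-β)).congr' ?_
    EventuallyEq.rfl
  filter_upwards [eventually_ge_atTop 1] with x hx
  rw [logPrimitive_eq hβ hx]; ring

lemma logPrimitive_sub_sub_isBigO {β : ℝ} (hβ : 2 ≤ β) :
    (fun x => logPrimitive β x - x * (Real.log x ^ β - β * Real.log x ^ (β - 1))) =O[atTop]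
      fun x => x * Real.log x ^ (β - 2) := by
  have h := (logPrimitive_sub_isBigO (β := β - 1) (by linarith)).const_mul_left (-β)
  rw [show β - 1 - 1 = β - 2 by ring] at h
  refine h.congr' ?_ EventuallyEq.rfl
  filter_upwards [eventually_ge_atTop 1] with x hx
  rw [logPrimitive_eq (β := β) (by linarith) hx]; ring

end Tauberian

section Tauberian
open MeasureTheory Set

lemma one_isBigO_mul_log_rpow (γ : ℝ) :
    (fun _ : ℝ => (1 : ℝ)) =O[atTop] fun x : ℝ => x * Real.log x ^ γ := by
  have h := (isLittleO_log_rpow_rpow_atTop (s := 1) (-γ) one_pos).isBigO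
  refine (h.mul (Asymptotics.isBigO_refl (fun x : ℝ => Real.log x ^ γ) atTop)).congr' ?_ ?_
  · filter_upwards [eventually_gt_atTop 1] with x hx
    rw [← Real.rpow_add (Real.log_pos hx), neg_add_cancel, Real.rpow_zero]
  · exact Eventually.of_forall fun x => by simp

lemma sqrt_isBigO_mul_log_rpow (γ : ℝ) :
    (fun x : ℝ => √x) =O[atTop] fun x : ℝ => x * Real.log x ^ γ := by
  have h := (isLittleO_log_rpow_rpow_atTop (s := 1 / 2) (-γ) one_half_pos).isBigO
  refine ((h.mul (Asymptotics.isBigO_refl (fun x : ℝ => Real.log x ^ γ) atTop)).mul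
    (Asymptotics.isBigO_refl (fun x : ℝ => √x) atTop)).congr' ?_ ?_
  · filter_upwards [eventually_gt_atTop 1] with x hx
    rw [← Real.rpow_add (Real.log_pos hx), neg_add_cancel, Real.rpow_zero, one_mul]
  · filter_upwards [eventually_gt_atTop 1] with x hx
    rw [← Real.sqrt_eq_rpow, mul_right_comm, Real.mul_self_sqrt (by linarith)]

lemma continuousOn_log_rpow (γ : ℝ) :
    ContinuousOn (fun t : ℝ => Real.log t ^ γ) (Ici 2) := by
  refine ContinuousOn.rpow_const (Real.continuousOn_log.mono fun t ht => ?_) fun t ht => Or.inl ?_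
  · simp only [mem_Ici] at ht; simp; linarith
  · exact (Real.log_pos (by simp only [mem_Ici] at ht; linarith)).ne'

lemma intervalIntegrable_log_rpow (γ : ℝ) {u v : ℝ} (hu : 2 ≤ u) (hv : 2 ≤ v) :
    IntervalIntegrable (fun t : ℝ => Real.log t ^ γ) volume u v :=
  ((continuousOn_log_rpow γ).mono fun t ht => by
    rw [mem_uIcc] at ht
    simp only [mem_Ici]
    rcases ht with h | h <;> linarith).intervalIntegrable

lemma integral_log_rpow_isBigO {γ : ℝ} (hγ : γ ≤ 0) :
    (fun x : ℝ => ∫ t in (2 : ℝ)..x, Real.log t ^ γ) =O[atTop]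
      fun x : ℝ => x * Real.log x ^ γ := by
  have h : (fun x : ℝ => ∫ t in (2 : ℝ)..x, Real.log t ^ γ) =O[atTop] fun x : ℝ =>
      Real.log 2 ^ γ * √x + (1 / 2) ^ γ * (x * Real.log x ^ γ) := by
    refine Asymptotics.IsBigO.of_bound 1 ?_
    filter_upwards [eventually_ge_atTop 4] with x hx
    have hs2 : 2 ≤ √x := by rw [Real.le_sqrt (by norm_num) (by linarith)]; linarith
    have hsx : √x ≤ x := by
      nlinarith [Real.mul_self_sqrt (show (0 : ℝ) ≤ x by linarith)]
    have hlog2 : 0 < Real.log 2 := Real.log_pos (by norm_num)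
    have hlx : 0 < Real.log x := Real.log_pos (by linarith)
    have h1 := intervalIntegral.norm_integral_le_of_norm_le_const (a := 2) (b := √x)
      (f := fun w => Real.log w ^ γ) (C := Real.log 2 ^ γ) fun w hw => by
        rw [uIoc_of_le hs2] at hw
        rw [Real.norm_of_nonneg (Real.rpow_nonneg (Real.log_nonneg (by linarith [hw.1])) _)]
        exact Real.rpow_le_rpow_of_nonpos hlog2 (Real.log_le_log (by norm_num) hw.1.le) hγ
    have h2 := intervalIntegral.norm_integral_le_of_norm_le_const (a := √x) (b := x)
      (f := fun w => Real.log w ^ γ) (C := (1 / 2) ^ γ * Real.log x ^ γ) fun w hw => by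
        rw [uIoc_of_le hsx] at hw
        rw [Real.norm_of_nonneg (Real.rpow_nonneg (Real.log_nonneg (by linarith [hw.1])) _),
          ← Real.mul_rpow (by norm_num) hlx.le]
        refine Real.rpow_le_rpow_of_nonpos (by positivity) ?_ hγ
        have := Real.log_le_log (by linarith) hw.1.le
        rw [Real.log_sqrt (by linarith)] at this
        linarith
    rw [← intervalIntegral.integral_add_adjacent_intervals
      (intervalIntegrable_log_rpow γ le_rfl hs2) (intervalIntegrable_log_rpow γ hs2 (by linarith))]
    refine (norm_add_le _ _).trans ((add_le_add h1 h2).trans ?_)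
    rw [one_mul, Real.norm_of_nonneg (by positivity), abs_of_nonneg (by linarith),
      abs_of_nonneg (by linarith), ← mul_assoc, mul_right_comm]
    gcongr <;> linarith [Real.sqrt_nonneg x]
  exact h.trans (((sqrt_isBigO_mul_log_rpow γ).const_mul_left _).add
    ((Asymptotics.isBigO_refl _ _).const_mul_left _))

lemma integral_isBigO_of_isBigO_log_rpow {W : ℝ → ℝ} {γ : ℝ} (hγ : γ ≤ 0)
    (hint : ∀ x, 2 ≤ x → IntervalIntegrable W volume 2 x)
    (hW : W =O[atTop] fun t => Real.log t ^ γ) :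
    (fun x : ℝ => ∫ t in (2 : ℝ)..x, W t) =O[atTop] fun x : ℝ => x * Real.log x ^ γ := by
  obtain ⟨C, hC0, hC⟩ := hW.exists_nonneg
  obtain ⟨x₁, hx₁⟩ := eventually_atTop.mp hC.bound
  set y := max 2 x₁ with hy
  have hy2 : 2 ≤ y := le_max_left _ _
  have h : (fun x : ℝ => ∫ t in (2 : ℝ)..x, W t) =O[atTop] fun x : ℝ =>
      ‖∫ t in (2 : ℝ)..y, W t‖ * 1 + C * ∫ t in (2 : ℝ)..x, Real.log t ^ γ := by
    refine Asymptotics.IsBigO.of_bound 1 ?_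
    filter_upwards [eventually_ge_atTop y] with x hx
    have hnn : ∀ t : ℝ, 2 ≤ t → 0 ≤ Real.log t ^ γ := fun t ht =>
      Real.rpow_nonneg (Real.log_nonneg (by linarith)) _
    have hI2 : ∀ u v : ℝ, 2 ≤ u → u ≤ v → 0 ≤ ∫ t in u..v, Real.log t ^ γ := fun u v hu huv =>
      intervalIntegral.integral_nonneg huv fun t ht => hnn t (hu.trans ht.1)
    have hWyx : IntervalIntegrable W volume y x := (hint y hy2).symm.trans (hint x (hy2.trans hx))
    rw [← intervalIntegral.integral_add_adjacent_intervals (hint y hy2) hWyx]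
    have h2 : ‖∫ t in y..x, W t‖ ≤ C * ∫ t in y..x, Real.log t ^ γ := by
      rw [← intervalIntegral.integral_const_mul]
      refine intervalIntegral.norm_integral_le_of_norm_le hx ?_
        ((intervalIntegrable_log_rpow γ hy2 (hy2.trans hx)).const_mul C)
      refine Eventually.of_forall fun t ht => ?_
      have := hx₁ t ((le_max_right _ _).trans ht.1.le)
      rwa [Real.norm_of_nonneg (hnn t (hy2.trans ht.1.le))] at this
    have h3 : ∫ t in y..x, Real.log t ^ γ ≤ ∫ t in (2 : ℝ)..x, Real.log t ^ γ := by
      rw [← intervalIntegral.integral_add_adjacent_intervals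
        (intervalIntegrable_log_rpow γ le_rfl hy2)
        (intervalIntegrable_log_rpow γ hy2 (hy2.trans hx))]
      linarith [hI2 2 y le_rfl hy2]
    have h4 := hI2 2 x le_rfl (hy2.trans hx)
    refine (norm_add_le _ _).trans ?_
    rw [one_mul, mul_one, Real.norm_of_nonneg (r := ‖_‖ + _) (by positivity)]
    gcongr
    exact h2.trans (by gcongr)
  exact h.trans (((one_isBigO_mul_log_rpow γ).const_mul_left _).add
    ((integral_log_rpow_isBigO hγ).const_mul_left _))

lemma integral_log_rpow_sub_isBigO {γ : ℝ} (hγ : γ ≤ 1) :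
    (fun x : ℝ => (∫ t in (2 : ℝ)..x, Real.log t ^ γ) - x * Real.log x ^ γ) =O[atTop]
      fun x : ℝ => x * Real.log x ^ (γ - 1) := by
  have h := ((one_isBigO_mul_log_rpow (γ - 1)).const_mul_left (-(2 * Real.log 2 ^ γ))).add
    ((integral_log_rpow_isBigO (γ := γ - 1) (by linarith)).const_mul_left (-γ))
  refine h.congr' ?_ EventuallyEq.rfl
  filter_upwards [eventually_ge_atTop 2] with x hx
  have h2 : ∫ v in (2 : ℝ)..x, (Real.log v ^ γ + γ * Real.log v ^ (γ - 1)) =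
      x * Real.log x ^ γ - 2 * Real.log 2 ^ γ := by
    refine intervalIntegral.integral_eq_sub_of_hasDerivAt_of_le (f := fun v => v * Real.log v ^ γ)
      hx ?_ (fun v hv => ?_) ?_
    · exact continuousOn_id.mul ((continuousOn_log_rpow γ).mono fun t ht => ht.1)
    · have hv0 : v ≠ 0 := by linarith [hv.1]
      have hlv : Real.log v ≠ 0 := (Real.log_pos (by linarith [hv.1])).ne'
      refine ((hasDerivAt_id v).mul (((Real.hasDerivAt_log hv0)).rpow_const
        (p := γ) (Or.inl hlv))).congr_deriv ?_
      simp only [id_eq]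
      field_simp
    · exact (intervalIntegrable_log_rpow γ le_rfl hx).add
        ((intervalIntegrable_log_rpow _ le_rfl hx).const_mul _)
  rw [intervalIntegral.integral_add (intervalIntegrable_log_rpow γ le_rfl hx)
    ((intervalIntegrable_log_rpow _ le_rfl hx).const_mul _),
    intervalIntegral.integral_const_mul] at h2
  linarith

end Tauberian

section Tauberian
open MeasureTheory Set

lemma sum_logPrimitive_sub_isBigO {κ : ℝ} {K : ℕ} (hK : 2 ≤ K) (hκ : 5 ≤ κ) (hκK : K ≤ κ + 1)
    (c : ℕ → ℝ) :
    (fun x => ∑ j ∈ Finset.range K, c j * logPrimitive (κ - j) x -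
      x * (c 0 * Real.log x ^ κ + (c 1 - κ * c 0) * Real.log x ^ (κ - 1))) =O[atTop]
      fun x => x * Real.log x ^ (κ - 2) := by
  obtain ⟨m, rfl⟩ := Nat.exists_eq_add_of_le' hK
  have h0 := (logPrimitive_sub_sub_isBigO (β := κ) (by linarith)).const_mul_left (c 0)
  have h1 := (logPrimitive_sub_isBigO (β := κ - 1) (by linarith)).const_mul_left (c 1)
  rw [show κ - 1 - 1 = κ - 2 by ring] at h1
  have h2 : (fun x => ∑ j ∈ Finset.range m, c (j + 2) * logPrimitive (κ - (j + 2 : ℕ)) x)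
      =O[atTop] fun x => x * Real.log x ^ (κ - 2) := by
    refine Asymptotics.IsBigO.fun_sum fun j hj =>
      (logPrimitive_isBigO (β := κ - (j + 2 : ℕ)) ?_ ?_).const_mul_left _
    · have hj' : ((j + 1 : ℕ) : ℝ) ≤ m := by exact_mod_cast Finset.mem_range.mp hj
      push_cast at hj' hκK ⊢
      linarith
    · push_cast
      linarith [(Nat.cast_nonneg j : (0 : ℝ) ≤ j)]
  refine ((h0.add h1).add h2).congr_left fun x => ?_
  rw [Finset.sum_range_succ', Finset.sum_range_succ']
  simp only [add_assoc, Nat.reduceAdd, Nat.cast_zero, Nat.cast_one, zero_add, sub_zero]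
  ring

/-- A Tauberian theorem for the summatory function of `f` weighted by a power of `log`. -/
lemma sum_mul_log_pow_sub_isBigO {f : ℕ → ℝ} (hf0 : ∀ n, 0 ≤ f n) (hf1 : ∀ n, f n ≤ 1)
    {α : ℝ} (hα : 0 < α) {b : ℕ → ℂ} {τ B : ℝ} (hτ : 0 < τ)
    (hD : ∀ σ t : ℝ, 1 < σ → σ ≤ 1 + τ →
      ‖LSeries (fun n => ((f n * Real.log n ^ 6 : ℝ) : ℂ)) (σ + t * Complex.I) -
      ∑ j ∈ Finset.range 6, b j * (Complex.Gamma ((α + 6 - j : ℝ)) *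
        ((σ + t * Complex.I) - 1) ^ (-((α + 6 - j : ℝ) : ℂ)))‖
          ≤ B / (σ - 1) * (1 + |t|) ^ (1 / 2 : ℝ)) :
    (fun x : ℝ => ∑ n ∈ Finset.Icc 1 ⌊x⌋₊, f n * Real.log n ^ 6 -
      x * ((b 0).re * Real.log x ^ (α + 5) +
        ((b 1).re - (α + 5) * (b 0).re) * Real.log x ^ (α + 4))) =O[atTop]
      fun x : ℝ => x * Real.log x ^ (α + 3) := by
  have ha : ∀ n : ℕ, 0 ≤ f n * Real.log n ^ 6 := fun n =>
    mul_nonneg (hf0 n) (by positivity)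
  have hO : ∀ r : ℝ, 1 < r → ∃ C : ℝ, ∀ v : ℝ, 1 < v →
      ∑ n ∈ Finset.Icc 1 ⌊v⌋₊, f n * Real.log n ^ 6 ≤ C * v ^ r := by
    intro r hr
    obtain ⟨C, hC⟩ := exists_log_rpow_le (β := 6) (r := r - 1) (by norm_num) (by linarith)
    refine ⟨C, fun v hv => ?_⟩
    have hv0 : 0 < v := by linarith
    have hLC : 0 ≤ C * v ^ (r - 1) :=
      (Real.rpow_nonneg (Real.log_nonneg hv.le) _).trans (hC v hv.le)
    calc ∑ n ∈ Finset.Icc 1 ⌊v⌋₊, f n * Real.log n ^ 6 ≤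
        ∑ n ∈ Finset.Icc 1 ⌊v⌋₊, C * v ^ (r - 1) := by
          refine Finset.sum_le_sum fun n hn => ?_
          obtain ⟨hn1, hn2⟩ := Finset.mem_Icc.mp hn
          have hn1' : (1 : ℝ) ≤ n := by exact_mod_cast hn1
          have hnv : (n : ℝ) ≤ v := (Nat.le_floor_iff hv0.le).mp hn2
          have hl : Real.log n ^ 6 ≤ Real.log v ^ 6 :=
            pow_le_pow_left₀ (Real.log_nonneg hn1') (Real.log_le_log (by linarith) hnv) 6
          have h6 : Real.log v ^ 6 ≤ C * v ^ (r - 1) := by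
            have := hC v hv.le
            rwa [show (6 : ℝ) = (6 : ℕ) by norm_num, Real.rpow_natCast] at this
          calc f n * Real.log n ^ 6 ≤ 1 * Real.log n ^ 6 := by gcongr; exact hf1 n
            _ ≤ _ := by linarith
      _ = ⌊v⌋₊ * (C * v ^ (r - 1)) := by simp
      _ ≤ v * (C * v ^ (r - 1)) := by gcongr; exact Nat.floor_le hv0.le
      _ = C * v ^ r := by
        rw [mul_left_comm, ← Real.rpow_one_add' hv0.le (by linarith)]
        congr 2; ring
  obtain ⟨C, hC0, hC⟩ := exists_norm_integral_sub_logPrimitive_le ha hO (K := 6) (b := b)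
    (β := fun j => α + 6 - j) (fun j hj => by
      have : ((j + 1 : ℕ) : ℝ) ≤ 6 := by exact_mod_cast hj
      push_cast at this
      linarith) hτ hD
  set A : ℝ → ℝ := fun v => ∑ n ∈ Finset.Icc 1 ⌊v⌋₊, f n * Real.log n ^ 6 with hA
  set M : ℝ → ℝ := fun v => ∑ j ∈ Finset.range 6, (b j).re * logPrimitive (α + 5 - j) v with hM
  have hexp : ∀ j : ℕ, α + 6 - j - 1 = α + 5 - j := fun j => by ring
  have hj5 : ∀ j ∈ Finset.range 6, 0 ≤ α + 5 - j := fun j hj => by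
    have : ((j + 1 : ℕ) : ℝ) ≤ 6 := by exact_mod_cast Finset.mem_range.mp hj
    push_cast at this
    linarith
  have hAmono : Monotone A := fun u v huv => by
    refine Finset.sum_le_sum_of_subset_of_nonneg
      (Finset.Icc_subset_Icc_right (Nat.floor_le_floor huv)) fun n _ _ => ha n
  have hMcont : Continuous M := by
    refine continuous_finsetSum _ fun j hj => ?_
    exact continuous_const.mul (continuous_logPrimitive (hj5 j hj))
  obtain ⟨C₂, x₁, h₂⟩ := abs_sub_le_of_abs_integral_sub_le hAmono hMcont (C := C)
    (C₁ := ∑ j ∈ Finset.range 6, |(b j).re|) (κ := α + 5)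
    (x₀ := max (Real.exp 1) (Real.exp (1 / τ))) (by linarith) hC0
    (Finset.sum_nonneg fun _ _ => abs_nonneg _) (fun u v hu huv => by
      have hu1 : 1 ≤ u := (Real.one_le_exp (by norm_num)).trans ((le_max_left _ _).trans hu)
      have hve : Real.exp 1 ≤ v := (le_max_left _ _).trans (hu.trans huv)
      have hLv : 1 ≤ Real.log v := (Real.le_log_iff_exp_le (by linarith)).mpr hve
      simp only [hM]
      rw [← Finset.sum_sub_distrib, Finset.sum_mul, Finset.sum_mul]
      refine (Finset.abs_sum_le_sum_abs _ _).trans (Finset.sum_le_sum fun j hj => ?_)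
      rw [← mul_sub, abs_mul, mul_assoc]
      refine mul_le_mul_of_nonneg_left ((abs_logPrimitive_sub_le (hj5 j hj) hu1 huv).trans ?_)
        (abs_nonneg _)
      refine mul_le_mul_of_nonneg_right (Real.rpow_le_rpow_of_exponent_le hLv ?_) (by linarith)
      linarith [(Nat.cast_nonneg j : (0 : ℝ) ≤ j)])
    (fun x hx => by
      have h := hC x ((le_max_right _ _).trans hx)
      refine le_trans ?_ h
      have hre : ∫ v in (1 : ℝ)..x, (A v - M v) = (∫ v in (1 : ℝ)..x, (((A v : ℝ) : ℂ) -
          ∑ j ∈ Finset.range 6, b j * logPrimitive (α + 6 - j - 1) v)).re := by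
        have hi : IntervalIntegrable (fun v : ℝ => ((A v : ℝ) : ℂ) -
            ∑ j ∈ Finset.range 6, b j * logPrimitive (α + 6 - j - 1) v) volume 1 x := by
          refine IntervalIntegrable.sub ?_ ?_
          · have := hAmono.intervalIntegrable (μ := volume) (a := 1) (b := x)
            exact ⟨this.1.ofReal, this.2.ofReal⟩
          · refine Continuous.intervalIntegrable ?_ _ _
            refine continuous_finsetSum _ fun j hj => continuous_const.mul
              (Complex.continuous_ofReal.comp (continuous_logPrimitive ?_))
            rw [hexp]; exact hj5 j hj
        have := intervalIntegral.intervalIntegral_re (𝕜 := ℂ) hi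
        refine Eq.trans ?_ this
        refine intervalIntegral.integral_congr fun v _ => ?_
        simp [hM, hexp, Complex.re_sum]
      rw [hre]
      exact Complex.abs_re_le_norm _)
  have h3 : (fun x => A x - M x) =O[atTop] fun x : ℝ => x * Real.log x ^ (α + 3) := by
    refine Asymptotics.IsBigO.of_bound C₂ ?_
    filter_upwards [eventually_ge_atTop x₁, eventually_ge_atTop 1] with x hx hx1
    have := h₂ x hx
    rw [show α + 5 - 2 = α + 3 by ring] at this
    have hnn : 0 ≤ x * Real.log x ^ (α + 3) :=
      mul_nonneg (by linarith) (Real.rpow_nonneg (Real.log_nonneg hx1) _)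
    rwa [Real.norm_eq_abs, Real.norm_of_nonneg hnn]
  have h4 := sum_logPrimitive_sub_isBigO (κ := α + 5) (K := 6) (by norm_num) (by linarith)
    (by push_cast; linarith) (fun j => (b j).re)
  rw [show α + 5 - 2 = α + 3 by ring, show α + 5 - 1 = α + 4 by ring] at h4
  exact (h3.add h4).congr_left fun x => by simp only [hM]; ring

/-- Removing the logarithmic weight by partial summation. -/
lemma sum_sub_isBigO_of_sum_mul_log_pow {f : ℕ → ℝ} {α B₀ B₁ : ℝ} (hα1 : α < 1)
    (h : (fun x : ℝ => ∑ n ∈ Finset.Icc 1 ⌊x⌋₊, f n * Real.log n ^ 6 -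
      x * (B₀ * Real.log x ^ (α + 5) + B₁ * Real.log x ^ (α + 4))) =O[atTop]
      fun x : ℝ => x * Real.log x ^ (α + 3)) :
    (fun x : ℝ => ∑ n ∈ Finset.Icc 1 ⌊x⌋₊, f n -
      x * (B₀ * Real.log x ^ (α - 1) + (B₁ + 6 * B₀) * Real.log x ^ (α - 2))) =O[atTop]
      fun x : ℝ => x * Real.log x ^ (α - 3) := by
  set c : ℕ → ℝ := fun n => f n * Real.log n ^ 6 with hc
  set A : ℝ → ℝ := fun v => ∑ n ∈ Finset.Icc 0 ⌊v⌋₊, c n with hA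
  have hc0 : c 0 = 0 := by simp [hc]
  have hc1 : c 1 = 0 := by simp [hc]
  have hAIcc : ∀ v, ∑ n ∈ Finset.Icc 1 ⌊v⌋₊, c n = A v := fun v => by
    simp only [hA]
    rw [Finset.Icc_eq_cons_Ioc (Nat.zero_le _), Finset.sum_cons, hc0, zero_add]; rfl
  have hmulpow : ∀ (w γ : ℝ) (n : ℕ), 0 < w → w ^ γ * (w ^ n)⁻¹ = w ^ (γ - n) := fun w γ n hw => by
    rw [Real.rpow_sub hw, Real.rpow_natCast, div_eq_mul_inv]
  simp_rw [hAIcc] at h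
  set W : ℝ → ℝ := fun t => A t / t * (Real.log t ^ 7)⁻¹ - B₀ * Real.log t ^ (α - 2) with hW
  have hgd : ∀ t : ℝ, 2 ≤ t → HasDerivAt (fun t => (Real.log t ^ 6)⁻¹)
      (-6 * (t⁻¹ * (Real.log t ^ 7)⁻¹)) t := fun t ht => by
    have hl : Real.log t ≠ 0 := (Real.log_pos (by linarith)).ne'
    refine (((Real.hasDerivAt_log (by linarith : t ≠ 0)).pow 6).inv (pow_ne_zero 6 hl)).congr_deriv ?_
    field_simp
    push_cast
    simp
    field_simp
  have hgc : ContinuousOn (fun t : ℝ => t⁻¹ * (Real.log t ^ 7)⁻¹) (Ici 2) := by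
    have h2 : ∀ t ∈ Ici (2 : ℝ), t ≠ 0 := fun t ht => by simp only [mem_Ici] at ht; linarith
    refine (continuousOn_id.inv₀ h2).mul
      (((Real.continuousOn_log.mono fun t ht => h2 t ht).pow 7).inv₀ fun t ht => ?_)
    exact pow_ne_zero 7 (Real.log_pos (by simp only [mem_Ici] at ht; linarith)).ne'
  have hgint : ∀ x : ℝ, IntegrableOn (fun t : ℝ => t⁻¹ * (Real.log t ^ 7)⁻¹) (Icc 2 x) := fun x =>
    (hgc.mono fun t ht => ht.1).integrableOn_Icc
  have hAint : ∀ x : ℝ, 2 ≤ x →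
      IntervalIntegrable (fun t => A t / t * (Real.log t ^ 7)⁻¹) volume 2 x := by
    intro x hx
    rw [intervalIntegrable_iff_integrableOn_Icc_of_le hx]
    refine (integrableOn_mul_sum_Icc c (m := 0) (by norm_num) (hgint x)).congr_fun
      (fun t _ => ?_) measurableSet_Icc
    simp only [hA]; ring
  have hWint : ∀ x : ℝ, 2 ≤ x → IntervalIntegrable W volume 2 x := fun x hx =>
    (hAint x hx).sub ((intervalIntegrable_log_rpow _ le_rfl hx).const_mul _)
  have hAO : (fun t => A t / t * (Real.log t ^ 7)⁻¹ - B₀ * Real.log t ^ (α - 2) -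
      B₁ * Real.log t ^ (α - 3)) =O[atTop] fun t => Real.log t ^ (α - 4) := by
    refine (h.mul (Asymptotics.isBigO_refl
      (fun t : ℝ => t⁻¹ * (Real.log t ^ 7)⁻¹) atTop)).congr' ?_ ?_
    · filter_upwards [eventually_gt_atTop 1] with t ht
      have hl := Real.log_pos ht
      have e1 := hmulpow (Real.log t) (α + 5) 7 hl
      have e2 := hmulpow (Real.log t) (α + 4) 7 hl
      rw [show α + 5 - (7 : ℕ) = α - 2 by push_cast; ring] at e1
      rw [show α + 4 - (7 : ℕ) = α - 3 by push_cast; ring] at e2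
      rw [← e1, ← e2]
      have ht0 : t ≠ 0 := by linarith
      field_simp
      ring
    · filter_upwards [eventually_gt_atTop 1] with t ht
      have hl := Real.log_pos ht
      have e1 := hmulpow (Real.log t) (α + 3) 7 hl
      rw [show α + 3 - (7 : ℕ) = α - 4 by push_cast; ring] at e1
      rw [← e1]
      have ht0 : t ≠ 0 := by linarith
      field_simp
  have hlogO : ∀ {γ γ' : ℝ}, γ ≤ γ' →
      (fun t : ℝ => Real.log t ^ γ) =O[atTop] fun t : ℝ => Real.log t ^ γ' := by
    intro γ γ' hγ
    refine Asymptotics.IsBigO.of_bound 1 ?_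
    filter_upwards [eventually_ge_atTop (Real.exp 1)] with x hx
    have hL : 1 ≤ Real.log x := (Real.le_log_iff_exp_le ((Real.exp_pos 1).trans_le hx)).mpr hx
    rw [Real.norm_of_nonneg (by positivity), Real.norm_of_nonneg (by positivity), one_mul]
    exact Real.rpow_le_rpow_of_exponent_le hL hγ
  have hWO : W =O[atTop] fun t => Real.log t ^ (α - 3) :=
    ((hAO.trans (hlogO (by linarith))).add
      ((Asymptotics.isBigO_refl _ _).const_mul_left B₁)).congr_left fun t => by
        simp only [hW]; ring
  have hWI := (integral_isBigO_of_isBigO_log_rpow (by linarith) hWint hWO).const_mul_left 6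
  have hLI := (integral_log_rpow_sub_isBigO (γ := α - 2) (by linarith)).const_mul_left (6 * B₀)
  rw [show α - 2 - 1 = α - 3 by ring] at hLI
  have hAx : (fun x => A x * (Real.log x ^ 6)⁻¹ -
      x * (B₀ * Real.log x ^ (α - 1) + B₁ * Real.log x ^ (α - 2))) =O[atTop]
      fun x => x * Real.log x ^ (α - 3) := by
    refine (h.mul (Asymptotics.isBigO_refl (fun t : ℝ => (Real.log t ^ 6)⁻¹) atTop)).congr' ?_ ?_
    · filter_upwards [eventually_gt_atTop 1] with t ht
      have hl := Real.log_pos ht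
      have e1 := hmulpow (Real.log t) (α + 5) 6 hl
      have e2 := hmulpow (Real.log t) (α + 4) 6 hl
      rw [show α + 5 - (6 : ℕ) = α - 1 by push_cast; ring] at e1
      rw [show α + 4 - (6 : ℕ) = α - 2 by push_cast; ring] at e2
      rw [← e1, ← e2]
      ring
    · filter_upwards [eventually_gt_atTop 1] with t ht
      have e1 := hmulpow (Real.log t) (α + 3) 6 (Real.log_pos ht)
      rw [show α + 3 - (6 : ℕ) = α - 3 by push_cast; ring] at e1
      rw [← e1]
      ring
  refine ((((one_isBigO_mul_log_rpow (α - 3)).const_mul_left (f 1)).add hAx).add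
    (hWI.add hLI)).congr' ?_ EventuallyEq.rfl
  filter_upwards [eventually_ge_atTop 2] with x hx
  have habel := sum_mul_eq_sub_integral_mul₁ c (f := fun t => (Real.log t ^ 6)⁻¹) hc0 hc1 x
    (fun t ht => (hgd t ht.1).differentiableAt)
    (IntegrableOn.congr_fun ((hgint x).const_mul (-6)) (fun t ht => (hgd t ht.1).deriv.symm) measurableSet_Icc)
  have hsum : ∑ n ∈ Finset.Icc 1 ⌊x⌋₊, f n =
      f 1 + ∑ k ∈ Finset.Icc 0 ⌊x⌋₊, (Real.log k ^ 6)⁻¹ * c k := by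
    have h1 : 1 ≤ ⌊x⌋₊ := (Nat.one_le_floor_iff _).mpr (by linarith)
    rw [Finset.Icc_eq_cons_Ioc (Nat.zero_le _), Finset.sum_cons, hc0, mul_zero, zero_add,
      ← Finset.Icc_add_one_left_eq_Ioc, zero_add, Finset.Icc_eq_cons_Ioc h1, Finset.sum_cons,
      Finset.sum_cons, hc1, mul_zero, zero_add]
    congr 1
    refine Finset.sum_congr rfl fun n hn => ?_
    have hn1 : (1 : ℝ) < n := by exact_mod_cast (Finset.mem_Ioc.mp hn).1
    have := (Real.log_pos hn1).ne'
    simp only [hc]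
    field_simp
  have hint : ∫ t in Ioc 2 x, deriv (fun t => (Real.log t ^ 6)⁻¹) t * ∑ k ∈ Finset.Icc 0 ⌊t⌋₊, c k =
      -6 * ((∫ t in (2 : ℝ)..x, W t) + B₀ * ∫ t in (2 : ℝ)..x, Real.log t ^ (α - 2)) := by
    rw [← intervalIntegral.integral_const_mul B₀, ← intervalIntegral.integral_add (hWint x hx)
      ((intervalIntegrable_log_rpow _ le_rfl hx).const_mul _),
      ← intervalIntegral.integral_const_mul, intervalIntegral.integral_of_le hx]
    refine setIntegral_congr_fun measurableSet_Ioc fun t ht => ?_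
    simp only [(hgd t ht.1.le).deriv, hW, hA]
    ring
  rw [hsum, habel, hint]
  simp only [hA]
  ring

end Tauberian

section LFunctionBounds
open Set

lemma norm_cpow_neg_sub_cpow_neg_le {n u : ℝ} (hn : 1 ≤ n) (hnu : n ≤ u) (hu : u ≤ n + 1) {s : ℂ}
    (hs : 0 < s.re) {θ : ℝ} (hθ0 : 0 < θ) (hθ1 : θ < 1) :
    ‖(n : ℂ) ^ (-s) - (u : ℂ) ^ (-s)‖ ≤ 2 * ‖s‖ ^ θ * n ^ (-s.re - θ) := by
  have hn0 : 0 < n := by linarith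
  have hu0 : 0 < u := by linarith
  set a := ‖(n : ℂ) ^ (-s) - (u : ℂ) ^ (-s)‖ with ha
  have h1 : a ≤ 2 * n ^ (-s.re) := by
    refine (norm_sub_le _ _).trans ?_
    rw [Complex.norm_cpow_eq_rpow_re_of_pos hn0, Complex.norm_cpow_eq_rpow_re_of_pos hu0,
      Complex.neg_re, two_mul]
    exact add_le_add le_rfl (Real.rpow_le_rpow_of_nonpos hn0 hnu (by simpa using hs.le))
  have h2 : a ≤ ‖s‖ * n ^ (-s.re - 1) := by
    have hd : ∀ w ∈ Icc n u, HasDerivWithinAt (fun w : ℝ => (w : ℂ) ^ (-s))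
        (-s * (w : ℂ) ^ (-s - 1)) (Icc n u) w := fun w hw =>
      (hasDerivAt_ofReal_cpow_const (by linarith [hw.1] : w ≠ 0)
        (by simpa using fun h => hs.ne' (by simp [h]))).hasDerivWithinAt
    have := Convex.norm_image_sub_le_of_norm_hasDerivWithin_le (C := ‖s‖ * n ^ (-s.re - 1)) hd
      (fun w hw => by
        have hw0 : 0 < w := by linarith [hw.1]
        rw [norm_mul, norm_neg, Complex.norm_cpow_eq_rpow_re_of_pos hw0]
        gcongr
        simp only [Complex.sub_re, Complex.neg_re, Complex.one_re]
        exact Real.rpow_le_rpow_of_nonpos hn0 hw.1 (by linarith))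
      (convex_Icc n u) (right_mem_Icc.mpr hnu) (left_mem_Icc.mpr hnu)
    refine this.trans ?_
    rw [Real.norm_eq_abs, abs_of_nonpos (by linarith)]
    have : 0 ≤ ‖s‖ * n ^ (-s.re - 1) := by positivity
    nlinarith
  rcases (show 0 ≤ a from norm_nonneg _).eq_or_lt with h0 | h0
  · rw [← h0]; positivity
  calc a = a ^ (1 - θ) * a ^ θ := by rw [← Real.rpow_add h0]; simp
    _ ≤ (2 * n ^ (-s.re)) ^ (1 - θ) * (‖s‖ * n ^ (-s.re - 1)) ^ θ := by
      gcongr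
    _ = 2 ^ (1 - θ) * ‖s‖ ^ θ * n ^ (-s.re - θ) := by
      rw [Real.mul_rpow (by norm_num) (by positivity), Real.mul_rpow (by positivity) (by positivity),
        ← Real.rpow_mul hn0.le, ← Real.rpow_mul hn0.le]
      have : n ^ (-s.re - θ) = n ^ (-s.re * (1 - θ)) * n ^ ((-s.re - 1) * θ) := by
        rw [← Real.rpow_add hn0]; congr 1; ring
      rw [this]; ring
    _ ≤ _ := by
      gcongr
      calc (2 : ℝ) ^ (1 - θ) ≤ 2 ^ (1 : ℝ) :=
            Real.rpow_le_rpow_of_exponent_le (by norm_num) (by linarith)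
        _ = 2 := by simp

lemma exists_norm_sum_range_le {q : ℕ} [NeZero q] {χ : DirichletCharacter ℂ q} (hχ : χ ≠ 1) :
    ∃ B : ℝ, 0 ≤ B ∧ ∀ N : ℕ, ‖∑ k ∈ Finset.range N, χ (k : ZMod q)‖ ≤ B := by
  set S : ℕ → ℂ := fun N => ∑ k ∈ Finset.range N, χ (k : ZMod q) with hS
  have hSq : S q = 0 := by
    rw [← MulChar.sum_eq_zero_of_ne_one hχ]
    refine Finset.sum_nbij' (fun k => (k : ZMod q)) ZMod.val (by simp)
      (fun a _ => by simpa using ZMod.val_lt a) (fun k hk => ?_) (by simp) (by simp)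
    exact ZMod.val_natCast_of_lt (by simpa using hk)
  have hper : Function.Periodic S q := by
    intro N
    induction N with
    | zero => rw [zero_add, hSq]; simp [hS]
    | succ N ih =>
      have h1 : S (N + 1 + q) = S (N + q) + χ ((N + q : ℕ) : ZMod q) := by
        rw [show N + 1 + q = N + q + 1 by ring]
        exact Finset.sum_range_succ _ _
      have h2 : S (N + 1) = S N + χ (N : ZMod q) := Finset.sum_range_succ _ _
      rw [h1, h2, ih]; simp
  refine ⟨∑ i ∈ Finset.range q, ‖S i‖, by positivity, fun N => ?_⟩
  have : S N = S (N % q) := (hper.map_mod_nat N).symm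
  change ‖S N‖ ≤ _
  rw [this]
  exact Finset.single_le_sum (f := fun i => ‖S i‖) (fun _ _ => norm_nonneg _)
    (Finset.mem_range.mpr (Nat.mod_lt _ (NeZero.pos q)))

/-- A function given on `1 < re s` by a series of functions whose terms decay uniformly in
`1 - η < re s` is bounded there by the same weight. -/
lemma exists_norm_le_of_eq_tsum {η : ℝ} (hη0 : 0 < η) {L : ℂ → ℂ} {w : ℂ → ℝ}
    (hw : Continuous w) (_hw0 : ∀ s, 0 ≤ w s) {g : ℕ → ℂ → ℂ} (hg : ∀ n, Differentiable ℂ (g n))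
    (hL : DifferentiableOn ℂ L {s | 1 - η < s.re})
    (hbd : ∀ n s, 1 - η < s.re → ‖g n s‖ ≤ w s * ((n : ℝ) + 1) ^ (-1 - η))
    (heq : ∀ s : ℂ, 1 < s.re → L s = ∑' n, g n s) :
    ∃ C : ℝ, 0 ≤ C ∧ ∀ s : ℂ, 1 - η < s.re → ‖L s‖ ≤ C * w s := by
  have hsum : Summable fun n : ℕ => ((n : ℝ) + 1) ^ (-1 - η) := by
    have := (summable_nat_add_iff 1).mpr (Real.summable_nat_rpow.mpr (by linarith : -1 - η < -1))
    simpa using this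
  have hopen : IsOpen {s : ℂ | 1 - η < s.re} := isOpen_lt continuous_const Complex.continuous_re
  have hdiff : DifferentiableOn ℂ (fun s => ∑' n, g n s) {s | 1 - η < s.re} := by
    intro s hs
    have hU : IsOpen ({s : ℂ | 1 - η < s.re} ∩ {z | w z < w s + 1}) :=
      hopen.inter (isOpen_lt hw continuous_const)
    have hd := Complex.differentiableOn_tsum_of_summable_norm (F := g)
      (hsum.mul_left (w s + 1)) (fun n => (hg n).differentiableOn) hU (fun n z hz =>
        (hbd n z hz.1).trans (mul_le_mul_of_nonneg_right hz.2.le (by positivity)))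
    exact (hd.differentiableAt (hU.mem_nhds ⟨hs, by simp⟩)).differentiableWithinAt
  have hEq : ∀ s : ℂ, 1 - η < s.re → L s = ∑' n, g n s := by
    have hconn : IsPreconnected {s : ℂ | 1 - η < s.re} :=
      (convex_halfSpace_re_gt (1 - η)).isPreconnected
    refine fun s hs => (hL.analyticOnNhd hopen).eqOn_of_preconnected_of_eventuallyEq
      (hdiff.analyticOnNhd hopen) hconn (z₀ := 2) (by simp; linarith) ?_ hs
    filter_upwards [(isOpen_lt continuous_const Complex.continuous_re).mem_nhds
      (by norm_num : (1 : ℝ) < (2 : ℂ).re)] with s hs using heq s hs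
  refine ⟨∑' n : ℕ, ((n : ℝ) + 1) ^ (-1 - η), tsum_nonneg fun _ => by positivity, fun s hs => ?_⟩
  rw [hEq s hs, mul_comm, ← tsum_mul_left]
  exact tsum_of_norm_bounded (hsum.mul_left _).hasSum fun n => hbd n s hs

lemma differentiable_natCast_add_one_cpow (n : ℕ) (a : ℂ) :
    Differentiable ℂ fun s : ℂ => ((n : ℂ) + 1) ^ (a - s) := fun s =>
  ((differentiableAt_const a).sub differentiableAt_id).const_cpow
    (Or.inl (by exact_mod_cast Nat.succ_ne_zero n))

lemma sum_mul_cpow_eq (c : ℕ → ℂ) (s : ℂ) (N : ℕ) :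
    ∑ n ∈ Finset.range N, c (n + 1) * ((n : ℂ) + 1) ^ (-s) =
      (∑ k ∈ Finset.range N, c (k + 1)) * ((N : ℂ) + 1) ^ (-s) +
      ∑ n ∈ Finset.range N, (∑ k ∈ Finset.range (n + 1), c (k + 1)) *
        (((n : ℂ) + 1) ^ (-s) - ((n : ℂ) + 1 + 1) ^ (-s)) := by
  induction N with
  | zero => simp
  | succ N ih =>
    simp only [Finset.sum_range_succ _ N]
    rw [ih]
    push_cast
    ring

lemma tendsto_natCast_add_one_cpow {s : ℂ} (hs : s.re < 0) :
    Tendsto (fun N : ℕ => ((N : ℂ) + 1) ^ s) atTop (𝓝 0) := by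
  rw [tendsto_zero_iff_norm_tendsto_zero]
  have h : ∀ N : ℕ, ‖((N : ℂ) + 1) ^ s‖ = ((N : ℝ) + 1) ^ (-(-s.re)) := fun N => by
    rw [show ((N : ℂ) + 1) = (((N : ℝ) + 1 : ℝ) : ℂ) by push_cast; ring,
      Complex.norm_cpow_eq_rpow_re_of_pos (by positivity), neg_neg]
  simp_rw [h]
  exact (tendsto_rpow_neg_atTop (by linarith)).comp
    (tendsto_atTop_add_const_right _ 1 tendsto_natCast_atTop_atTop)

lemma exists_norm_LFunction_le_of_ne_one {q : ℕ} [NeZero q] {χ : DirichletCharacter ℂ q}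
    (hχ : χ ≠ 1) {η : ℝ} (hη0 : 0 < η) (hη1 : η < 1 / 2) :
    ∃ C : ℝ, 0 ≤ C ∧ ∀ s : ℂ, 1 - η < s.re →
      ‖DirichletCharacter.LFunction χ s‖ ≤ C * ‖s‖ ^ (2 * η) := by
  obtain ⟨B, hB0, hB⟩ := exists_norm_sum_range_le hχ
  set S : ℕ → ℂ := fun N => ∑ k ∈ Finset.range N, χ ((k + 1 : ℕ) : ZMod q) with hS
  have hSB : ∀ N, ‖S N‖ ≤ B + B := fun N => by
    have : S N = ∑ k ∈ Finset.range (N + 1), χ (k : ZMod q) -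
        ∑ k ∈ Finset.range 1, χ (k : ZMod q) := by
      rw [Finset.sum_range_succ' _ N]; simp [hS]
    rw [this]
    exact (norm_sub_le _ _).trans (add_le_add (hB _) (hB _))
  have hcast : ∀ n : ℕ, ((n : ℂ) + 1) = (((n : ℝ) + 1 : ℝ) : ℂ) := fun n => by push_cast; ring
  have hcast' : ∀ n : ℕ, ((n : ℂ) + 1 + 1) = (((n : ℝ) + 1 + 1 : ℝ) : ℂ) := fun n => by
    push_cast; ring
  have hbd : ∀ (n : ℕ) (s : ℂ), 1 - η < s.re →
      ‖S (n + 1) * (((n : ℂ) + 1) ^ (-s) - ((n : ℂ) + 1 + 1) ^ (-s))‖ ≤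
        4 * B * ‖s‖ ^ (2 * η) * ((n : ℝ) + 1) ^ (-1 - η) := by
    intro n s hs
    rw [norm_mul, hcast', hcast]
    have hn1 : (1 : ℝ) ≤ (n : ℝ) + 1 := by linarith [(Nat.cast_nonneg n : (0 : ℝ) ≤ n)]
    have h := norm_cpow_neg_sub_cpow_neg_le (n := (n : ℝ) + 1) (u := (n : ℝ) + 1 + 1) (s := s)
      (θ := 2 * η) hn1 (by linarith) le_rfl (by linarith) (by linarith) (by linarith)
    have h2 : ((n : ℝ) + 1) ^ (-s.re - 2 * η) ≤ ((n : ℝ) + 1) ^ (-1 - η) :=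
      Real.rpow_le_rpow_of_exponent_le hn1 (by linarith)
    calc _ ≤ (B + B) * (2 * ‖s‖ ^ (2 * η) * ((n : ℝ) + 1) ^ (-s.re - 2 * η)) := by
          gcongr; exact hSB _
      _ ≤ (B + B) * (2 * ‖s‖ ^ (2 * η) * ((n : ℝ) + 1) ^ (-1 - η)) := by gcongr
      _ = _ := by ring
  obtain ⟨C, hC0, hC⟩ := exists_norm_le_of_eq_tsum hη0 (L := DirichletCharacter.LFunction χ)
    (w := fun s => 4 * B * ‖s‖ ^ (2 * η))
    (g := fun n s => S (n + 1) * (((n : ℂ) + 1) ^ (-s) - ((n : ℂ) + 1 + 1) ^ (-s)))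
    (continuous_const.mul (continuous_norm.rpow_const fun _ => Or.inr (by linarith)))
    (fun s => by positivity) (fun n => by
      have h1 := differentiable_natCast_add_one_cpow n 0
      have h2 := differentiable_natCast_add_one_cpow (n + 1) 0
      simp only [zero_sub, Nat.cast_add, Nat.cast_one] at h1 h2
      exact (h1.sub h2).const_mul _)
    (DirichletCharacter.differentiable_LFunction hχ).differentiableOn hbd (fun s hs => by
      have hsum : Summable fun n : ℕ =>
          S (n + 1) * (((n : ℂ) + 1) ^ (-s) - ((n : ℂ) + 1 + 1) ^ (-s)) := by
        refine Summable.of_norm_bounded (g := fun n : ℕ => 4 * B * ‖s‖ ^ (2 * η) *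
          ((n : ℝ) + 1) ^ (-1 - η)) (Summable.mul_left _ ?_) fun n => hbd n s (by linarith)
        have := (summable_nat_add_iff 1).mpr
          (Real.summable_nat_rpow.mpr (by linarith : -1 - η < -1))
        simpa using this
      rw [DirichletCharacter.LFunction_eq_LSeries χ hs]
      have hLS := (DirichletCharacter.LSeriesSummable_of_one_lt_re χ hs).hasSum
      have h1 := ((hasSum_nat_add_iff' 1).mpr hLS).tendsto_sum_nat
      have h0 : LSeries (fun n => χ (n : ZMod q)) s =
          (∑' n, LSeries.term (fun n => χ (n : ZMod q)) s n) -
            ∑ i ∈ Finset.range 1, LSeries.term (fun n => χ (n : ZMod q)) s i := by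
        simp [LSeries]
      rw [h0]
      refine tendsto_nhds_unique (h1.congr (f₂ := fun N => S N * ((N : ℂ) + 1) ^ (-s) +
        ∑ n ∈ Finset.range N, S (n + 1) * (((n : ℂ) + 1) ^ (-s) - ((n : ℂ) + 1 + 1) ^ (-s)))
        fun N => ?_) ?_
      · rw [← sum_mul_cpow_eq (fun n => χ (n : ZMod q)) s N]
        refine Finset.sum_congr rfl fun n _ => ?_
        rw [LSeries.term_of_ne_zero (Nat.succ_ne_zero n), Complex.cpow_neg, div_eq_mul_inv]
        push_cast
        rfl
      · rw [← zero_add (∑' n : ℕ, _)]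
        refine Tendsto.add ?_ hsum.hasSum.tendsto_sum_nat
        exact Filter.isBoundedUnder_le_mul_tendsto_zero (isBoundedUnder_of ⟨B + B, fun N => hSB N⟩)
          (tendsto_natCast_add_one_cpow (s := -s) (by simp; linarith)))
  refine ⟨C * (4 * B), by positivity, fun s hs => ?_⟩
  rw [mul_assoc]
  exact hC s hs

end LFunctionBounds

section LFunctionBounds
open Set DirichletCharacter

lemma norm_sub_one_mul_cpow_sub_le {n : ℝ} (hn : 1 ≤ n) {s : ℂ} (hs : 0 < s.re) {θ : ℝ}
    (hθ0 : 0 < θ) (hθ1 : θ < 1) :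
    ‖(s - 1) * (n : ℂ) ^ (-s) - ((n : ℂ) ^ (1 - s) - ((n + 1 : ℝ) : ℂ) ^ (1 - s))‖ ≤
      2 * (‖s - 1‖ * ‖s‖ ^ θ) * n ^ (-s.re - θ) := by
  rcases eq_or_ne s 1 with rfl | hs1
  · simp
  have hd : ∀ u ∈ Icc n (n + 1), HasDerivWithinAt
      (fun u : ℝ => (s - 1) * (n : ℂ) ^ (-s) * (u : ℂ) + (u : ℂ) ^ (1 - s))
      ((s - 1) * ((n : ℂ) ^ (-s) - (u : ℂ) ^ (-s))) (Icc n (n + 1)) u := fun u hu => by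
    have h1 := hasDerivAt_ofReal_cpow_const (by linarith [hu.1] : u ≠ 0)
      (r := 1 - s) (sub_ne_zero.mpr hs1.symm)
    have h2 : HasDerivAt (fun u : ℝ => (u : ℂ)) 1 u := Complex.ofRealCLM.hasDerivAt
    refine (((h2.const_mul ((s - 1) * (n : ℂ) ^ (-s))).add h1).congr_deriv ?_).hasDerivWithinAt
    rw [show (1 : ℂ) - s - 1 = -s by ring]
    ring
  have := Convex.norm_image_sub_le_of_norm_hasDerivWithin_le
    (C := 2 * (‖s - 1‖ * ‖s‖ ^ θ) * n ^ (-s.re - θ)) hd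
    (fun u hu => by
      rw [norm_mul]
      calc _ ≤ ‖s - 1‖ * (2 * ‖s‖ ^ θ * n ^ (-s.re - θ)) := by
            gcongr
            exact norm_cpow_neg_sub_cpow_neg_le hn hu.1 hu.2 hs hθ0 hθ1
        _ = _ := by ring)
    (convex_Icc n (n + 1)) (left_mem_Icc.mpr (by linarith)) (right_mem_Icc.mpr (by linarith))
  rw [show n + 1 - n = 1 by ring, norm_one, mul_one] at this
  refine (le_of_eq ?_).trans this
  congr 1
  push_cast
  ring

lemma LFunctionTrivChar₁_one_apply_of_ne_one {s : ℂ} (hs : s ≠ 1) :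
    LFunctionTrivChar₁ 1 s = (s - 1) * riemannZeta s := by
  rw [LFunctionTrivChar₁, Function.update_of_ne hs, LFunctionTrivChar_eq_mul_riemannZeta hs]
  simp

lemma exists_norm_LFunctionTrivChar₁_one_le {η : ℝ} (hη0 : 0 < η) (hη1 : η < 1 / 2) :
    ∃ C : ℝ, 0 ≤ C ∧ ∀ s : ℂ, 1 - η < s.re →
      ‖LFunctionTrivChar₁ 1 s‖ ≤ 1 + C * (‖s - 1‖ * ‖s‖ ^ (2 * η)) := by
  have hcast : ∀ n : ℕ, ((n : ℂ) + 1) = (((n : ℝ) + 1 : ℝ) : ℂ) := fun n => by push_cast; ring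
  have hcast' : ∀ n : ℕ, ((n : ℂ) + 1 + 1) = (((n : ℝ) + 1 + 1 : ℝ) : ℂ) := fun n => by
    push_cast; ring
  set g : ℕ → ℂ → ℂ := fun n s => (s - 1) * ((n : ℂ) + 1) ^ (-s) -
    (((n : ℂ) + 1) ^ (1 - s) - ((n : ℂ) + 1 + 1) ^ (1 - s)) with hg
  have hbd : ∀ (n : ℕ) (s : ℂ), 1 - η < s.re →
      ‖g n s‖ ≤ 2 * (‖s - 1‖ * ‖s‖ ^ (2 * η)) * ((n : ℝ) + 1) ^ (-1 - η) := by
    intro n s hs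
    have hn1 : (1 : ℝ) ≤ (n : ℝ) + 1 := by linarith [(Nat.cast_nonneg n : (0 : ℝ) ≤ n)]
    simp only [hg]
    rw [hcast', hcast]
    refine (norm_sub_one_mul_cpow_sub_le hn1 (by linarith) (by linarith : 0 < 2 * η)
      (by linarith)).trans ?_
    have h2 : ((n : ℝ) + 1) ^ (-s.re - 2 * η) ≤ ((n : ℝ) + 1) ^ (-1 - η) :=
      Real.rpow_le_rpow_of_exponent_le hn1 (by linarith)
    gcongr
  obtain ⟨C, hC0, hC⟩ := exists_norm_le_of_eq_tsum hη0 (L := fun s => LFunctionTrivChar₁ 1 s - 1)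
    (w := fun s => 2 * (‖s - 1‖ * ‖s‖ ^ (2 * η))) (g := g)
    (continuous_const.mul ((continuous_id.sub continuous_const).norm.mul
      (continuous_norm.rpow_const fun _ => Or.inr (by linarith))))
    (fun s => by positivity) (fun n => by
      have h1 := differentiable_natCast_add_one_cpow n 0
      have h2 := differentiable_natCast_add_one_cpow n 1
      have h3 := differentiable_natCast_add_one_cpow (n + 1) 1
      simp only [zero_sub, Nat.cast_add, Nat.cast_one] at h1 h2 h3
      exact ((differentiable_id.sub_const 1).mul h1).sub (h2.sub h3))
    ((differentiable_LFunctionTrivChar₁ 1).sub_const 1).differentiableOn hbd (fun s hs => by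
      have hs1 : s ≠ 1 := by rintro rfl; simp at hs
      have hsum : Summable fun n : ℕ => g n s := by
        refine Summable.of_norm_bounded (g := fun n : ℕ => 2 * (‖s - 1‖ * ‖s‖ ^ (2 * η)) *
          ((n : ℝ) + 1) ^ (-1 - η)) (Summable.mul_left _ ?_) fun n => hbd n s (by linarith)
        have := (summable_nat_add_iff 1).mpr
          (Real.summable_nat_rpow.mpr (by linarith : -1 - η < -1))
        simpa using this
      rw [LFunctionTrivChar₁_one_apply_of_ne_one hs1]
      have hz : HasSum (fun n : ℕ => ((n : ℂ) + 1) ^ (-s)) (riemannZeta s) := by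
        rw [zeta_eq_tsum_one_div_nat_add_one_cpow hs]
        simp only [Complex.cpow_neg, ← one_div]
        refine Summable.hasSum ?_
        have := (summable_nat_add_iff 1).mpr (Complex.summable_one_div_nat_cpow.mpr hs)
        simpa using this
      have htel : ∀ N : ℕ, ∑ n ∈ Finset.range N,
          (((n : ℂ) + 1) ^ (1 - s) - ((n : ℂ) + 1 + 1) ^ (1 - s)) =
            1 - ((N : ℂ) + 1) ^ (1 - s) := by
        intro N
        induction N with
        | zero => simp
        | succ N ih => rw [Finset.sum_range_succ, ih]; push_cast; ring
      have h1 : Tendsto (fun N : ℕ => ∑ n ∈ Finset.range N, g n s) atTop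
          (𝓝 ((s - 1) * riemannZeta s - (1 - 0))) := by
        have h2 := (hz.mul_left (s - 1)).tendsto_sum_nat
        have h3 := (tendsto_natCast_add_one_cpow (s := 1 - s) (by simpa using hs)).const_sub 1
        refine (h2.sub h3).congr fun N => ?_
        rw [← htel, ← Finset.sum_sub_distrib]
      rw [sub_zero] at h1
      exact tendsto_nhds_unique h1 hsum.hasSum.tendsto_sum_nat)
  refine ⟨C * 2, by positivity, fun s hs => ?_⟩
  have := hC s hs
  calc ‖LFunctionTrivChar₁ 1 s‖ = ‖1 + (LFunctionTrivChar₁ 1 s - 1)‖ := by congr 1; ring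
    _ ≤ ‖(1 : ℂ)‖ + ‖LFunctionTrivChar₁ 1 s - 1‖ := norm_add_le _ _
    _ ≤ 1 + C * (2 * (‖s - 1‖ * ‖s‖ ^ (2 * η))) := by rw [norm_one]; gcongr
    _ = _ := by ring

/-- Polynomial growth of small degree for Dirichlet `L`-functions slightly to the left of
`re s = 1`, away from the real axis. -/
lemma exists_norm_LFunction_le {q : ℕ} [NeZero q] (χ : DirichletCharacter ℂ q) {η τ : ℝ}
    (hη0 : 0 < η) (hη1 : η < 1 / 2) (hτ : 0 < τ) :
    ∃ C : ℝ, 0 < C ∧ ∀ s : ℂ, 1 - η < s.re → s.re ≤ 4 → τ ≤ |s.im| →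
      ‖LFunction χ s‖ ≤ C * (1 + |s.im|) ^ (2 * η) := by
  have hnorm : ∀ s : ℂ, 1 - η < s.re → s.re ≤ 4 → ‖s‖ ^ (2 * η) ≤ 4 * (1 + |s.im|) ^ (2 * η) := by
    intro s h1 h2
    have h3 : ‖s‖ ≤ 4 * (1 + |s.im|) := by
      refine (Complex.norm_le_abs_re_add_abs_im s).trans ?_
      rw [abs_of_pos (by linarith : 0 < s.re)]
      linarith [abs_nonneg s.im]
    calc ‖s‖ ^ (2 * η) ≤ (4 * (1 + |s.im|)) ^ (2 * η) := by gcongr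
      _ = 4 ^ (2 * η) * (1 + |s.im|) ^ (2 * η) := by
        rw [Real.mul_rpow (by norm_num) (by positivity)]
      _ ≤ _ := by
        gcongr
        calc (4 : ℝ) ^ (2 * η) ≤ 4 ^ (1 : ℝ) :=
              Real.rpow_le_rpow_of_exponent_le (by norm_num) (by linarith)
          _ = 4 := by simp
  by_cases hχ : χ = 1
  · subst hχ
    obtain ⟨C, hC0, hC⟩ := exists_norm_LFunctionTrivChar₁_one_le hη0 hη1
    refine ⟨(∏ p ∈ q.primeFactors, (2 : ℝ)) * (1 / τ + C * 4), by positivity,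
      fun s h1 h2 h3 => ?_⟩
    have hs1 : s ≠ 1 := by rintro rfl; simp at h3; linarith
    have hs0 : 0 < ‖s - 1‖ := norm_pos_iff.mpr (sub_ne_zero.mpr hs1)
    have hτs : τ ≤ ‖s - 1‖ := h3.trans (by simpa using Complex.abs_im_le_norm (s - 1))
    have hT : (1 : ℝ) ≤ (1 + |s.im|) ^ (2 * η) :=
      Real.one_le_rpow (by linarith [abs_nonneg s.im]) (by linarith)
    have h := LFunctionTrivChar_eq_mul_riemannZeta (N := q) hs1
    rw [show LFunction (1 : DirichletCharacter ℂ q) s = _ from h, norm_mul, norm_prod, mul_assoc]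
    have hz : ‖riemannZeta s‖ ≤ (1 / τ + C * 4) * (1 + |s.im|) ^ (2 * η) := by
      have h5 := hC s h1
      rw [LFunctionTrivChar₁_one_apply_of_ne_one hs1, norm_mul] at h5
      have h6 : ‖riemannZeta s‖ ≤ 1 / ‖s - 1‖ + C * ‖s‖ ^ (2 * η) := by
        rw [← mul_le_mul_iff_right₀ hs0, mul_add, mul_one_div_cancel hs0.ne']
        linarith
      calc _ ≤ _ := h6
        _ ≤ 1 / τ * (1 + |s.im|) ^ (2 * η) + C * (4 * (1 + |s.im|) ^ (2 * η)) := by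
          gcongr ?_ + C * ?_
          · calc 1 / ‖s - 1‖ ≤ 1 / τ * 1 := by rw [mul_one]; gcongr
              _ ≤ _ := by gcongr
          · exact hnorm s h1 h2
        _ = _ := by ring
    refine mul_le_mul ?_ hz (norm_nonneg _) (by positivity)
    refine Finset.prod_le_prod (fun _ _ => norm_nonneg _) fun p hp => ?_
    have hp1 : (1 : ℝ) ≤ p := by exact_mod_cast (Nat.prime_of_mem_primeFactors hp).one_lt.le
    refine (norm_sub_le _ _).trans ?_
    rw [norm_one, ← Complex.ofReal_natCast, Complex.norm_cpow_eq_rpow_re_of_pos (by linarith)]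
    have : (p : ℝ) ^ (-s).re ≤ 1 :=
      Real.rpow_le_one_of_one_le_of_nonpos hp1 (by simp; linarith)
    linarith
  · obtain ⟨C, hC0, hC⟩ := exists_norm_LFunction_le_of_ne_one hχ hη0 hη1
    refine ⟨C * 4 + 1, by positivity, fun s h1 h2 h3 => (hC s h1).trans ?_⟩
    calc C * ‖s‖ ^ (2 * η) ≤ C * (4 * (1 + |s.im|) ^ (2 * η)) := by gcongr; exact hnorm s h1 h2
      _ ≤ _ := by
        have : 0 ≤ (1 + |s.im|) ^ (2 * η) := by positivity
        nlinarith

end LFunctionBounds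

section LFunctionBounds
open Set DirichletCharacter

lemma exists_norm_LFunctionTrivChar_le (q : ℕ) [NeZero q] :
    ∃ A : ℝ, 0 < A ∧ ∀ δ : ℝ, 0 < δ → δ ≤ 1 → ‖LFunctionTrivChar q (1 + δ)‖ ≤ A / δ := by
  obtain ⟨A, hA⟩ := (isCompact_Icc (a := (0 : ℝ)) (b := 1)).exists_bound_of_continuousOn
    (f := fun δ : ℝ => LFunctionTrivChar₁ q (1 + δ))
    (((differentiable_LFunctionTrivChar₁ q).continuous.comp
      (continuous_const.add Complex.continuous_ofReal)).continuousOn)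
  refine ⟨|A| + 1, by positivity, fun δ h0 h1 => ?_⟩
  have h := hA δ ⟨h0.le, h1⟩
  have hne : (1 + δ : ℂ) ≠ 1 := by simpa using h0.ne'
  simp only [LFunctionTrivChar₁] at h
  rw [Function.update_of_ne hne, norm_mul] at h
  rw [le_div_iff₀ h0, mul_comm]
  simp only [add_sub_cancel_left, Complex.norm_real, Real.norm_eq_abs, abs_of_pos h0] at h
  linarith [le_abs_self A]

lemma one_add_abs_rpow_le {t t' : ℝ} (h : |t'| ≤ 2 * |t| + 1) :
    (1 + |t'|) ^ (1 / 60 : ℝ) ≤ 2 * (1 + |t|) ^ (1 / 60 : ℝ) := by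
  calc (1 + |t'|) ^ (1 / 60 : ℝ) ≤ (2 * (1 + |t|)) ^ (1 / 60 : ℝ) := by gcongr; linarith
    _ = 2 ^ (1 / 60 : ℝ) * (1 + |t|) ^ (1 / 60 : ℝ) :=
      Real.mul_rpow (by norm_num) (by positivity)
    _ ≤ _ := by
      gcongr
      calc (2 : ℝ) ^ (1 / 60 : ℝ) ≤ 2 ^ (1 : ℝ) :=
            Real.rpow_le_rpow_of_exponent_le (by norm_num) (by norm_num)
        _ = 2 := by simp

lemma one_le_one_add_abs_rpow (t : ℝ) : 1 ≤ (1 + |t|) ^ (1 / 60 : ℝ) :=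
  Real.one_le_rpow (by linarith [abs_nonneg t]) (by norm_num)

lemma differentiableAt_LFunction_of_im {q : ℕ} [NeZero q] (χ : DirichletCharacter ℂ q) {s : ℂ}
    (hs : 0 < |s.im|) : DifferentiableAt ℂ (LFunction χ) s :=
  differentiableAt_LFunction χ s (Or.inl (by rintro rfl; simp at hs))

lemma abs_im_le_of_norm_sub_le {s z : ℂ} {ρ : ℝ} (h : ‖z - s‖ ≤ ρ) :
    |s.im| - ρ ≤ |z.im| ∧ |z.im| ≤ |s.im| + ρ := by
  have h1 := (Complex.abs_im_le_norm (z - s)).trans h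
  rw [Complex.sub_im] at h1
  have h2 := abs_sub_abs_le_abs_sub s.im z.im
  have h3 := abs_sub_abs_le_abs_sub z.im s.im
  rw [abs_sub_comm] at h2
  constructor <;> linarith

lemma abs_re_le_of_norm_sub_le {s z : ℂ} {ρ : ℝ} (h : ‖z - s‖ ≤ ρ) :
    s.re - ρ ≤ z.re ∧ z.re ≤ s.re + ρ := by
  have h1 := (Complex.abs_re_le_norm (z - s)).trans h
  rw [Complex.sub_re, abs_le] at h1
  constructor <;> linarith

lemma exists_norm_LFunction_le_rpow {q : ℕ} [NeZero q] (χ : DirichletCharacter ℂ q) {τ : ℝ}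
    (hτ : 0 < τ) :
    ∃ C : ℝ, 0 < C ∧ ∀ s : ℂ, 1 - 1 / 120 < s.re → s.re ≤ 4 → τ ≤ |s.im| →
      ‖LFunction χ s‖ ≤ C * (1 + |s.im|) ^ (1 / 60 : ℝ) := by
  have := exists_norm_LFunction_le χ (η := 1 / 120) (by norm_num) (by norm_num) hτ
  norm_num at this ⊢
  exact this

lemma exists_norm_deriv_LFunction_le {q : ℕ} [NeZero q] (χ : DirichletCharacter ℂ q) {τ : ℝ}
    (hτ : 0 < τ) :
    ∃ C : ℝ, 0 < C ∧ ∀ s : ℂ, 1 - 1 / 240 ≤ s.re → s.re ≤ 3 → τ ≤ |s.im| →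
      ‖deriv (LFunction χ) s‖ ≤ C * (1 + |s.im|) ^ (1 / 60 : ℝ) := by
  obtain ⟨C, hC0, hC⟩ := exists_norm_LFunction_le_rpow χ (half_pos hτ)
  set R := min (1 / 480) (τ / 2) with hR
  have hR0 : 0 < R := lt_min (by norm_num) (by linarith)
  have hR1 : R ≤ 1 / 480 := min_le_left _ _
  have hR2 : R ≤ τ / 2 := min_le_right _ _
  refine ⟨C * 2 / R, by positivity, fun s h1 h2 h3 => ?_⟩
  rw [div_mul_eq_mul_div]
  refine Complex.norm_deriv_le_of_forall_mem_sphere_norm_le hR0 ?_ fun z hz => ?_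
  · refine DifferentiableOn.diffContOnCl fun z hz => ?_
    rw [closure_ball _ hR0.ne', Metric.mem_closedBall, dist_eq_norm] at hz
    exact (differentiableAt_LFunction_of_im χ (by
      linarith [(abs_im_le_of_norm_sub_le hz).1])).differentiableWithinAt
  · rw [mem_sphere_iff_norm] at hz
    have him := abs_im_le_of_norm_sub_le hz.le
    have hre := abs_re_le_of_norm_sub_le hz.le
    refine (hC z (by linarith) (by linarith) (by linarith)).trans ?_
    rw [mul_assoc]
    gcongr
    exact one_add_abs_rpow_le (by linarith [abs_nonneg s.im])

/-- Effective nonvanishing of `L`-functions to the right of `re s = 1`. -/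
lemma exists_le_norm_LFunction {q : ℕ} [NeZero q] (χ : DirichletCharacter ℂ q) {τ : ℝ}
    (hτ : 0 < τ) :
    ∃ c : ℝ, 0 < c ∧ ∀ σ t : ℝ, 1 < σ → σ ≤ 2 → τ ≤ |t| →
      c / ((1 + |t|) ^ (1 / 60 : ℝ)) ^ 4 ≤ ‖LFunction χ (σ + Complex.I * t)‖ := by
  obtain ⟨A, hA0, hA⟩ := exists_norm_LFunctionTrivChar_le q
  obtain ⟨B, hB0, hB⟩ := exists_norm_LFunction_le_rpow (χ ^ 2) hτ
  obtain ⟨D, hD0, hD⟩ := exists_norm_deriv_LFunction_le χ hτ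
  set a : ℝ := 1 / (16 * D ^ 4 * A ^ 3 * (2 * B) + 1) with ha
  have hden : 0 < 16 * D ^ 4 * A ^ 3 * (2 * B) + 1 := by positivity
  have ha0 : 0 < a := by positivity
  have ha1 : a ≤ 1 := by
    rw [ha, div_le_one hden]
    have : 0 < 16 * D ^ 4 * A ^ 3 * (2 * B) := by positivity
    linarith
  have haD : 16 * a * D ^ 4 * A ^ 3 * (2 * B) < 1 := by
    have : a * (16 * D ^ 4 * A ^ 3 * (2 * B) + 1) = 1 := by rw [ha]; field_simp
    nlinarith
  have hfar : ∀ δ t : ℝ, τ ≤ |t| → δ ≤ 1 → a / ((1 + |t|) ^ (1 / 60 : ℝ)) ^ 5 ≤ δ →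
      2 * a * D / ((1 + |t|) ^ (1 / 60 : ℝ)) ^ 4 ≤ ‖LFunction χ (1 + δ + Complex.I * t)‖ := by
    intro δ t ht hδ1 hδ
    set P := (1 + |t|) ^ (1 / 60 : ℝ) with hP
    have hP1 : 1 ≤ P := one_le_one_add_abs_rpow t
    have hδ0 : 0 < δ := lt_of_lt_of_le (by positivity) hδ
    by_contra! hlt
    have h := norm_LFunction_product_ge_one χ hδ0 t
    rw [norm_mul, norm_mul, norm_pow, norm_pow] at h
    have h1 : ‖LFunctionTrivChar q (1 + δ)‖ ≤ A * P ^ 5 / a := by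
      refine (hA δ hδ0 hδ1).trans ?_
      rw [mul_div_assoc]
      calc A / δ ≤ A / (a / P ^ 5) := by gcongr
        _ = _ := by rw [div_div_eq_mul_div, mul_div_assoc]
    have h2 : ‖LFunction (χ ^ 2) (1 + δ + 2 * Complex.I * t)‖ ≤ 2 * B * P := by
      have := hB (1 + δ + 2 * Complex.I * t) (by simp; linarith) (by simp; linarith)
        (by simp; linarith [abs_nonneg t])
      refine this.trans ?_
      exact (mul_le_mul_of_nonneg_left (one_add_abs_rpow_le (t := t)
        (t' := (1 + δ + 2 * Complex.I * t : ℂ).im) (by simp [abs_mul])) hB0.le).trans_eq (by ring)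
    have h3 : ‖LFunctionTrivChar q (1 + δ)‖ ^ 3 * ‖LFunction χ (1 + δ + Complex.I * t)‖ ^ 4 *
        ‖LFunction (χ ^ 2) (1 + δ + 2 * Complex.I * t)‖ ≤
        (A * P ^ 5 / a) ^ 3 * (2 * a * D / P ^ 4) ^ 4 * (2 * B * P) := by gcongr
    have h4 : (A * P ^ 5 / a) ^ 3 * (2 * a * D / P ^ 4) ^ 4 * (2 * B * P) =
        16 * a * D ^ 4 * A ^ 3 * (2 * B) := by
      field_simp
      ring
    linarith
  refine ⟨a * D, by positivity, fun σ t h1 h2 ht => ?_⟩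
  set P := (1 + |t|) ^ (1 / 60 : ℝ) with hP
  have hP1 : 1 ≤ P := one_le_one_add_abs_rpow t
  have hform : ∀ δ : ℝ, (1 + δ + Complex.I * t : ℂ) = ((1 + δ : ℝ) : ℂ) + Complex.I * t := by
    intro δ; push_cast; ring
  have haP : a / P ^ 5 ≤ 1 := by
    rw [div_le_one (by positivity)]
    exact ha1.trans (one_le_pow₀ hP1)
  rcases le_or_gt (a / P ^ 5) (σ - 1) with h | h
  · have h5 := hfar (σ - 1) t ht (by linarith) h
    rw [hform, add_sub_cancel] at h5
    refine le_trans ?_ h5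
    gcongr
    linarith
  · have h5 := hfar (a / P ^ 5) t ht haP le_rfl
    rw [hform] at h5
    set σ₁ := 1 + a / P ^ 5 with hσ₁
    have hconv : Convex ℝ {z : ℂ | z.im = t ∧ 1 ≤ z.re ∧ z.re ≤ 2} := by
      have : {z : ℂ | z.im = t ∧ 1 ≤ z.re ∧ z.re ≤ 2} =
          (Complex.imLm ⁻¹' {t}) ∩ (Complex.reLm ⁻¹' Icc 1 2) := by
        ext z; simp
      rw [this]
      exact ((convex_singleton t).linear_preimage _).inter ((convex_Icc 1 2).linear_preimage _)
    have hdiff := hconv.norm_image_sub_le_of_norm_deriv_le (f := LFunction χ) (C := D * P)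
      (x := σ + Complex.I * t) (y := σ₁ + Complex.I * t)
      (fun z hz => differentiableAt_LFunction_of_im χ (by rw [hz.1]; linarith))
      (fun z hz => by
        have := hD z (by linarith [hz.2.1]) (by linarith [hz.2.2]) (by rw [hz.1]; exact ht)
        rwa [hz.1] at this)
      (by simp; constructor <;> linarith)
      (by
        have : 0 < a / P ^ 5 := by positivity
        simp; constructor <;> linarith)
    have hn : ‖(σ₁ + Complex.I * t : ℂ) - (σ + Complex.I * t)‖ ≤ a / P ^ 5 := by
      rw [show (σ₁ + Complex.I * t : ℂ) - (σ + Complex.I * t) = ((σ₁ - σ : ℝ) : ℂ) by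
        push_cast; ring, Complex.norm_real, Real.norm_eq_abs, abs_of_nonneg (by linarith)]
      linarith
    have h6 : D * P * ‖(σ₁ + Complex.I * t : ℂ) - (σ + Complex.I * t)‖ ≤ a * D / P ^ 4 := by
      calc _ ≤ D * P * (a / P ^ 5) := by gcongr
        _ = _ := by field_simp
    have h7 := norm_sub_norm_le (LFunction χ (σ₁ + Complex.I * t)) (LFunction χ (σ + Complex.I * t))
    have h8 : 2 * a * D / P ^ 4 = a * D / P ^ 4 + a * D / P ^ 4 := by ring
    linarith

/-- The logarithmic derivative of a Dirichlet `L`-function has small polynomial growth on discs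
reaching to the left of `re s = 1`. -/
lemma exists_norm_logDeriv_LFunction_le {q : ℕ} [NeZero q] (χ : DirichletCharacter ℂ q) {τ : ℝ}
    (hτ : 0 < τ) :
    ∃ C ρ₀ : ℝ, 0 < C ∧ 0 < ρ₀ ∧ ∀ s₀ : ℂ, 1 < s₀.re → s₀.re ≤ 2 → τ ≤ |s₀.im| →
      ∀ s ∈ Metric.ball s₀ (ρ₀ / (1 + |s₀.im|) ^ (1 / 12 : ℝ)), LFunction χ s ≠ 0 ∧
        ‖deriv (LFunction χ) s / LFunction χ s‖ ≤ C * (1 + |s₀.im|) ^ (1 / 12 : ℝ) := by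
  obtain ⟨c, hc0, hc⟩ := exists_le_norm_LFunction χ hτ
  obtain ⟨D, hD0, hD⟩ := exists_norm_deriv_LFunction_le χ (half_pos hτ)
  set ρ₀ := min (min (1 / 240) (τ / 2)) (c / (4 * D)) with hρ
  have hρ0 : 0 < ρ₀ := lt_min (lt_min (by norm_num) (by linarith)) (by positivity)
  have hρ1 : ρ₀ ≤ 1 / 240 := (min_le_left _ _).trans (min_le_left _ _)
  have hρ2 : ρ₀ ≤ τ / 2 := (min_le_left _ _).trans (min_le_right _ _)
  have hρ3 : ρ₀ ≤ c / (4 * D) := min_le_right _ _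
  refine ⟨4 * D / c, ρ₀, by positivity, hρ0, fun s₀ h1 h2 ht s hs => ?_⟩
  set P := (1 + |s₀.im|) ^ (1 / 60 : ℝ) with hP
  have hP1 : 1 ≤ P := one_le_one_add_abs_rpow s₀.im
  have hP5 : (1 + |s₀.im|) ^ (1 / 12 : ℝ) = P ^ 5 := by
    rw [hP, ← Real.rpow_natCast, ← Real.rpow_mul (by positivity)]
    norm_num
  rw [hP5] at hs ⊢
  set ρ := ρ₀ / P ^ 5 with hρdef
  have hρle : ρ ≤ ρ₀ := div_le_self hρ0.le (one_le_pow₀ hP1)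
  have hρpos : 0 < ρ := by positivity
  have hball : ∀ z ∈ Metric.ball s₀ ρ, τ / 2 ≤ |z.im| ∧
      ‖deriv (LFunction χ) z‖ ≤ 2 * D * P := by
    intro z hz
    rw [mem_ball_iff_norm] at hz
    have him := abs_im_le_of_norm_sub_le hz.le
    have hre := abs_re_le_of_norm_sub_le hz.le
    refine ⟨by linarith, (hD z (by linarith) (by linarith) (by linarith)).trans ?_⟩
    rw [mul_comm 2 D, mul_assoc]
    gcongr
    exact one_add_abs_rpow_le (by linarith [abs_nonneg s₀.im])
  have hdiff := (convex_ball s₀ ρ).norm_image_sub_le_of_norm_deriv_le (f := LFunction χ)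
    (C := 2 * D * P) (x := s) (y := s₀)
    (fun z hz => differentiableAt_LFunction_of_im χ (by linarith [(hball z hz).1]))
    (fun z hz => (hball z hz).2) hs (Metric.mem_ball_self hρpos)
  have h3 : c / P ^ 4 ≤ ‖LFunction χ s₀‖ := by
    have := hc s₀.re s₀.im h1 h2 ht
    rwa [mul_comm, Complex.re_add_im] at this
  have h4 : 2 * D * P * ‖s₀ - s‖ ≤ c / P ^ 4 / 2 := by
    rw [mem_ball_iff_norm'] at hs
    calc 2 * D * P * ‖s₀ - s‖ ≤ 2 * D * P * (c / (4 * D) / P ^ 5) := by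
          gcongr
          exact hs.le.trans (by rw [hρdef]; gcongr)
      _ = _ := by field_simp; norm_num
  have h5 : c / P ^ 4 / 2 ≤ ‖LFunction χ s‖ := by
    have := norm_sub_norm_le (LFunction χ s₀) (LFunction χ s)
    linarith
  have h6 : 0 < c / P ^ 4 / 2 := by positivity
  refine ⟨norm_pos_iff.mp (h6.trans_le h5), ?_⟩
  rw [norm_div]
  calc _ ≤ 2 * D * P / (c / P ^ 4 / 2) := by
        gcongr
        exact (hball s hs).2
    _ = _ := by field_simp; ring

end LFunctionBounds

section Extension
open Set Metric

/-- A solution of `F' = -V F` on a convex open set extends to any disc centred in this set on which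
`V` is holomorphic. -/
lemma exists_extension_of_hasDerivAt {U : Set ℂ} (hU : IsOpen U) (hUc : Convex ℝ U) {F V : ℂ → ℂ}
    {s₀ : ℂ} {ρ : ℝ} (hs₀ : s₀ ∈ U) (hρ : 0 < ρ)
    (hF : ∀ s ∈ U ∩ ball s₀ ρ, HasDerivAt F (-(V s * F s)) s)
    (hV : DifferentiableOn ℂ V (ball s₀ ρ)) :
    ∃ E : ℂ → ℂ, (∀ s ∈ ball s₀ ρ, HasDerivAt E (-(V s * E s)) s) ∧
      EqOn F E (U ∩ ball s₀ ρ) ∧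
      ∀ B : ℝ, (∀ s ∈ ball s₀ ρ, ‖V s‖ ≤ B) →
        ∀ s ∈ ball s₀ ρ, ‖E s‖ ≤ ‖F s₀‖ * Real.exp (B * ρ) := by
  obtain ⟨W, hW⟩ := hV.isExactOn_ball
  have hE : ∀ s ∈ ball s₀ ρ, HasDerivAt (fun s => F s₀ * Complex.exp (W s₀ - W s))
      (-(V s * (F s₀ * Complex.exp (W s₀ - W s)))) s := fun s hs =>
    ((((hW s hs).const_sub (W s₀)).cexp).const_mul (F s₀)).congr_deriv (by ring)
  refine ⟨fun s => F s₀ * Complex.exp (W s₀ - W s), hE, fun s hs => ?_, fun B hB s hs => ?_⟩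
  · have hd : ∀ z ∈ U ∩ ball s₀ ρ,
        HasDerivAt (fun z => F z * Complex.exp (W z - W s₀)) 0 z := fun z hz =>
      ((hF z hz).mul ((hW z hz.2).sub_const (W s₀)).cexp).congr_deriv (by ring)
    have h := (hU.inter isOpen_ball).is_const_of_deriv_eq_zero
      (hUc.inter (convex_ball s₀ ρ)).isPreconnected
      (fun z hz => (hd z hz).differentiableAt.differentiableWithinAt)
      (fun z hz => (hd z hz).deriv) hs ⟨hs₀, mem_ball_self hρ⟩
    simp only [sub_self, Complex.exp_zero, mul_one] at h
    simp only
    rw [← h, mul_assoc, ← Complex.exp_add]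
    simp
  · have hB0 : 0 ≤ B := (norm_nonneg _).trans (hB s hs)
    have h := (convex_ball s₀ ρ).norm_image_sub_le_of_norm_hasDerivWithin_le (f := W) (f' := V)
      (C := B) (fun z hz => (hW z hz).hasDerivWithinAt) hB hs (mem_ball_self hρ)
    rw [norm_mul, Complex.norm_exp]
    gcongr
    refine (Complex.re_le_norm _).trans (h.trans ?_)
    gcongr
    rw [mem_ball_iff_norm'] at hs
    exact hs.le

lemma norm_iteratedDeriv_le_of_hasDerivAt {U : Set ℂ} (hU : IsOpen U) (hUc : Convex ℝ U)
    {F V : ℂ → ℂ} {s₀ : ℂ} {ρ B : ℝ} (hs₀ : s₀ ∈ U) (hρ : 0 < ρ)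
    (hF : ∀ s ∈ U ∩ ball s₀ ρ, HasDerivAt F (-(V s * F s)) s)
    (hV : DifferentiableOn ℂ V (ball s₀ ρ)) (hB : ∀ s ∈ ball s₀ ρ, ‖V s‖ ≤ B) (k : ℕ) :
    ‖iteratedDeriv k F s₀‖ ≤ k.factorial * (‖F s₀‖ * Real.exp (B * ρ)) / (ρ / 2) ^ k := by
  obtain ⟨E, hE, hFE, hEB⟩ := exists_extension_of_hasDerivAt hU hUc hs₀ hρ hF hV
  have h : F =ᶠ[𝓝 s₀] E := by
    filter_upwards [(hU.inter isOpen_ball).mem_nhds ⟨hs₀, mem_ball_self hρ⟩] with s hs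
      using hFE hs
  have hsub : closedBall s₀ (ρ / 2) ⊆ ball s₀ ρ := closedBall_subset_ball (by linarith)
  rw [h.iteratedDeriv_eq]
  refine Complex.norm_iteratedDeriv_le_of_forall_mem_sphere_norm_le k (by positivity) ?_
    fun z hz => hEB B hB z (hsub (sphere_subset_closedBall hz))
  refine DifferentiableOn.diffContOnCl fun z hz => ?_
  rw [closure_ball _ (by positivity)] at hz
  exact (hE z (hsub hz)).differentiableAt.differentiableWithinAt

/-- Taylor expansion with bounded remainder. -/
lemma exists_taylor_of_differentiableOn {f : ℂ → ℂ} {c : ℂ} {ρ : ℝ} (hρ : 0 < ρ)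
    (hf : DifferentiableOn ℂ f (ball c ρ)) (n : ℕ) :
    ∃ (a : ℕ → ℂ) (M : ℝ), a 0 = f c ∧ a 1 = deriv f c ∧ 0 ≤ M ∧
      ∀ s ∈ closedBall c (ρ / 2), ‖f s - ∑ j ∈ Finset.range n, a j * (s - c) ^ j‖ ≤
        M * ‖s - c‖ ^ n := by
  set D : ℕ → ℂ → ℂ := fun j => (fun g => dslope g c)^[j] f with hD
  have hDs : ∀ j, D (j + 1) = dslope (D j) c := fun j => by
    simp only [hD, Function.iterate_succ_apply']
  have hdiff : ∀ j, DifferentiableOn ℂ (D j) (ball c ρ) := by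
    intro j
    induction j with
    | zero => exact hf
    | succ j ih =>
      rw [hDs]
      exact (Complex.differentiableOn_dslope (ball_mem_nhds c hρ)).mpr ih
  have hexp : ∀ s, f s - ∑ j ∈ Finset.range n, D j c * (s - c) ^ j = D n s * (s - c) ^ n := by
    intro s
    induction n with
    | zero => simp [hD]
    | succ n ih =>
      have h1 := sub_smul_dslope (D n) c s
      rw [smul_eq_mul] at h1
      rw [Finset.sum_range_succ, ← sub_sub, ih, hDs, pow_succ]
      linear_combination (-(s - c) ^ n) * h1
  have hcont : ContinuousOn (D n) (closedBall c (ρ / 2)) :=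
    (hdiff n).continuousOn.mono (closedBall_subset_ball (by linarith))
  obtain ⟨M, hM⟩ := (isCompact_closedBall c (ρ / 2)).exists_bound_of_continuousOn hcont
  refine ⟨fun j => D j c, |M|, rfl, ?_, abs_nonneg M, fun s hs => ?_⟩
  · simp only [hDs 0, dslope_same]
    rfl
  · rw [hexp, norm_mul, norm_pow]
    gcongr
    exact (hM s hs).trans (le_abs_self M)

/-- The numerators of the successive derivatives of `(s - 1) ^ (-α) * G s`. -/
noncomputable def polarNumerator (α : ℂ) (G : ℂ → ℂ) : ℕ → ℂ → ℂ
  | 0 => G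
  | k + 1 => fun s => (-α - k) * polarNumerator α G k s + (s - 1) * deriv (polarNumerator α G k) s

variable {α : ℂ} {G : ℂ → ℂ} {ρ : ℝ}

lemma differentiableOn_polarNumerator (hG : DifferentiableOn ℂ G (ball 1 ρ)) (k : ℕ) :
    DifferentiableOn ℂ (polarNumerator α G k) (ball 1 ρ) := by
  induction k with
  | zero => exact hG
  | succ k ih =>
    exact (ih.const_mul _).add ((differentiableOn_id.sub_const 1).mul (ih.deriv isOpen_ball))

lemma polarNumerator_one (α : ℂ) (G : ℂ → ℂ) (k : ℕ) :
    polarNumerator α G k 1 = (∏ i ∈ Finset.range k, (-α - i)) * G 1 := by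
  induction k with
  | zero => simp [polarNumerator]
  | succ k ih => simp only [polarNumerator, ih, Finset.prod_range_succ]; ring

lemma deriv_polarNumerator_one (hρ : 0 < ρ) (hG : DifferentiableOn ℂ G (ball 1 ρ)) (k : ℕ) :
    deriv (polarNumerator α G k) 1 = (∏ i ∈ Finset.range k, (1 - α - i)) * deriv G 1 := by
  induction k with
  | zero => simp [polarNumerator]
  | succ k ih =>
    have h := differentiableOn_polarNumerator (α := α) hG k
    have h1 := (h.differentiableAt (ball_mem_nhds 1 hρ)).hasDerivAt
    have h2 := ((h.deriv isOpen_ball).differentiableAt (ball_mem_nhds 1 hρ)).hasDerivAt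
    have h3 := (h1.const_mul (-α - k)).add (((hasDerivAt_id (1 : ℂ)).sub_const 1).mul h2)
    have h4 : deriv (polarNumerator α G (k + 1)) 1 = _ := h3.deriv
    rw [h4, ih, Finset.prod_range_succ]
    simp
    ring

lemma iteratedDeriv_eq_polarNumerator {F : ℂ → ℂ} (hG : DifferentiableOn ℂ G (ball 1 ρ))
    (hF : ∀ s ∈ ball (1 : ℂ) ρ, 1 < s.re → F s = (s - 1) ^ (-α) * G s) (k : ℕ) :
    ∀ s ∈ ball (1 : ℂ) ρ, 1 < s.re →
      iteratedDeriv k F s = (s - 1) ^ (-α - k) * polarNumerator α G k s := by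
  induction k with
  | zero => simpa [polarNumerator] using hF
  | succ k ih =>
    intro s hs hs1
    rw [iteratedDeriv_succ]
    have h0 : iteratedDeriv k F =ᶠ[𝓝 s] fun s => (s - 1) ^ (-α - k) * polarNumerator α G k s := by
      filter_upwards [isOpen_ball.mem_nhds hs,
        (isOpen_lt continuous_const Complex.continuous_re).mem_nhds hs1] with z hz hz1
        using ih z hz hz1
    rw [h0.deriv_eq]
    have h := ((differentiableOn_polarNumerator (α := α) hG k).differentiableAt
      (isOpen_ball.mem_nhds hs)).hasDerivAt
    have hslit : s - 1 ∈ Complex.slitPlane := Or.inl (by simpa using hs1)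
    have h1 := (((hasDerivAt_id s).sub_const 1).cpow_const (c := -α - k) hslit).mul h
    have h2 := h1.deriv
    simp only [id_eq] at h2
    refine h2.trans ?_
    have hne : s - 1 ≠ 0 := Complex.slitPlane_ne_zero hslit
    have h3 : (s - 1) ^ (-α - k) = (s - 1) ^ (-α - k - 1) * (s - 1) := by
      rw [Complex.cpow_sub (-α - k) 1 hne, Complex.cpow_one, div_mul_cancel₀ _ hne]
    have h4 : -α - ((k + 1 : ℕ) : ℂ) = -α - k - 1 := by push_cast; ring
    rw [h4, h3]
    simp only [polarNumerator]
    ring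

end Extension

section Singularity
open Set Metric

lemma exists_eq_cpow_mul_of_hasDerivAt {F V V₀ : ℂ → ℂ} {α ρ : ℝ} (hρ : 0 < ρ)
    (hF : ∀ s : ℂ, 1 < s.re → HasDerivAt F (-(V s * F s)) s)
    (hV₀ : DifferentiableOn ℂ V₀ (ball 1 ρ))
    (hV : ∀ s ∈ ball (1 : ℂ) ρ, 1 < s.re → V s = α / (s - 1) + V₀ s)
    (hreal : ∀ σ : ℝ, 1 < σ → (F σ).im = 0) :
    ∃ G : ℂ → ℂ, DifferentiableOn ℂ G (ball 1 (ρ / 4)) ∧ deriv G 1 = -(V₀ 1 * G 1) ∧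
      (G 1).im = 0 ∧ ∀ s ∈ ball (1 : ℂ) (ρ / 4), 1 < s.re → F s = (s - 1) ^ (-α : ℂ) * G s := by
  set U : Set ℂ := {s | 1 < s.re} with hU
  have hslit : ∀ s ∈ U, s - 1 ∈ Complex.slitPlane := fun s hs =>
    Or.inl (by simpa [hU] using hs)
  have hs₀ : ((1 + ρ / 4 : ℝ) : ℂ) ∈ U := by
    simp only [hU, mem_ofPred_eq, Complex.ofReal_re]; linarith
  have hsub1 : ball (((1 + ρ / 4 : ℝ) : ℂ)) (ρ / 2) ⊆ ball 1 ρ := by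
    refine ball_subset_ball' ?_
    rw [dist_eq_norm, show (((1 + ρ / 4 : ℝ) : ℂ)) - 1 = ((ρ / 4 : ℝ) : ℂ) by push_cast; ring,
      Complex.norm_real, Real.norm_eq_abs, abs_of_pos (by positivity)]
    linarith
  have hsub2 : ball 1 (ρ / 4) ⊆ ball (((1 + ρ / 4 : ℝ) : ℂ)) (ρ / 2) := by
    refine ball_subset_ball' ?_
    rw [dist_eq_norm', show (((1 + ρ / 4 : ℝ) : ℂ)) - 1 = ((ρ / 4 : ℝ) : ℂ) by push_cast; ring,
      Complex.norm_real, Real.norm_eq_abs, abs_of_pos (by positivity)]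
    linarith
  obtain ⟨G, hG, hFG, -⟩ := exists_extension_of_hasDerivAt (U := U)
    (F := fun s => (s - 1) ^ (α : ℂ) * F s) (V := V₀) (s₀ := ((1 + ρ / 4 : ℝ) : ℂ)) (ρ := ρ / 2)
    (isOpen_lt continuous_const Complex.continuous_re) (convex_halfSpace_re_gt 1) hs₀
    (by positivity) (fun s hs => by
      have hne := Complex.slitPlane_ne_zero (hslit s hs.1)
      have h1 := ((hasDerivAt_id s).sub_const 1).cpow_const (c := (α : ℂ)) (hslit s hs.1)
      refine (h1.mul (hF s hs.1)).congr_deriv ?_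
      rw [hV s (hsub1 hs.2) hs.1]
      simp only [id_eq]
      rw [Complex.cpow_sub _ _ hne, Complex.cpow_one]
      field_simp
      ring) (hV₀.mono hsub1)
  have hGF : ∀ s ∈ ball (1 : ℂ) (ρ / 4), 1 < s.re → G s = (s - 1) ^ (α : ℂ) * F s :=
    fun s hs hs1 => (hFG ⟨hs1, hsub2 hs⟩).symm
  have h1mem : (1 : ℂ) ∈ ball (1 : ℂ) (ρ / 4) := mem_ball_self (by positivity)
  refine ⟨G, fun s hs => (hG s (hsub2 hs)).differentiableAt.differentiableWithinAt,
    (hG 1 (hsub2 h1mem)).deriv, ?_, fun s hs hs1 => ?_⟩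
  · have hcont : Tendsto (fun σ : ℝ => (G σ).im) (𝓝[>] 1) (𝓝 (G 1).im) := by
      have h1 : ContinuousAt G ((1 : ℝ) : ℂ) := by
        simpa using (hG 1 (hsub2 h1mem)).continuousAt
      have h2 : ContinuousAt (fun σ : ℝ => (G σ).im) 1 :=
        Complex.continuous_im.continuousAt.comp
          (ContinuousAt.comp (f := fun σ : ℝ => (σ : ℂ)) h1 Complex.continuous_ofReal.continuousAt)
      have h3 := h2.tendsto
      simp only [Complex.ofReal_one] at h3
      exact h3.mono_left nhdsWithin_le_nhds
    refine tendsto_nhds_unique (hcont.congr' ?_) tendsto_const_nhds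
    filter_upwards [Ioo_mem_nhdsGT (show (1 : ℝ) < 1 + ρ / 4 by linarith)] with σ hσ
    have hmem : (σ : ℂ) ∈ ball (1 : ℂ) (ρ / 4) := by
      rw [mem_ball_iff_norm, show (σ : ℂ) - 1 = ((σ - 1 : ℝ) : ℂ) by push_cast; ring,
        Complex.norm_real, Real.norm_eq_abs, abs_of_pos (by linarith [hσ.1])]
      linarith [hσ.2]
    rw [hGF σ hmem (by simpa using hσ.1),
      show (σ : ℂ) - 1 = ((σ - 1 : ℝ) : ℂ) by push_cast; ring,
      ← Complex.ofReal_cpow (by linarith [hσ.1]), Complex.im_ofReal_mul, hreal σ hσ.1, mul_zero]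
  · rw [hGF s hs hs1, Complex.cpow_neg, inv_mul_cancel_left₀]
    exact fun h => Complex.slitPlane_ne_zero (hslit s hs1) ((Complex.cpow_eq_zero_iff _ _).mp h).1

lemma exists_iteratedDeriv_sub_le {F V V₀ : ℂ → ℂ} {α ρ : ℝ} (hα : 0 < α) (hρ : 0 < ρ)
    (hF : ∀ s : ℂ, 1 < s.re → HasDerivAt F (-(V s * F s)) s)
    (hV₀ : DifferentiableOn ℂ V₀ (ball 1 ρ))
    (hV : ∀ s ∈ ball (1 : ℂ) ρ, 1 < s.re → V s = α / (s - 1) + V₀ s)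
    (hreal : ∀ σ : ℝ, 1 < σ → (F σ).im = 0) :
    ∃ (b : ℕ → ℂ) (ρ' M : ℝ), 0 < ρ' ∧ 0 ≤ M ∧ (b 1).re = (α - 1) * (-(V₀ 1).re) * (b 0).re ∧
      ∀ s : ℂ, ‖s - 1‖ ≤ ρ' → 1 < s.re →
        ‖iteratedDeriv 6 F s - ∑ j ∈ Finset.range 6, b j * (Complex.Gamma ((α + 6 - j : ℝ)) *
          (s - 1) ^ (-((α + 6 - j : ℝ) : ℂ)))‖ ≤ M * ‖s - 1‖ ^ (-α) := by
  obtain ⟨G, hG, hG', hG1, hFG⟩ := exists_eq_cpow_mul_of_hasDerivAt hρ hF hV₀ hV hreal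
  have hρ4 : 0 < ρ / 4 := by positivity
  obtain ⟨a, M, ha0, ha1, hM0, hM⟩ := exists_taylor_of_differentiableOn hρ4
    (differentiableOn_polarNumerator (α := (α : ℂ)) hG 6) 6
  have hΓ : ∀ j ∈ Finset.range 6, Complex.Gamma ((α + 6 - j : ℝ)) ≠ 0 := fun j hj => by
    have : (j : ℝ) ≤ 5 := by
      exact_mod_cast Nat.lt_succ_iff.mp (Finset.mem_range.mp hj)
    exact Complex.Gamma_ne_zero_of_re_pos (by simp only [Complex.ofReal_re]; linarith)
  refine ⟨fun j => a j / Complex.Gamma ((α + 6 - j : ℝ)), ρ / 4 / 2, M, by positivity, hM0, ?_,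
    fun s hs hs1 => ?_⟩
  · have hrec : Complex.Gamma ((α + 6 : ℝ)) = (α + 5) * Complex.Gamma ((α + 5 : ℝ)) := by
      rw [show ((α + 6 : ℝ) : ℂ) = ((α + 5 : ℝ) : ℂ) + 1 by push_cast; ring,
        Complex.Gamma_add_one _ (by exact_mod_cast (by positivity : α + 5 ≠ 0))]
      push_cast
      ring
    have hΓ5 : Complex.Gamma ((α + 5 : ℝ)) ≠ 0 :=
      Complex.Gamma_ne_zero_of_re_pos (by simp only [Complex.ofReal_re]; linarith)
    have hα5 : (α : ℂ) + 5 ≠ 0 := by exact_mod_cast (by positivity : α + 5 ≠ 0)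
    have hb0 : a 0 / Complex.Gamma ((α + 6 - (0 : ℕ) : ℝ)) =
        ((∏ i ∈ Finset.range 6, (-α - i)) * (G 1).re / Real.Gamma (α + 6) : ℝ) := by
      rw [ha0, polarNumerator_one, Nat.cast_zero, sub_zero, Complex.Gamma_ofReal,
        show G 1 = ((G 1).re : ℂ) from Complex.ext rfl (by simpa using hG1)]
      push_cast
      simp
    have hb1 : a 1 / Complex.Gamma ((α + 6 - (1 : ℕ) : ℝ)) =
        ((α - 1 : ℝ) : ℂ) * (-V₀ 1) * (a 0 / Complex.Gamma ((α + 6 - (0 : ℕ) : ℝ))) := by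
      rw [ha0, ha1, polarNumerator_one, deriv_polarNumerator_one hρ4 hG, hG', Nat.cast_zero,
        sub_zero, Nat.cast_one, show α + 6 - 1 = α + 5 by ring, hrec]
      simp only [Finset.prod_range_succ, Finset.prod_range_zero]
      push_cast
      field_simp
      ring
    simp only [hb1]
    rw [hb0, Complex.re_mul_ofReal, Complex.re_ofReal_mul, Complex.ofReal_re, Complex.neg_re]
  · have hmem : s ∈ ball (1 : ℂ) (ρ / 4) := by rw [mem_ball_iff_norm]; linarith
    have hne : s - 1 ≠ 0 := Complex.slitPlane_ne_zero (Or.inl (by simpa using hs1))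
    have hn0 : 0 < ‖s - 1‖ := norm_pos_iff.mpr hne
    have hsum : ∑ j ∈ Finset.range 6, a j / Complex.Gamma ((α + 6 - j : ℝ)) *
        (Complex.Gamma ((α + 6 - j : ℝ)) * (s - 1) ^ (-((α + 6 - j : ℝ) : ℂ))) =
        (s - 1) ^ (-(α : ℂ) - (6 : ℕ)) * ∑ j ∈ Finset.range 6, a j * (s - 1) ^ j := by
      rw [Finset.mul_sum]
      refine Finset.sum_congr rfl fun j hj => ?_
      rw [← mul_assoc, div_mul_cancel₀ _ (hΓ j hj), show -((α + 6 - j : ℝ) : ℂ) =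
        (-(α : ℂ) - (6 : ℕ)) + j by push_cast; ring, Complex.cpow_add _ _ hne,
        Complex.cpow_natCast]
      ring
    rw [hsum, iteratedDeriv_eq_polarNumerator hG hFG 6 s hmem hs1, ← mul_sub, norm_mul]
    have h1 : ‖(s - 1) ^ (-(α : ℂ) - (6 : ℕ))‖ = ‖s - 1‖ ^ (-α - 6) := by
      rw [show (-(α : ℂ) - (6 : ℕ)) = ((-α - 6 : ℝ) : ℂ) by push_cast; ring,
        Complex.norm_cpow_real]
    rw [h1]
    calc _ ≤ ‖s - 1‖ ^ (-α - 6) * (M * ‖s - 1‖ ^ 6) := by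
          gcongr
          exact hM s (mem_closedBall_iff_norm.mpr hs)
      _ = _ := by
        rw [← Real.rpow_natCast, mul_left_comm, ← Real.rpow_add hn0]
        norm_num

end Singularity

section AnalyticCriterion
open Set Metric DirichletCharacter

variable {f : ℕ → ℝ}

lemma LSeriesSummable_ofReal_of_le_one (hf0 : ∀ n, 0 ≤ f n) (hf1 : ∀ n, f n ≤ 1) {s : ℂ}
    (hs : 1 < s.re) : LSeriesSummable (fun n => (f n : ℂ)) s :=
  LSeriesSummable_of_bounded_of_one_lt_re (m := 1)
    (fun n _ => by rw [Complex.norm_real, Real.norm_eq_abs, abs_of_nonneg (hf0 n)]; exact hf1 n) hs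

lemma abscissaOfAbsConv_ofReal_lt (hf0 : ∀ n, 0 ≤ f n) (hf1 : ∀ n, f n ≤ 1) {s : ℂ}
    (hs : 1 < s.re) : LSeries.abscissaOfAbsConv (fun n => (f n : ℂ)) < s.re :=
  (LSeries.abscissaOfAbsConv_le_of_forall_lt_LSeriesSummable fun y hy =>
    LSeriesSummable_ofReal_of_le_one hf0 hf1 (by simpa using hy)).trans_lt (by exact_mod_cast hs)

lemma exists_norm_LSeries_le : ∃ A : ℝ, 0 < A ∧ ∀ f : ℕ → ℝ, (∀ n, 0 ≤ f n) → (∀ n, f n ≤ 1) →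
    ∀ s : ℂ, 1 < s.re → s.re ≤ 2 → ‖LSeries (fun n => (f n : ℂ)) s‖ ≤ A / (s.re - 1) := by
  obtain ⟨A, hA0, hA⟩ := exists_norm_LFunctionTrivChar_le 1
  refine ⟨A, hA0, fun f hf0 hf1 s h1 h2 => ?_⟩
  have hσ : (1 : ℝ) < (s.re : ℂ).re := by simpa using h1
  have hsum : HasSum (LSeries.term 1 (s.re : ℂ)) (LSeries 1 (s.re : ℂ)) :=
    (LSeriesSummable_one_iff.mpr hσ).hasSum
  have hle : ‖LSeries (fun n => (f n : ℂ)) s‖ ≤ (LSeries 1 (s.re : ℂ)).re := by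
    refine tsum_of_norm_bounded (Complex.hasSum_re hsum) fun n => ?_
    rcases eq_or_ne n 0 with rfl | hn
    · simp
    · rw [LSeries.norm_term_eq, if_neg hn, LSeries.term_of_ne_zero hn, Complex.norm_real,
        Real.norm_eq_abs, abs_of_nonneg (hf0 n), ← Complex.ofReal_natCast,
        ← Complex.ofReal_cpow (Nat.cast_nonneg n)]
      simp only [Pi.one_apply, ← Complex.ofReal_one, ← Complex.ofReal_div, Complex.ofReal_re]
      gcongr
      exact hf1 n
  refine hle.trans ((Complex.re_le_norm _).trans ?_)
  have h3 := hA (s.re - 1) (by linarith) (by linarith)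
  rw [LSeries_one_eq_riemannZeta hσ]
  rw [show (1 : ℂ) + (s.re - 1 : ℝ) = (s.re : ℂ) by push_cast; ring,
    LFunctionTrivChar_eq_mul_riemannZeta (by
      intro h; rw [h] at hσ; simp at hσ)] at h3
  simpa using h3

lemma iteratedDeriv_LSeries_ofReal (hf0 : ∀ n, 0 ≤ f n) (hf1 : ∀ n, f n ≤ 1) {s : ℂ}
    (hs : 1 < s.re) : iteratedDeriv 6 (LSeries fun n => (f n : ℂ)) s =
      LSeries (fun n => ((f n * Real.log n ^ 6 : ℝ) : ℂ)) s := by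
  rw [LSeries_iteratedDeriv 6 (abscissaOfAbsConv_ofReal_lt hf0 hf1 hs)]
  have h : ∀ m n : ℕ, LSeries.logMul^[m] (fun n => (f n : ℂ)) n =
      ((f n * Real.log n ^ m : ℝ) : ℂ) := by
    intro m
    induction m with
    | zero => simp
    | succ m ih =>
      intro n
      rw [Function.iterate_succ_apply', LSeries.logMul, ih, ← Complex.natCast_log]
      push_cast
      ring
  rw [funext (h 6)]
  norm_num

/-- Selberg–Delange type expansion to second order, from analytic information on the logarithmic
derivative of the generating Dirichlet series. -/
lemma sum_sub_isBigO_of_hasDerivAt_LSeries (hf0 : ∀ n, 0 ≤ f n) (hf1 : ∀ n, f n ≤ 1) {α ρ : ℝ}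
    (hα0 : 0 < α) (hα1 : α < 1) (hρ : 0 < ρ) {V V₀ : ℂ → ℂ}
    (hF : ∀ s : ℂ, 1 < s.re → HasDerivAt (LSeries fun n => (f n : ℂ))
      (-(V s * LSeries (fun n => (f n : ℂ)) s)) s)
    (hV₀ : DifferentiableOn ℂ V₀ (ball 1 ρ))
    (hV : ∀ s ∈ ball (1 : ℂ) ρ, 1 < s.re → V s = α / (s - 1) + V₀ s)
    (hfar : ∀ τ : ℝ, 0 < τ → ∃ C ρ₀ : ℝ, 0 < C ∧ 0 < ρ₀ ∧ ∀ s₀ : ℂ, 1 < s₀.re → s₀.re ≤ 2 →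
      τ ≤ |s₀.im| → DifferentiableOn ℂ V (ball s₀ (ρ₀ / (1 + |s₀.im|) ^ (1 / 12 : ℝ))) ∧
        ∀ s ∈ ball s₀ (ρ₀ / (1 + |s₀.im|) ^ (1 / 12 : ℝ)),
          ‖V s‖ ≤ C * (1 + |s₀.im|) ^ (1 / 12 : ℝ)) :
    ∃ c : ℝ, (fun x : ℝ => ∑ n ∈ Finset.Icc 1 ⌊x⌋₊, f n -
      x * (c * Real.log x ^ (α - 1) + (1 - α) * c * (1 + (V₀ 1).re) * Real.log x ^ (α - 2)))
        =O[atTop] fun x => x * Real.log x ^ (α - 3) := by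
  set F : ℂ → ℂ := LSeries fun n => (f n : ℂ) with hFdef
  have hreal : ∀ σ : ℝ, 1 < σ → (F σ).im = 0 := by
    intro σ hσ
    have h := (LSeriesSummable_ofReal_of_le_one hf0 hf1
      (show 1 < (σ : ℂ).re by simpa using hσ)).hasSum
    have h2 := Complex.hasSum_im h
    refine h2.unique ?_
    convert hasSum_zero (α := ℝ) (β := ℕ) using 2 with n
    rcases eq_or_ne n 0 with rfl | hn
    · simp
    · rw [LSeries.term_of_ne_zero hn, ← Complex.ofReal_natCast,
        ← Complex.ofReal_cpow (Nat.cast_nonneg n), ← Complex.ofReal_div, Complex.ofReal_im]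
  obtain ⟨b, ρ', M, hρ', hM0, hb, hM⟩ := exists_iteratedDeriv_sub_le hα0 hρ hF hV₀ hV hreal
  set τ := min 1 (ρ' / 2) with hτdef
  have hτ0 : 0 < τ := lt_min one_pos (by positivity)
  have hτ1 : τ ≤ 1 := min_le_left _ _
  have hτ2 : τ ≤ ρ' / 2 := min_le_right _ _
  obtain ⟨C, ρ₀, hC0, hρ₀, hfar⟩ := hfar τ hτ0
  obtain ⟨A, hA0, hA⟩ := exists_norm_LSeries_le
  set S : ℝ := ∑ j ∈ Finset.range 6, ‖b j * Complex.Gamma ((α + 6 - j : ℝ))‖ *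
    τ ^ (-(α + 6 - j)) with hS
  have hS0 : 0 ≤ S := Finset.sum_nonneg fun j _ => by positivity
  set D : ℝ := 720 * A * Real.exp (C * ρ₀) / (ρ₀ / 2) ^ 6 with hD
  have hD0 : 0 ≤ D := by positivity
  have key : ∀ σ t : ℝ, 1 < σ → σ ≤ 1 + τ →
      ‖LSeries (fun n => ((f n * Real.log n ^ 6 : ℝ) : ℂ)) (σ + t * Complex.I) -
        ∑ j ∈ Finset.range 6, b j * (Complex.Gamma ((α + 6 - j : ℝ)) *
          ((σ + t * Complex.I) - 1) ^ (-((α + 6 - j : ℝ) : ℂ)))‖ ≤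
        (M + D + S) / (σ - 1) * (1 + |t|) ^ (1 / 2 : ℝ) := by
    intro σ t hσ hστ
    set s : ℂ := σ + t * Complex.I with hs
    have hre : s.re = σ := by simp [hs]
    have him : s.im = t := by simp [hs]
    have hs1 : 1 < s.re := by rwa [hre]
    have hT : 1 ≤ (1 + |t|) ^ (1 / 2 : ℝ) :=
      Real.one_le_rpow (by linarith [abs_nonneg t]) (by norm_num)
    have hσ0 : 0 < σ - 1 := by linarith
    rw [← iteratedDeriv_LSeries_ofReal hf0 hf1 hs1]
    have hn : σ - 1 ≤ ‖s - 1‖ := by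
      have := (le_abs_self _).trans (Complex.abs_re_le_norm (s - 1))
      simpa [hre] using this
    rcases le_or_gt |t| τ with ht | ht
    · have hnear : ‖s - 1‖ ≤ ρ' := by
        refine (Complex.norm_le_abs_re_add_abs_im _).trans ?_
        simp only [Complex.sub_re, Complex.sub_im, hre, him, Complex.one_re, Complex.one_im,
          sub_zero]
        rw [abs_of_pos hσ0]
        linarith
      refine (hM s hnear hs1).trans ?_
      calc M * ‖s - 1‖ ^ (-α) ≤ M * (σ - 1) ^ (-α) := by
            gcongr ?_ * ?_
            exact Real.rpow_le_rpow_of_nonpos hσ0 hn (by linarith)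
        _ ≤ M * (σ - 1) ^ (-1 : ℝ) := by
            gcongr ?_ * ?_
            exact Real.rpow_le_rpow_of_exponent_ge hσ0 (by linarith) (by linarith)
        _ = M / (σ - 1) * 1 := by rw [Real.rpow_neg_one]; ring
        _ ≤ _ := by gcongr; linarith
    · have hsτ : τ ≤ ‖s - 1‖ := by
        have := Complex.abs_im_le_norm (s - 1)
        simp only [Complex.sub_im, him, Complex.one_im, sub_zero] at this
        linarith
      obtain ⟨hVd, hVb⟩ := hfar s hs1 (by rw [hre]; linarith) (by rw [him]; exact ht.le)
      rw [him] at hVd hVb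
      have hP0 : 0 < (1 + |t|) ^ (1 / 12 : ℝ) := by positivity
      have hder := norm_iteratedDeriv_le_of_hasDerivAt (U := {s | 1 < s.re})
        (isOpen_lt continuous_const Complex.continuous_re) (convex_halfSpace_re_gt 1) hs1
        (div_pos hρ₀ hP0) (fun z hz => hF z hz.1) hVd hVb 6
      have hP6 : ((1 + |t|) ^ (1 / 12 : ℝ)) ^ 6 = (1 + |t|) ^ (1 / 2 : ℝ) := by
        rw [← Real.rpow_natCast, ← Real.rpow_mul (by positivity)]
        norm_num
      have hFs : ‖F s‖ ≤ A / (σ - 1) := by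
        have := hA f hf0 hf1 s hs1 (by rw [hre]; linarith)
        rwa [hre] at this
      have h1 : ‖iteratedDeriv 6 F s‖ ≤ D / (σ - 1) * (1 + |t|) ^ (1 / 2 : ℝ) := by
        refine hder.trans ?_
        rw [← hP6]
        set P := (1 + |t|) ^ (1 / 12 : ℝ)
        have hfac : ((6 : ℕ).factorial : ℝ) = 720 := by norm_num [Nat.factorial]
        rw [hfac, show C * P * (ρ₀ / P) = C * ρ₀ by field_simp]
        calc 720 * (‖F s‖ * Real.exp (C * ρ₀)) / (ρ₀ / P / 2) ^ 6 ≤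
              720 * (A / (σ - 1) * Real.exp (C * ρ₀)) / (ρ₀ / P / 2) ^ 6 := by gcongr
          _ = _ := by rw [hD]; field_simp
      have h2 : ‖∑ j ∈ Finset.range 6, b j * (Complex.Gamma ((α + 6 - j : ℝ)) *
          (s - 1) ^ (-((α + 6 - j : ℝ) : ℂ)))‖ ≤ S := by
        refine norm_sum_le_of_le _ fun j hj => ?_
        have hj5 : (j : ℝ) ≤ 5 := by exact_mod_cast Nat.lt_succ_iff.mp (Finset.mem_range.mp hj)
        rw [← mul_assoc, norm_mul, ← Complex.ofReal_neg, Complex.norm_cpow_real]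
        gcongr ?_ * ?_
        exact Real.rpow_le_rpow_of_nonpos hτ0 hsτ (by linarith)
      have h3 : S ≤ S / (σ - 1) * (1 + |t|) ^ (1 / 2 : ℝ) := by
        have : S * 1 ≤ S / (σ - 1) * 1 := by
          rw [mul_one, mul_one, le_div_iff₀ hσ0]
          nlinarith
        calc S = S * 1 := (mul_one S).symm
          _ ≤ S / (σ - 1) * 1 := this
          _ ≤ _ := by gcongr
      have h4 : 0 ≤ M / (σ - 1) * (1 + |t|) ^ (1 / 2 : ℝ) := by positivity
      calc _ ≤ ‖iteratedDeriv 6 F s‖ + S := (norm_sub_le _ _).trans (by gcongr)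
        _ ≤ D / (σ - 1) * (1 + |t|) ^ (1 / 2 : ℝ) + S / (σ - 1) * (1 + |t|) ^ (1 / 2 : ℝ) :=
          add_le_add h1 h3
        _ ≤ _ := by
          rw [add_div, add_div, add_mul, add_mul]
          linarith
  have h := sum_sub_isBigO_of_sum_mul_log_pow hα1
    (sum_mul_log_pow_sub_isBigO hf0 hf1 hα0 (b := b) hτ0 key)
  refine ⟨(b 0).re, ?_⟩
  refine h.congr_left fun x => ?_
  rw [hb]
  ring

end AnalyticCriterion

section LocalFactors

/-- The indicator function of the `n` with `q ∤ n σ_k(n)`. -/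
noncomputable def coprimeIndicator (k q n : ℕ) : ℝ := if q ∣ n * sigmak k n then 0 else 1

lemma coprimeIndicator_nonneg (k q n : ℕ) : 0 ≤ coprimeIndicator k q n := by
  unfold coprimeIndicator; split_ifs <;> norm_num

lemma coprimeIndicator_le_one (k q n : ℕ) : coprimeIndicator k q n ≤ 1 := by
  unfold coprimeIndicator; split_ifs <;> norm_num

lemma sigmak_eq_sigma (k n : ℕ) : sigmak k n = ArithmeticFunction.sigma k n := by
  rw [ArithmeticFunction.sigma_apply]; rfl

lemma sigmak_mul_of_coprime (k : ℕ) {m n : ℕ} (h : m.Coprime n) :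
    sigmak k (m * n) = sigmak k m * sigmak k n := by
  simp only [sigmak_eq_sigma]
  exact ArithmeticFunction.isMultiplicative_sigma.map_mul_of_coprime h

lemma sigmak_prime_pow (k : ℕ) {p : ℕ} (hp : p.Prime) (a : ℕ) :
    sigmak k (p ^ a) = ∑ i ∈ Finset.range (a + 1), (p ^ k) ^ i := by
  unfold sigmak
  rw [Nat.sum_divisors_prime_pow hp]
  exact Finset.sum_congr rfl fun i _ => by rw [← pow_mul, ← pow_mul, mul_comm]

lemma sigmak_one (k : ℕ) : sigmak k 1 = 1 := by simp [sigmak]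

lemma coprimeIndicator_one {k q : ℕ} (hq : q.Prime) : coprimeIndicator k q 1 = 1 := by
  simp [coprimeIndicator, sigmak_one, hq.one_lt.ne']

lemma coprimeIndicator_zero (k q : ℕ) : coprimeIndicator k q 0 = 0 := by
  simp [coprimeIndicator]

lemma coprimeIndicator_mul {k q : ℕ} (hq : q.Prime) {m n : ℕ} (h : m.Coprime n) :
    coprimeIndicator k q (m * n) = coprimeIndicator k q m * coprimeIndicator k q n := by
  have : q ∣ m * n * sigmak k (m * n) ↔ q ∣ m * sigmak k m ∨ q ∣ n * sigmak k n := by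
    rw [sigmak_mul_of_coprime k h, mul_mul_mul_comm, hq.dvd_mul]
  unfold coprimeIndicator
  simp only [this]
  split_ifs <;> simp_all

lemma gp_eq_orderOf_pow {q k p : ℕ} [Fact q.Prime] (hk : k ≠ 0) (hp : (p : ZMod q) ≠ 0) :
    gp q (k.gcd (q - 1)) p = orderOf ((p : ZMod q) ^ k) := by
  have h1 : orderOf (p : ZMod q) ∣ q - 1 :=
    orderOf_dvd_of_pow_eq_one (ZMod.pow_card_sub_one_eq_one hp)
  unfold gp
  rw [orderOf_pow' _ hk, orderOf_pow' _ (Nat.gcd_pos_of_pos_left _ (Nat.pos_of_ne_zero hk)).ne',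
    Nat.gcd_comm k, ← Nat.gcd_assoc, Nat.gcd_eq_left h1]

lemma gp_dvd {q r p : ℕ} [Fact q.Prime] (hr : r ∣ q - 1) (hp : (p : ZMod q) ≠ 0) :
    gp q r p ∣ (q - 1) / r := by
  refine orderOf_dvd_of_pow_eq_one ?_
  rw [← pow_mul, Nat.mul_div_cancel' hr, ZMod.pow_card_sub_one_eq_one hp]

/-- The smallest exponent `e` such that `q` divides `σ_k(p ^ (e - 1))`. -/
noncomputable def vanishingPeriod (q r p : ℕ) : ℕ := if gp q r p = 1 then q else gp q r p

lemma dvd_sigmak_prime_pow_iff {q k p : ℕ} [Fact q.Prime] (hk : k ≠ 0) (hp : p.Prime)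
    (hp0 : (p : ZMod q) ≠ 0) (a : ℕ) :
    q ∣ sigmak k (p ^ a) ↔ vanishingPeriod q (k.gcd (q - 1)) p ∣ a + 1 := by
  rw [sigmak_prime_pow k hp, ← ZMod.natCast_eq_zero_iff, vanishingPeriod, gp_eq_orderOf_pow hk hp0]
  push_cast
  split_ifs with h
  · rw [orderOf_eq_one_iff] at h
    simp only [h, one_pow, Finset.sum_const, Finset.card_range, nsmul_eq_mul, mul_one]
    rw [ZMod.natCast_eq_zero_iff]
  · rw [orderOf_dvd_iff_pow_eq_one, geom_sum_eq (by rwa [Ne, ← orderOf_eq_one_iff]),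
      div_eq_zero_iff]
    rw [orderOf_eq_one_iff] at h
    simp [sub_eq_zero, h]

lemma natCast_zmod_ne_zero_of_ne {q p : ℕ} [hq : Fact q.Prime] (hp : p.Prime) (h : p ≠ q) :
    (p : ZMod q) ≠ 0 := by
  rw [Ne, ZMod.natCast_eq_zero_iff, Nat.prime_dvd_prime_iff_eq hq.out hp]
  exact h.symm

lemma coprimeIndicator_prime_pow {q k p : ℕ} [hq : Fact q.Prime] (hk : k ≠ 0) (hp : p.Prime)
    (hpq : p ≠ q) (a : ℕ) : coprimeIndicator k q (p ^ a) =
      if vanishingPeriod q (k.gcd (q - 1)) p ∣ a + 1 then 0 else 1 := by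
  have h1 : ¬ q ∣ p ^ a := fun h =>
    hpq ((Nat.prime_dvd_prime_iff_eq hq.out hp).mp (hq.out.dvd_of_dvd_pow h)).symm
  have h2 := dvd_sigmak_prime_pow_iff hk hp (natCast_zmod_ne_zero_of_ne hp hpq) a
  unfold coprimeIndicator
  simp only [hq.out.dvd_mul, h1, false_or, h2]

lemma coprimeIndicator_self_pow {q k a : ℕ} (ha : a ≠ 0) :
    coprimeIndicator k q (q ^ a) = 0 := by
  unfold coprimeIndicator
  rw [if_pos]
  exact (dvd_pow_self q ha).mul_right _

lemma gp_pos {q r p : ℕ} [hq : Fact q.Prime] (hr : r ∣ q - 1) (hp : (p : ZMod q) ≠ 0) :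
    0 < gp q r p := by
  have h0 : 0 < q - 1 := Nat.sub_pos_of_lt hq.out.one_lt
  exact Nat.pos_of_dvd_of_pos (gp_dvd hr hp)
    (Nat.div_pos (Nat.le_of_dvd h0 hr) (Nat.pos_of_dvd_of_pos hr h0))

lemma gp_lt {q r p : ℕ} [hq : Fact q.Prime] (hr : r ∣ q - 1) (hp : (p : ZMod q) ≠ 0) :
    gp q r p < q := by
  have h0 : 0 < q - 1 := Nat.sub_pos_of_lt hq.out.one_lt
  have h1 := Nat.le_of_dvd (Nat.div_pos (Nat.le_of_dvd h0 hr) (Nat.pos_of_dvd_of_pos hr h0))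
    (gp_dvd hr hp)
  have h2 := Nat.div_le_self (q - 1) r
  omega

lemma two_le_vanishingPeriod {q r p : ℕ} [hq : Fact q.Prime] (hr : r ∣ q - 1)
    (hp : (p : ZMod q) ≠ 0) : 2 ≤ vanishingPeriod q r p := by
  have := gp_pos hr hp
  unfold vanishingPeriod
  split_ifs with h
  · exact hq.out.two_le
  · omega

lemma gp_two_mul {q r p : ℕ} : gp q (2 * r) p =
    if 2 ∣ gp q r p then gp q r p / 2 else gp q r p := by
  have h : gp q (2 * r) p = orderOf (((p : ZMod q) ^ r) ^ 2) := by
    rw [← pow_mul, mul_comm]; rfl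
  rw [h, orderOf_pow' _ two_ne_zero]
  change gp q r p / (gp q r p).gcd 2 = _
  split_ifs with h2
  · rw [Nat.gcd_eq_right h2]
  · rw [Nat.Coprime.gcd_eq_one
      (Nat.Coprime.symm ((Nat.Prime.coprime_iff_not_dvd Nat.prime_two).mpr h2)), Nat.div_one]

/-- Summation of a power series over the multiples of `f`. -/
lemma hasSum_ite_dvd_pow {f : ℕ} (hf : 0 < f) {w : ℂ} (hw : ‖w‖ < 1) :
    HasSum (fun j : ℕ => if f ∣ j + 1 then w ^ (j + 1) else 0) (w ^ f / (1 - w ^ f)) := by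
  have hwf : ‖w ^ f‖ < 1 := by rw [norm_pow]; exact pow_lt_one₀ (norm_nonneg _) hw hf.ne'
  have hinj : Function.Injective fun i : ℕ => f * (i + 1) - 1 := by
    intro i j hij
    have h1 : 0 < f * (i + 1) := by positivity
    have h2 : 0 < f * (j + 1) := by positivity
    have h3 : f * (i + 1) = f * (j + 1) := by simp only at hij; omega
    have := Nat.eq_of_mul_eq_mul_left hf h3
    omega
  rw [← hinj.hasSum_iff]
  · have h := (hasSum_geometric_of_norm_lt_one hwf).mul_left (w ^ f)
    rw [← div_eq_mul_inv] at h
    have h2 : ((fun j : ℕ => if f ∣ j + 1 then w ^ (j + 1) else 0) ∘ fun i => f * (i + 1) - 1) =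
        fun i => w ^ f * (w ^ f) ^ i := by
      funext i
      have h1 : f * (i + 1) - 1 + 1 = f * (i + 1) := Nat.sub_add_cancel (Nat.mul_pos hf i.succ_pos)
      simp only [Function.comp_apply, h1, dvd_mul_right, if_true]
      ring
    rwa [h2]
  · intro j hj
    rw [if_neg]
    rintro ⟨c, hc⟩
    refine hj ⟨c - 1, ?_⟩
    have : c ≠ 0 := by rintro rfl; simp at hc
    simp only
    rw [Nat.sub_add_cancel (Nat.one_le_iff_ne_zero.mpr this), ← hc]
    simp

end LocalFactors

section Orthogonality

/-- The Dirichlet characters mod `q` which are trivial on the `m`-th roots of unity. -/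
noncomputable def charsTrivialOnRoots (q m : ℕ) : Finset (DirichletCharacter ℂ q) :=
  open Classical in Finset.univ.filter fun χ => ∀ a : ZMod q, a ^ m = 1 → χ a = 1

lemma mem_charsTrivialOnRoots {q m : ℕ} {χ : DirichletCharacter ℂ q} :
    χ ∈ charsTrivialOnRoots q m ↔ ∀ a : ZMod q, a ^ m = 1 → χ a = 1 := by
  simp [charsTrivialOnRoots]

lemma one_mem_charsTrivialOnRoots {q m : ℕ} (hm : m ≠ 0) :
    (1 : DirichletCharacter ℂ q) ∈ charsTrivialOnRoots q m := by
  rw [mem_charsTrivialOnRoots]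
  intro a ha
  exact MulChar.one_apply (IsUnit.of_pow_eq_one ha hm)

lemma sum_nthRootsFinset_eq {q m : ℕ} [hq : Fact q.Prime] (hm : m ∣ q - 1)
    (χ : DirichletCharacter ℂ q) :
    ∑ b ∈ Polynomial.nthRootsFinset m (1 : ZMod q), χ b =
      open Classical in if χ ∈ charsTrivialOnRoots q m then (m : ℂ) else 0 := by
  have h0 : 0 < q - 1 := Nat.sub_pos_of_lt hq.out.one_lt
  have hm0 : 0 < m := Nat.pos_of_dvd_of_pos hm h0
  split_ifs with h
  · rw [mem_charsTrivialOnRoots] at h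
    rw [Finset.sum_congr rfl fun b hb => h b ((Polynomial.mem_nthRootsFinset hm0 1).mp hb)]
    obtain ⟨ζ, hζ⟩ := HasEnoughRootsOfUnity.prim (M := ZMod q) (n := q - 1)
    obtain ⟨c, hc⟩ := hm
    have := (hζ.pow h0 (by rw [hc, mul_comm] : q - 1 = c * m)).card_nthRootsFinset
    simp [this]
  · rw [mem_charsTrivialOnRoots] at h
    push Not at h
    obtain ⟨b₀, hb₀, h1⟩ := h
    refine eq_zero_of_mul_eq_self_left h1 ?_
    rw [Finset.mul_sum]
    have hb0 : b₀ ≠ 0 := by rintro rfl; simp [hm0.ne'] at hb₀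
    refine Finset.sum_bij' (fun b _ => b₀ * b) (fun b _ => b₀⁻¹ * b) ?_ ?_ ?_ ?_ ?_
    · intro b hb
      rw [Polynomial.mem_nthRootsFinset hm0] at hb ⊢
      rw [mul_pow, hb₀, hb, one_mul]
    · intro b hb
      rw [Polynomial.mem_nthRootsFinset hm0] at hb ⊢
      rw [mul_pow, inv_pow, hb₀, hb, inv_one, one_mul]
    · intro b _; field_simp
    · intro b _; field_simp
    · intro b _; simp

/-- Orthogonality for the characters that are trivial on the `m`-th roots of unity. -/
lemma sum_charsTrivialOnRoots_apply {q m : ℕ} [hq : Fact q.Prime] (hm : m ∣ q - 1)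
    {a : ZMod q} (ha : a ≠ 0) : ∑ χ ∈ charsTrivialOnRoots q m, χ a =
      if a ^ m = 1 then (((q - 1) / m : ℕ) : ℂ) else 0 := by
  classical
  have h0 : 0 < q - 1 := Nat.sub_pos_of_lt hq.out.one_lt
  have hm0 : 0 < m := Nat.pos_of_dvd_of_pos hm h0
  have hmC : (m : ℂ) ≠ 0 := by exact_mod_cast hm0.ne'
  have key : (m : ℂ) * ∑ χ ∈ charsTrivialOnRoots q m, χ a =
      if a ^ m = 1 then ((q - 1 : ℕ) : ℂ) else 0 := by
    calc (m : ℂ) * ∑ χ ∈ charsTrivialOnRoots q m, χ a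
        = ∑ χ : DirichletCharacter ℂ q, (if χ ∈ charsTrivialOnRoots q m then (m : ℂ) else 0) * χ a := by
          rw [Finset.mul_sum]
          simp only [ite_mul, zero_mul]
          rw [← Finset.sum_filter, Finset.filter_mem_eq_inter, Finset.univ_inter]
      _ = ∑ b ∈ Polynomial.nthRootsFinset m (1 : ZMod q), ∑ χ : DirichletCharacter ℂ q, χ (b * a) := by
          rw [Finset.sum_comm]
          refine Finset.sum_congr rfl fun χ _ => ?_
          simp only [map_mul]
          rw [← Finset.sum_mul, sum_nthRootsFinset_eq hm]
      _ = ∑ b ∈ Polynomial.nthRootsFinset m (1 : ZMod q), if b = a⁻¹ then ((q - 1 : ℕ) : ℂ) else 0 := by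
          refine Finset.sum_congr rfl fun b _ => ?_
          rw [DirichletCharacter.sum_characters_eq, Nat.totient_prime hq.out]
          simp only [mul_eq_one_iff_eq_inv₀ ha]
      _ = _ := by
          rw [Finset.sum_ite_eq']
          simp only [Polynomial.mem_nthRootsFinset hm0, inv_pow, inv_eq_one]
  rw [← mul_right_inj' hmC, key]
  split_ifs
  · rw [← Nat.cast_mul, Nat.mul_div_cancel' hm]
  · simp

/-- The sum of the Euler factor terms over the characters trivial on `m`-th roots of unity. -/
lemma sum_charsTrivialOnRoots_div {q m p : ℕ} [hq : Fact q.Prime] (hm : m ∣ q - 1)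
    (hp : (p : ZMod q) ≠ 0) {z : ℂ} (hz : ‖z‖ < 1) :
    ∑ χ ∈ charsTrivialOnRoots q m, χ p * z / (1 - χ p * z) =
      (((q - 1) / m : ℕ) : ℂ) * (z ^ gp q m p / (1 - z ^ gp q m p)) := by
  have h1 : HasSum (fun j : ℕ => ∑ χ ∈ charsTrivialOnRoots q m, (χ p * z) ^ (j + 1))
      (∑ χ ∈ charsTrivialOnRoots q m, χ p * z / (1 - χ p * z)) := by
    refine hasSum_sum fun χ _ => ?_
    have hlt : ‖χ p * z‖ < 1 := by
      rw [norm_mul]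
      exact (mul_le_of_le_one_left (norm_nonneg z) (χ.norm_le_one _)).trans_lt hz
    have h := (hasSum_geometric_of_norm_lt_one hlt).mul_left (χ p * z)
    rw [← div_eq_mul_inv] at h
    simpa only [pow_succ'] using h
  have h2 := (hasSum_ite_dvd_pow (gp_pos hm hp) hz).mul_left (((q - 1) / m : ℕ) : ℂ)
  refine h1.unique ?_
  have h3 : (fun j : ℕ => ∑ χ ∈ charsTrivialOnRoots q m, (χ p * z) ^ (j + 1)) =
      fun j : ℕ => (((q - 1) / m : ℕ) : ℂ) * if gp q m p ∣ j + 1 then z ^ (j + 1) else 0 := by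
    funext j
    have h4 := sum_charsTrivialOnRoots_apply hm (pow_ne_zero (j + 1) hp)
    simp only [mul_pow, ← map_pow]
    rw [← Finset.sum_mul, h4, ← pow_mul, mul_comm (j + 1), pow_mul, gp]
    simp only [orderOf_dvd_iff_pow_eq_one]
    split_ifs <;> ring
  rwa [h3]

end Orthogonality

section PrimeSeries

/-- The closed form `w ^ n / (1 - w ^ n)` of `∑_{j ≥ 1} w ^ (n j)`. -/
noncomputable def geomTail (n : ℕ) (w : ℂ) : ℂ := w ^ n / (1 - w ^ n)

lemma norm_geomTail_le {n l : ℕ} {w : ℂ} {δ : ℝ} (hδ : 0 < δ) (hw : ‖w‖ ≤ 1 - δ) (hn : l ≤ n)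
    (hl : 1 ≤ l) : ‖geomTail n w‖ ≤ ‖w‖ ^ l / δ := by
  have hw0 := norm_nonneg w
  have hw1 : ‖w‖ ≤ 1 := by linarith
  unfold geomTail
  rw [norm_div, norm_pow]
  have h1 : ‖w‖ ^ n ≤ ‖w‖ ^ l := pow_le_pow_of_le_one hw0 hw1 hn
  have h2 : ‖w‖ ^ n ≤ ‖w‖ := by
    simpa using pow_le_pow_of_le_one hw0 hw1 (hl.trans hn)
  have h3 : δ ≤ ‖1 - w ^ n‖ := by
    have := norm_sub_norm_le (1 : ℂ) (w ^ n)
    rw [norm_one, norm_pow] at this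
    linarith
  gcongr

/-- The part of the local logarithmic derivative at `p` which does not come from
Dirichlet `L`-functions, divided by `log p`. -/
noncomputable def localRemainder (q r p : ℕ) (w : ℂ) : ℂ :=
  vanishingPeriod q r p * geomTail (vanishingPeriod q r p) w
    - (vanishingPeriod q r p - 1 : ℕ) * geomTail (vanishingPeriod q r p - 1) w
    + (geomTail (gp q (2 * r) p) w - geomTail (gp q r p) w)

/-- The three possible shapes of `localRemainder`. -/
lemma localRemainder_cases (q r p : ℕ) (w : ℂ) :
    (gp q r p = 1 → localRemainder q r p w =
      q * geomTail q w - (q - 1 : ℕ) * geomTail (q - 1) w) ∧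
    (gp q r p = 2 → localRemainder q r p w = geomTail 2 w) ∧
    (3 ≤ gp q r p → localRemainder q r p w =
      gp q r p * geomTail (gp q r p) w - (gp q r p - 1 : ℕ) * geomTail (gp q r p - 1) w
        + if 2 ∣ gp q r p then geomTail (gp q r p / 2) w - geomTail (gp q r p) w else 0) := by
  unfold localRemainder vanishingPeriod
  rw [gp_two_mul]
  refine ⟨fun h => ?_, fun h => ?_, fun h => ?_⟩
  · simp [h]
  · simp [h]; ring
  · rw [if_neg (by omega)]
    split_ifs <;> simp

lemma norm_localRemainder_le {q r p : ℕ} [hq : Fact q.Prime] (hq2 : q ≠ 2) (hr : r ∣ q - 1)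
    (hp : (p : ZMod q) ≠ 0) {w : ℂ} {δ : ℝ} (hδ : 0 < δ) (hw : ‖w‖ ≤ 1 - δ) :
    ‖localRemainder q r p w‖ ≤ (2 * q + 2) / δ * ‖w‖ ^ 2 := by
  obtain ⟨h1, h2, h3⟩ := localRemainder_cases q r p w
  have hq3 : 3 ≤ q := by have := hq.out.two_le; omega
  have hg := gp_pos hr hp
  have hgq := gp_lt hr hp
  have hX : 0 ≤ ‖w‖ ^ 2 / δ := by positivity
  have hb : ∀ n : ℕ, 2 ≤ n → ‖geomTail n w‖ ≤ ‖w‖ ^ 2 / δ := fun n hn =>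
    norm_geomTail_le hδ hw hn one_le_two
  have hb' : ∀ c n : ℕ, c ≤ q → 2 ≤ n → ‖(c : ℂ) * geomTail n w‖ ≤ q * (‖w‖ ^ 2 / δ) := by
    intro c n hc hn
    rw [norm_mul, Complex.norm_natCast]
    exact mul_le_mul (by exact_mod_cast hc) (hb n hn) (norm_nonneg _) (by positivity)
  have hR : (2 * q + 2) / δ * ‖w‖ ^ 2 = q * (‖w‖ ^ 2 / δ) + q * (‖w‖ ^ 2 / δ) +
      (‖w‖ ^ 2 / δ + ‖w‖ ^ 2 / δ) := by ring
  have hqX : 0 ≤ q * (‖w‖ ^ 2 / δ) := by positivity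
  rw [hR]
  obtain h | h | h : gp q r p = 1 ∨ gp q r p = 2 ∨ 3 ≤ gp q r p := by omega
  · rw [h1 h]
    refine (norm_sub_le _ _).trans ?_
    linarith [hb' q q le_rfl (by omega), hb' (q - 1) (q - 1) (by omega) (by omega)]
  · rw [h2 h]
    linarith [hb 2 le_rfl]
  · rw [h3 h]
    refine (norm_add_le _ _).trans (add_le_add ((norm_sub_le _ _).trans (add_le_add
      (hb' _ _ hgq.le (by omega)) (hb' _ _ (by omega) (by omega)))) ?_)
    split_ifs with hd
    · exact (norm_sub_le _ _).trans (add_le_add (hb _ (by omega)) (hb _ (by omega)))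
    · simp only [norm_zero]; positivity

/-- The term at `p` of the prime series `primeRemainder`. -/
noncomputable def primeRemainderTerm (q r p : ℕ) (s : ℂ) : ℂ :=
  if p = q then 0 else Real.log p * localRemainder q r p ((p : ℂ) ^ (-s))

/-- The part of `-F'/F` which does not come from Dirichlet `L`-functions. -/
noncomputable def primeRemainder (q r : ℕ) (s : ℂ) : ℂ :=
  ∑' p : Nat.Primes, primeRemainderTerm q r p s

lemma norm_prime_cpow_neg_le {p : ℕ} (hp : p.Prime) {s : ℂ} {σ : ℝ} (hσ : 0 ≤ σ) (hs : σ ≤ s.re) :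
    ‖(p : ℂ) ^ (-s)‖ ≤ (2 : ℝ) ^ (-σ) := by
  rw [Complex.norm_natCast_cpow_of_pos hp.pos, Complex.neg_re]
  calc (p : ℝ) ^ (-s.re) ≤ (p : ℝ) ^ (-σ) :=
        Real.rpow_le_rpow_of_exponent_le (by exact_mod_cast hp.one_lt.le) (by linarith)
    _ ≤ (2 : ℝ) ^ (-σ) :=
        Real.rpow_le_rpow_of_nonpos two_pos (by exact_mod_cast hp.two_le) (by linarith)

lemma exists_norm_primeRemainderTerm_le {q : ℕ} (r : ℕ) [hq : Fact q.Prime] (hq2 : q ≠ 2)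
    (hr : r ∣ q - 1) : ∃ C : ℝ, 0 < C ∧ ∀ (p : Nat.Primes) (s : ℂ), 9 / 10 < s.re →
      ‖primeRemainderTerm q r p s‖ ≤ C * ((p : ℕ) : ℝ) ^ (-(3 / 2) : ℝ) := by
  set δ : ℝ := 1 - (2 : ℝ) ^ (-(9 / 10) : ℝ) with hδ'
  have hδ : 0 < δ := sub_pos.mpr (Real.rpow_lt_one_of_one_lt_of_neg one_lt_two (by norm_num))
  refine ⟨10 * ((2 * q + 2) / δ), by positivity, fun p s hs => ?_⟩
  have hp0 : (0 : ℝ) < (p : ℕ) := by exact_mod_cast p.2.pos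
  have hp1 : (1 : ℝ) ≤ (p : ℕ) := by exact_mod_cast p.2.one_lt.le
  unfold primeRemainderTerm
  split_ifs with hpq
  · simp only [norm_zero]; positivity
  have h1 := norm_localRemainder_le hq2 hr (natCast_zmod_ne_zero_of_ne p.2 hpq) hδ
    (w := ((p : ℕ) : ℂ) ^ (-s))
    ((norm_prime_cpow_neg_le p.2 (by norm_num) hs.le).trans (by rw [hδ']; linarith))
  have h2 : ‖((p : ℕ) : ℂ) ^ (-s)‖ ^ 2 ≤ ((p : ℕ) : ℝ) ^ (-(9 / 5) : ℝ) := by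
    rw [Complex.norm_natCast_cpow_of_pos p.2.pos, Complex.neg_re, ← Real.rpow_natCast,
      ← Real.rpow_mul hp0.le]
    exact Real.rpow_le_rpow_of_exponent_le hp1 (by push_cast; linarith)
  have h3 : Real.log (p : ℕ) ≤ 10 * ((p : ℕ) : ℝ) ^ (1 / 10 : ℝ) := by
    have := Real.log_le_rpow_div hp0.le (show (0 : ℝ) < 1 / 10 by norm_num)
    linarith
  have h4 : ((p : ℕ) : ℝ) ^ (1 / 10 : ℝ) * ((p : ℕ) : ℝ) ^ (-(9 / 5) : ℝ) ≤
      ((p : ℕ) : ℝ) ^ (-(3 / 2) : ℝ) := by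
    rw [← Real.rpow_add hp0]
    exact Real.rpow_le_rpow_of_exponent_le hp1 (by norm_num)
  rw [norm_mul, Complex.norm_real, Real.norm_of_nonneg (Real.log_nonneg hp1)]
  calc _ ≤ (10 * ((p : ℕ) : ℝ) ^ (1 / 10 : ℝ)) *
        ((2 * q + 2) / δ * ((p : ℕ) : ℝ) ^ (-(9 / 5) : ℝ)) := by
        refine mul_le_mul h3 (h1.trans ?_) (norm_nonneg _) (by positivity)
        gcongr
    _ = 10 * ((2 * q + 2) / δ) * (((p : ℕ) : ℝ) ^ (1 / 10 : ℝ) *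
        ((p : ℕ) : ℝ) ^ (-(9 / 5) : ℝ)) := by ring
    _ ≤ _ := by gcongr

lemma summable_primes_rpow_three_halves (C : ℝ) :
    Summable fun p : Nat.Primes => C * ((p : ℕ) : ℝ) ^ (-(3 / 2) : ℝ) :=
  (Nat.Primes.summable_rpow.mpr (by norm_num)).mul_left C

lemma exists_norm_primeRemainder_le {q : ℕ} (r : ℕ) [hq : Fact q.Prime] (hq2 : q ≠ 2)
    (hr : r ∣ q - 1) : ∃ C : ℝ, ∀ s : ℂ, 9 / 10 < s.re → ‖primeRemainder q r s‖ ≤ C := by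
  obtain ⟨C, _, hC⟩ := exists_norm_primeRemainderTerm_le r hq2 hr
  exact ⟨_, fun s hs => tsum_of_norm_bounded (summable_primes_rpow_three_halves C).hasSum
    fun p => hC p s hs⟩

lemma summable_primeRemainderTerm {q : ℕ} (r : ℕ) [hq : Fact q.Prime] (hq2 : q ≠ 2)
    (hr : r ∣ q - 1) {s : ℂ} (hs : 9 / 10 < s.re) :
    Summable fun p : Nat.Primes => primeRemainderTerm q r p s := by
  obtain ⟨C, _, hC⟩ := exists_norm_primeRemainderTerm_le r hq2 hr
  exact Summable.of_norm_bounded (summable_primes_rpow_three_halves C) fun p => hC p s hs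

lemma differentiableAt_geomTail {n : ℕ} (hn : n ≠ 0) {w : ℂ} (hw : ‖w‖ < 1) :
    DifferentiableAt ℂ (geomTail n) w := by
  have h : (1 : ℂ) - w ^ n ≠ 0 := by
    intro h
    have h1 : ‖w ^ n‖ < 1 := by rw [norm_pow]; exact pow_lt_one₀ (norm_nonneg _) hw hn
    rw [← sub_eq_zero.mp h, norm_one] at h1
    exact lt_irrefl _ h1
  unfold geomTail
  fun_prop (disch := exact h)

lemma norm_prime_cpow_neg_lt_one {p : ℕ} (hp : p.Prime) {s : ℂ} (hs : 0 < s.re) :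
    ‖(p : ℂ) ^ (-s)‖ < 1 :=
  (norm_prime_cpow_neg_le hp hs.le le_rfl).trans_lt
    (Real.rpow_lt_one_of_one_lt_of_neg one_lt_two (by linarith))

lemma differentiableAt_natCast_cpow_neg {p : ℕ} (hp : p ≠ 0) (s : ℂ) :
    DifferentiableAt ℂ (fun s : ℂ => (p : ℂ) ^ (-s)) s :=
  (differentiableAt_id.neg).const_cpow (Or.inl (by exact_mod_cast hp))

lemma differentiableAt_primeRemainderTerm {q r : ℕ} [hq : Fact q.Prime] (hr : 2 * r ∣ q - 1)
    (p : Nat.Primes) {s : ℂ} (hs : 0 < s.re) :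
    DifferentiableAt ℂ (primeRemainderTerm q r p) s := by
  by_cases hpq : (p : ℕ) = q
  · have : primeRemainderTerm q r p = fun _ => 0 := by
      funext s; simp [primeRemainderTerm, hpq]
    rw [this]
    exact differentiableAt_const _
  have hp := natCast_zmod_ne_zero_of_ne p.2 hpq
  have hr' : r ∣ q - 1 := (dvd_mul_left r 2).trans hr
  have hz := norm_prime_cpow_neg_lt_one p.2 hs
  have hd := differentiableAt_natCast_cpow_neg p.2.ne_zero s
  have h : ∀ n : ℕ, n ≠ 0 → DifferentiableAt ℂ (fun s : ℂ => geomTail n (((p : ℕ) : ℂ) ^ (-s))) s :=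
    fun n hn => DifferentiableAt.comp s (differentiableAt_geomTail hn hz) hd
  have he := two_le_vanishingPeriod hr' hp
  have h1 := h (vanishingPeriod q r p) (by omega)
  have h2 := h (vanishingPeriod q r p - 1) (by omega)
  have h3 := h (gp q (2 * r) p) (gp_pos hr hp).ne'
  have h4 := h (gp q r p) (gp_pos hr' hp).ne'
  have : primeRemainderTerm q r p = fun s =>
      Real.log p * localRemainder q r p (((p : ℕ) : ℂ) ^ (-s)) := by
    funext s; simp [primeRemainderTerm, hpq]
  rw [this]
  unfold localRemainder
  fun_prop

lemma differentiableOn_primeRemainder {q r : ℕ} [hq : Fact q.Prime] (hq2 : q ≠ 2)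
    (hr : 2 * r ∣ q - 1) : DifferentiableOn ℂ (primeRemainder q r) {s | 9 / 10 < s.re} := by
  obtain ⟨C, _, hC⟩ := exists_norm_primeRemainderTerm_le r hq2 ((dvd_mul_left r 2).trans hr)
  refine Complex.differentiableOn_tsum_of_summable_norm (summable_primes_rpow_three_halves C) ?_
    (isOpen_lt continuous_const Complex.continuous_re) fun p s hs => hC p s hs
  intro p s hs
  simp only [Set.mem_ofPred_eq] at hs
  exact (differentiableAt_primeRemainderTerm hr p (by linarith)).differentiableWithinAt

lemma geomTail_inv {n : ℕ} {x : ℝ} (hx : x ≠ 0) :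
    geomTail n ((x : ℂ)⁻¹) = ((1 / (x ^ n - 1) : ℝ) : ℂ) := by
  have h : (x : ℂ) ^ n ≠ 0 := pow_ne_zero _ (by exact_mod_cast hx)
  unfold geomTail
  push_cast
  by_cases h1 : (x : ℂ) ^ n - 1 = 0
  · rw [inv_pow, sub_eq_zero.mp h1]; simp
  · have h2 : 1 - ((x : ℂ) ^ n)⁻¹ ≠ 0 := by
      rw [sub_ne_zero, Ne, eq_comm, inv_eq_one]
      exact sub_ne_zero.mp h1
    rw [inv_pow]
    field_simp

lemma primeRemainderTerm_one {q r : ℕ} [hq : Fact q.Prime] (hr : r ∣ q - 1) (p : Nat.Primes) :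
    primeRemainderTerm q r p 1 = Sterm q r p := by
  unfold primeRemainderTerm Sterm
  by_cases hpq : (p : ℕ) = q
  · simp [hpq]
  rw [if_neg hpq, if_neg hpq]
  have hp0 : ((p : ℕ) : ℝ) ≠ 0 := by exact_mod_cast p.2.ne_zero
  have hp1 : (1 : ℝ) < (p : ℕ) := by exact_mod_cast p.2.one_lt
  have hq1 : ((q - 1 : ℕ) : ℝ) = q - 1 := by rw [Nat.cast_sub hq.out.one_lt.le]; simp
  have hpq' := natCast_zmod_ne_zero_of_ne p.2 hpq
  have hw : ((p : ℕ) : ℂ) ^ (-1 : ℂ) = (((p : ℕ) : ℝ) : ℂ)⁻¹ := by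
    rw [Complex.cpow_neg_one]; simp
  obtain ⟨h1, h2, h3⟩ := localRemainder_cases q r p (((p : ℕ) : ℂ) ^ (-1 : ℂ))
  have hg := gp_pos hr hpq'
  rw [hw] at h1 h2 h3 ⊢
  simp only [geomTail_inv hp0] at h1 h2 h3
  obtain h | h | h : gp q r p = 1 ∨ gp q r p = 2 ∨ 3 ≤ gp q r p := by omega
  · rw [h1 h]
    simp only [h]
    norm_num
    rw [Nat.cast_sub hq.out.one_lt.le]
    push_cast
    ring
  · rw [h2 h]
    simp only [h]
    norm_num
    ring
  · rw [h3 h, if_neg (by omega : ¬ gp q r p = 1), if_pos h, if_neg (by omega : gp q r p ≠ 2),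
      Nat.cast_sub (by omega)]
    by_cases hd : 2 ∣ gp q r p
    · rw [if_pos hd, if_pos ⟨by omega, hd⟩]
      obtain ⟨c, hc⟩ := hd
      have hc0 : c ≠ 0 := by rintro rfl; omega
      have hP : (1 : ℝ) < ((p : ℕ) : ℝ) ^ c := one_lt_pow₀ hp1 hc0
      have hdiv : gp q r p / 2 = c := by omega
      have hpow : ((p : ℕ) : ℝ) ^ gp q r p = (((p : ℕ) : ℝ) ^ c) ^ 2 := by
        rw [hc, mul_comm, pow_mul]
      rw [hdiv, hpow]
      have key : ∀ P : ℝ, 1 < P → 1 / (P - 1) - 1 / (P ^ 2 - 1) = 1 / (P - P⁻¹) := by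
        intro P hP
        have h1 : P - 1 ≠ 0 := by linarith
        have h2 : P ^ 2 - 1 ≠ 0 := by nlinarith
        have h3 : P - P⁻¹ = (P ^ 2 - 1) / P := by field_simp
        rw [h3]
        field_simp
        ring
      have hk := key _ hP
      rw [← Complex.ofReal_sub, hk]
      push_cast
      ring
    · rw [if_neg hd, if_neg (fun h => hd h.2)]
      push_cast
      ring

lemma primeRemainder_one {q r : ℕ} [hq : Fact q.Prime] (hr : r ∣ q - 1) :
    primeRemainder q r 1 = Smq q r := by
  unfold primeRemainder Smq
  rw [Complex.ofReal_tsum]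
  exact tsum_congr fun p => primeRemainderTerm_one hr p

end PrimeSeries

section EulerProducts

lemma hasDerivAt_of_eq_exp_tsum_primes {l : Nat.Primes → ℂ → ℂ} {F : ℂ → ℂ} {C : ℝ}
    (hd : ∀ p s, 1 < s.re → DifferentiableAt ℂ (l p) s)
    (hb : ∀ (p : Nat.Primes) s, 1 < s.re → ‖l p s‖ ≤ C * ‖((p : ℕ) : ℂ) ^ (-s)‖)
    (hF : ∀ s, 1 < s.re → F s = Complex.exp (∑' p, l p s)) {s : ℂ} (hs : 1 < s.re) :
    ∃ D, HasSum (fun p => deriv (l p) s) D ∧ HasDerivAt F (D * F s) s := by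
  obtain ⟨σ, h1σ, hσs⟩ := exists_between hs
  have hC : 0 ≤ C := by
    have h := (norm_nonneg _).trans (hb ⟨2, Nat.prime_two⟩ s hs)
    refine nonneg_of_mul_nonneg_left h ?_
    rw [norm_pos_iff, Ne, Complex.cpow_eq_zero_iff]
    simp
  have hU : IsOpen {s : ℂ | σ < s.re} := isOpen_lt continuous_const Complex.continuous_re
  have hu : Summable fun p : Nat.Primes => C * ((p : ℕ) : ℝ) ^ (-σ) :=
    (Nat.Primes.summable_rpow.mpr (by linarith)).mul_left C
  have hdU : ∀ p, DifferentiableOn ℂ (l p) {s : ℂ | σ < s.re} := fun p z hz =>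
    (hd p z (h1σ.trans hz)).differentiableWithinAt
  have hle : ∀ (p : Nat.Primes) (z : ℂ), z ∈ {s : ℂ | σ < s.re} →
      ‖l p z‖ ≤ C * ((p : ℕ) : ℝ) ^ (-σ) := by
    intro p z hz
    simp only [Set.mem_ofPred_eq] at hz
    refine (hb p z (h1σ.trans hz)).trans (mul_le_mul_of_nonneg_left ?_ hC)
    rw [Complex.norm_natCast_cpow_of_pos p.2.pos, Complex.neg_re]
    exact Real.rpow_le_rpow_of_exponent_le (by exact_mod_cast p.2.one_lt.le) (by linarith)
  have hs' : s ∈ {s : ℂ | σ < s.re} := hσs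
  refine ⟨_, Complex.hasSum_deriv_of_summable_norm hu hdU hU hle hs', ?_⟩
  have h1 : HasDerivAt (fun w => ∑' p, l p w) (deriv (fun w => ∑' p, l p w) s) s :=
    ((Complex.differentiableOn_tsum_of_summable_norm hu hdU hU hle).differentiableAt
      (hU.mem_nhds hs')).hasDerivAt
  have h2 := h1.cexp
  rw [← hF s hs, mul_comm] at h2
  refine h2.congr_of_eventuallyEq ?_
  filter_upwards [hU.mem_nhds hs'] with z hz using hF z (h1σ.trans hz)

/-- The logarithm of the factor `(1 - a p^{-ns})⁻¹`. -/
noncomputable def eulerLog (a : ℂ) (n p : ℕ) (s : ℂ) : ℂ :=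
  -Complex.log (1 - a * ((p : ℂ) ^ (-s)) ^ n)

lemma norm_prime_cpow_neg_le_half {p : ℕ} (hp : p.Prime) {s : ℂ} (hs : 1 < s.re) :
    ‖(p : ℂ) ^ (-s)‖ ≤ 1 / 2 := by
  have := norm_prime_cpow_neg_le hp zero_le_one hs.le
  rwa [Real.rpow_neg_one, ← one_div] at this

lemma norm_mul_prime_cpow_pow_le {a : ℂ} (ha : ‖a‖ ≤ 1) {n : ℕ} (hn : n ≠ 0) {p : ℕ}
    (hp : p.Prime) {s : ℂ} (hs : 1 < s.re) :
    ‖a * ((p : ℂ) ^ (-s)) ^ n‖ ≤ ‖(p : ℂ) ^ (-s)‖ := by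
  rw [norm_mul, norm_pow]
  have h1 := norm_prime_cpow_neg_le_half hp hs
  have h2 := norm_nonneg ((p : ℂ) ^ (-s))
  calc ‖a‖ * ‖(p : ℂ) ^ (-s)‖ ^ n ≤ 1 * ‖(p : ℂ) ^ (-s)‖ ^ 1 := by
        refine mul_le_mul ha ?_ (by positivity) zero_le_one
        exact pow_le_pow_of_le_one h2 (by linarith) (Nat.one_le_iff_ne_zero.mpr hn)
    _ = _ := by ring

lemma norm_eulerLog_le {a : ℂ} (ha : ‖a‖ ≤ 1) {n : ℕ} (hn : n ≠ 0) {p : ℕ}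
    (hp : p.Prime) {s : ℂ} (hs : 1 < s.re) :
    ‖eulerLog a n p s‖ ≤ 3 / 2 * ‖(p : ℂ) ^ (-s)‖ := by
  have h1 := norm_mul_prime_cpow_pow_le ha hn hp hs
  have h2 := norm_prime_cpow_neg_le_half hp hs
  have h3 := Complex.norm_log_one_add_half_le_self (z := -(a * ((p : ℂ) ^ (-s)) ^ n))
    (by rw [norm_neg]; exact h1.trans h2)
  unfold eulerLog
  rw [norm_neg, sub_eq_add_neg]
  rw [norm_neg] at h3
  linarith

lemma one_sub_mul_prime_cpow_pow_mem_slitPlane {a : ℂ} (ha : ‖a‖ ≤ 1) {n : ℕ} (hn : n ≠ 0) {p : ℕ}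
    (hp : p.Prime) {s : ℂ} (hs : 1 < s.re) :
    1 - a * ((p : ℂ) ^ (-s)) ^ n ∈ Complex.slitPlane := by
  have h1 := norm_mul_prime_cpow_pow_le ha hn hp hs
  have h2 := norm_prime_cpow_neg_le_half hp hs
  rw [sub_eq_add_neg]
  exact Complex.mem_slitPlane_of_norm_lt_one (by rw [norm_neg]; linarith)

lemma exp_eulerLog {a : ℂ} (ha : ‖a‖ ≤ 1) {n : ℕ} (hn : n ≠ 0) {p : ℕ}
    (hp : p.Prime) {s : ℂ} (hs : 1 < s.re) :
    Complex.exp (eulerLog a n p s) = (1 - a * ((p : ℂ) ^ (-s)) ^ n)⁻¹ := by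
  unfold eulerLog
  rw [Complex.exp_neg, Complex.exp_log
    (Complex.slitPlane_ne_zero (one_sub_mul_prime_cpow_pow_mem_slitPlane ha hn hp hs))]

lemma hasDerivAt_eulerLog {a : ℂ} (ha : ‖a‖ ≤ 1) {n : ℕ} (hn : n ≠ 0) {p : ℕ}
    (hp : p.Prime) {s : ℂ} (hs : 1 < s.re) :
    HasDerivAt (eulerLog a n p) (-(Real.log p * (n * (a * ((p : ℂ) ^ (-s)) ^ n /
      (1 - a * ((p : ℂ) ^ (-s)) ^ n))))) s := by
  have hmem := one_sub_mul_prime_cpow_pow_mem_slitPlane ha hn hp hs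
  have hz : HasDerivAt (fun s : ℂ => (p : ℂ) ^ (-s))
      ((p : ℂ) ^ (-s) * Complex.log p * -1) s :=
    (hasDerivAt_id s).neg.const_cpow (Or.inl (by exact_mod_cast hp.ne_zero))
  have h := ((((hz.pow n).const_mul a).const_sub 1).clog hmem).neg
  refine h.congr_deriv ?_
  have h0 := Complex.slitPlane_ne_zero hmem
  obtain ⟨m, rfl⟩ := Nat.exists_eq_succ_of_ne_zero hn
  rw [Complex.natCast_log]
  simp only [Nat.succ_eq_add_one, Nat.add_sub_cancel, Pi.pow_apply] at h0 ⊢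
  field_simp
  ring

open DirichletCharacter in
/-- `-L'/L` as a sum over primes. -/
lemma hasSum_neg_logDeriv_LFunction {q : ℕ} [NeZero q] (χ : DirichletCharacter ℂ q) {s : ℂ}
    (hs : 1 < s.re) : HasSum (fun p : Nat.Primes => (Real.log (p : ℕ) : ℂ) *
      (χ (p : ℕ) * ((p : ℕ) : ℂ) ^ (-s) / (1 - χ (p : ℕ) * ((p : ℕ) : ℂ) ^ (-s))))
      (-(deriv (LFunction χ) s / LFunction χ s)) := by
  have hF : ∀ s : ℂ, 1 < s.re → LFunction χ s =
      Complex.exp (∑' p : Nat.Primes, eulerLog (χ (p : ℕ)) 1 p s) := by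
    intro s hs
    rw [LFunction_eq_LSeries χ hs, ← LSeries_eulerProduct_exp_log χ hs]
    simp [eulerLog]
  have hn : ∀ p : Nat.Primes, ‖χ (p : ℕ)‖ ≤ 1 := fun p => χ.norm_le_one _
  obtain ⟨D, hD, hder⟩ := hasDerivAt_of_eq_exp_tsum_primes
    (fun p s hs => (hasDerivAt_eulerLog (hn p) one_ne_zero p.2 hs).differentiableAt)
    (fun p s hs => norm_eulerLog_le (hn p) one_ne_zero p.2 hs) hF hs
  have h0 : LFunction χ s ≠ 0 := by rw [hF s hs]; exact Complex.exp_ne_zero _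
  rw [hder.deriv, mul_div_cancel_right₀ _ h0]
  convert! hD.neg using 1
  funext p
  rw [(hasDerivAt_eulerLog (hn p) one_ne_zero p.2 hs).deriv]
  simp

lemma tsum_coprimeIndicator_prime_pow {q k p : ℕ} [hq : Fact q.Prime] (hk : k ≠ 0) (hp : p.Prime)
    (hpq : p ≠ q) {s : ℂ} (hs : 1 < s.re) :
    ∑' a : ℕ, (coprimeIndicator k q (p ^ a) : ℂ) * ((p ^ a : ℕ) : ℂ) ^ (-s) =
      Complex.exp (eulerLog 1 1 p s + eulerLog 1 (vanishingPeriod q (k.gcd (q - 1)) p) p s -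
        eulerLog 1 (vanishingPeriod q (k.gcd (q - 1)) p - 1) p s) := by
  set e := vanishingPeriod q (k.gcd (q - 1)) p with he
  have he2 : 2 ≤ e := two_le_vanishingPeriod (Nat.gcd_dvd_right k (q - 1))
    (natCast_zmod_ne_zero_of_ne hp hpq)
  set w : ℂ := (p : ℂ) ^ (-s) with hw
  have hw1 : ‖w‖ < 1 := norm_prime_cpow_neg_lt_one hp (by linarith)
  have hw0 : w ≠ 0 := by
    rw [hw, Ne, Complex.cpow_eq_zero_iff]; simp [hp.ne_zero]
  have h1 := hasSum_geometric_of_norm_lt_one hw1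
  have h2 := (hasSum_ite_dvd_pow (f := e) (by omega) hw1).mul_left w⁻¹
  have h3 := h1.sub h2
  have h4 : (fun a : ℕ => (coprimeIndicator k q (p ^ a) : ℂ) * ((p ^ a : ℕ) : ℂ) ^ (-s)) =
      fun a : ℕ => w ^ a - w⁻¹ * if e ∣ a + 1 then w ^ (a + 1) else 0 := by
    funext a
    rw [coprimeIndicator_prime_pow hk hp hpq, ← he, Nat.cast_pow, ← Complex.natCast_cpow_natCast_mul,
      mul_comm (a : ℂ), Complex.cpow_mul_nat, ← hw]
    split_ifs
    · rw [pow_succ']; field_simp; simp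
    · simp
  rw [h4, h3.tsum_eq, Complex.exp_sub, Complex.exp_add, exp_eulerLog (by simp) one_ne_zero hp hs,
    exp_eulerLog (by simp) (by omega) hp hs, exp_eulerLog (by simp) (by omega) hp hs, ← hw]
  have hne : ∀ n : ℕ, n ≠ 0 → 1 - w ^ n ≠ 0 := fun n hn => by
    have := Complex.slitPlane_ne_zero
      (one_sub_mul_prime_cpow_pow_mem_slitPlane (a := 1) (by simp) hn hp hs)
    rwa [one_mul] at this
  have ha := hne 1 one_ne_zero
  have hb := hne e (by omega)
  obtain ⟨d, hd⟩ : ∃ d, e = d + 1 := ⟨e - 1, by omega⟩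
  have hc := hne d (by omega)
  rw [hd] at hb ⊢
  simp only [one_mul, pow_one, Nat.add_sub_cancel] at ha hb hc ⊢
  field_simp
  ring

/-- The logarithm of the Euler factor at `p` of the Dirichlet series of `coprimeIndicator k q`. -/
noncomputable def indicatorEulerLog (k q p : ℕ) (s : ℂ) : ℂ :=
  if p = q then 0 else
    eulerLog 1 1 p s + eulerLog 1 (vanishingPeriod q (k.gcd (q - 1)) p) p s -
      eulerLog 1 (vanishingPeriod q (k.gcd (q - 1)) p - 1) p s

lemma norm_indicatorEulerLog_le (k : ℕ) {q p : ℕ} [hq : Fact q.Prime] (hp : p.Prime) {s : ℂ}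
    (hs : 1 < s.re) : ‖indicatorEulerLog k q p s‖ ≤ 9 / 2 * ‖(p : ℂ) ^ (-s)‖ := by
  unfold indicatorEulerLog
  split_ifs with hpq
  · simp only [norm_zero]; positivity
  have he2 := two_le_vanishingPeriod (Nat.gcd_dvd_right k (q - 1))
    (natCast_zmod_ne_zero_of_ne hp hpq)
  have h : ∀ n : ℕ, n ≠ 0 → ‖eulerLog 1 n p s‖ ≤ 3 / 2 * ‖(p : ℂ) ^ (-s)‖ := fun n hn =>
    norm_eulerLog_le (by simp) hn hp hs
  refine (norm_sub_le _ _).trans ((add_le_add_left (norm_add_le _ _) _).trans ?_)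
  linarith [h 1 one_ne_zero, h (vanishingPeriod q (k.gcd (q - 1)) p) (by omega),
    h (vanishingPeriod q (k.gcd (q - 1)) p - 1) (by omega)]

lemma hasDerivAt_indicatorEulerLog (k : ℕ) {q p : ℕ} [hq : Fact q.Prime] (hp : p.Prime) {s : ℂ}
    (hs : 1 < s.re) : HasDerivAt (indicatorEulerLog k q p) (if p = q then 0 else
      -(Real.log p * (geomTail 1 ((p : ℂ) ^ (-s)) +
        vanishingPeriod q (k.gcd (q - 1)) p *
          geomTail (vanishingPeriod q (k.gcd (q - 1)) p) ((p : ℂ) ^ (-s)) -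
        (vanishingPeriod q (k.gcd (q - 1)) p - 1 : ℕ) *
          geomTail (vanishingPeriod q (k.gcd (q - 1)) p - 1) ((p : ℂ) ^ (-s))))) s := by
  by_cases hpq : p = q
  · have : indicatorEulerLog k q p = fun _ => 0 := by funext; simp [indicatorEulerLog, hpq]
    rw [this, if_pos hpq]
    exact hasDerivAt_const _ _
  have he2 := two_le_vanishingPeriod (Nat.gcd_dvd_right k (q - 1))
    (natCast_zmod_ne_zero_of_ne hp hpq)
  have h : ∀ n : ℕ, n ≠ 0 → _ := fun n hn =>
    hasDerivAt_eulerLog (a := 1) (by simp) hn hp hs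
  have h1 := ((h 1 one_ne_zero).add (h (vanishingPeriod q (k.gcd (q - 1)) p) (by omega))).sub
    (h (vanishingPeriod q (k.gcd (q - 1)) p - 1) (by omega))
  have : indicatorEulerLog k q p = fun s =>
      eulerLog 1 1 p s + eulerLog 1 (vanishingPeriod q (k.gcd (q - 1)) p) p s -
      eulerLog 1 (vanishingPeriod q (k.gcd (q - 1)) p - 1) p s := by
    funext; simp [indicatorEulerLog, hpq]
  rw [this, if_neg hpq]
  refine h1.congr_deriv ?_
  simp only [geomTail, one_mul, Nat.cast_one]
  ring

lemma LSeries_coprimeIndicator_eq {q k : ℕ} [hq : Fact q.Prime] (hk : k ≠ 0) {s : ℂ}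
    (hs : 1 < s.re) : LSeries (fun n => (coprimeIndicator k q n : ℂ)) s =
      Complex.exp (∑' p : Nat.Primes, indicatorEulerLog k q p s) := by
  set f : ℕ → ℂ := LSeries.term (fun n => (coprimeIndicator k q n : ℂ)) s with hf
  have hterm : ∀ n, f n = (coprimeIndicator k q n : ℂ) * (n : ℂ) ^ (-s) := fun n =>
    LSeries.term_def₀ (by simp [coprimeIndicator_zero]) s n
  have hsum : Summable (‖f ·‖) := (LSeriesSummable_ofReal_of_le_one
    (coprimeIndicator_nonneg k q) (coprimeIndicator_le_one k q) hs).norm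
  have h1 : f 1 = 1 := by simp [hterm, coprimeIndicator_one hq.out]
  have hmul : ∀ {m n : ℕ}, m.Coprime n → f (m * n) = f m * f n := by
    intro m n hmn
    rw [hterm, hterm, hterm, coprimeIndicator_mul hq.out hmn, Nat.cast_mul,
      Complex.natCast_mul_natCast_cpow]
    push_cast
    ring
  have hprod := EulerProduct.eulerProduct_hasProd h1 hmul hsum (by simp [hf])
  have hlog : Summable fun p : Nat.Primes => indicatorEulerLog k q p s := by
    refine Summable.of_norm_bounded
      (g := fun p : Nat.Primes => 9 / 2 * ((p : ℕ) : ℝ) ^ (-s.re))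
      ((Nat.Primes.summable_rpow.mpr (by linarith)).mul_left _) fun p => ?_
    have := norm_indicatorEulerLog_le k (q := q) p.2 hs
    rwa [Complex.norm_natCast_cpow_of_pos p.2.pos, Complex.neg_re] at this
  have hexp := hlog.hasSum.cexp
  have hEq : (fun p : Nat.Primes => ∑' e, f ((p : ℕ) ^ e)) =
      Complex.exp ∘ fun p : Nat.Primes => indicatorEulerLog k q p s := by
    funext p
    simp only [Function.comp_apply, hterm, indicatorEulerLog]
    by_cases hpq : (p : ℕ) = q
    · rw [if_pos hpq, hpq, Complex.exp_zero, tsum_eq_single 0]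
      · simp [coprimeIndicator_one hq.out]
      · intro a ha
        simp [coprimeIndicator_self_pow ha]
    · rw [if_neg hpq, tsum_coprimeIndicator_prime_pow hk p.2 hpq hs]
  rw [hEq] at hprod
  exact hprod.unique hexp

/-- `-F'/F` for the Dirichlet series `F` of `coprimeIndicator k q`, in terms of Dirichlet
`L`-functions. -/
noncomputable def negLogDeriv (q r : ℕ) [NeZero q] (s : ℂ) : ℂ :=
  -(deriv (DirichletCharacter.LFunction (1 : DirichletCharacter ℂ q)) s /
      DirichletCharacter.LFunction (1 : DirichletCharacter ℂ q) s)
    - (1 / (((q - 1) / r : ℕ) : ℂ)) *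
      (2 * ∑ χ ∈ charsTrivialOnRoots q (2 * r), -(deriv (DirichletCharacter.LFunction χ) s /
          DirichletCharacter.LFunction χ s)
        - ∑ χ ∈ charsTrivialOnRoots q r, -(deriv (DirichletCharacter.LFunction χ) s /
          DirichletCharacter.LFunction χ s))
    + primeRemainder q r s

lemma hasDerivAt_LSeries_coprimeIndicator {q k : ℕ} [hq : Fact q.Prime] (hk : k ≠ 0) (hq2 : q ≠ 2)
    (h2r : 2 * k.gcd (q - 1) ∣ q - 1) {s : ℂ} (hs : 1 < s.re) :
    HasDerivAt (LSeries fun n => (coprimeIndicator k q n : ℂ))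
      (-(negLogDeriv q (k.gcd (q - 1)) s * LSeries (fun n => (coprimeIndicator k q n : ℂ)) s))
      s := by
  obtain ⟨D, hD, hder⟩ := hasDerivAt_of_eq_exp_tsum_primes
    (fun p s hs => (hasDerivAt_indicatorEulerLog k (q := q) p.2 hs).differentiableAt)
    (fun p s hs => norm_indicatorEulerLog_le k (q := q) p.2 hs)
    (fun s hs => LSeries_coprimeIndicator_eq hk hs) hs
  set r := k.gcd (q - 1) with hr
  have hr' : r ∣ q - 1 := Nat.gcd_dvd_right k (q - 1)
  have hr0 : 0 < r := Nat.gcd_pos_of_pos_left _ (Nat.pos_of_ne_zero hk)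
  have hV := ((hasSum_neg_logDeriv_LFunction (1 : DirichletCharacter ℂ q) hs).sub
    ((((hasSum_sum (s := charsTrivialOnRoots q (2 * r))
        fun χ _ => hasSum_neg_logDeriv_LFunction χ hs).mul_left 2).sub
      (hasSum_sum (s := charsTrivialOnRoots q r)
        fun χ _ => hasSum_neg_logDeriv_LFunction χ hs)).mul_left
        (1 / (((q - 1) / r : ℕ) : ℂ)))).add
    (summable_primeRemainderTerm r hq2 hr' (by linarith : 9 / 10 < s.re)).hasSum
  have hh : (((q - 1) / r : ℕ) : ℂ) ≠ 0 := by
    have h0 : 0 < q - 1 := Nat.sub_pos_of_lt hq.out.one_lt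
    exact_mod_cast (Nat.div_pos (Nat.le_of_dvd h0 hr') hr0).ne'
  have h2 : (2 : ℂ) * (((q - 1) / (2 * r) : ℕ) : ℂ) = (((q - 1) / r : ℕ) : ℂ) := by
    obtain ⟨c, hc⟩ := h2r
    rw [hc, Nat.mul_div_cancel_left _ (by positivity), show 2 * r * c = r * (2 * c) by ring,
      Nat.mul_div_cancel_left _ hr0]
    push_cast; ring
  have hDV : -D = negLogDeriv q r s := by
    refine hD.neg.unique ?_
    convert! hV using 1
    funext p
    rw [(hasDerivAt_indicatorEulerLog k (q := q) p.2 hs).deriv, primeRemainderTerm]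
    by_cases hpq : (p : ℕ) = q
    · have h0 : ∀ χ : DirichletCharacter ℂ q, χ ((p : ℕ) : ZMod q) = 0 := fun χ => by
        rw [hpq, ZMod.natCast_self]; exact MulChar.map_zero χ
      simp only [h0]
      simp [hpq]
    have hp := natCast_zmod_ne_zero_of_ne p.2 hpq
    have hz := norm_prime_cpow_neg_lt_one p.2 (by linarith : 0 < s.re)
    rw [if_neg hpq, if_neg hpq, ← Finset.mul_sum, ← Finset.mul_sum,
      sum_charsTrivialOnRoots_div h2r hp hz, sum_charsTrivialOnRoots_div hr' hp hz,
      MulChar.one_apply (isUnit_iff_ne_zero.mpr hp), localRemainder, ← hr]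
    have h3 : 1 / (((q - 1) / r : ℕ) : ℂ) * (2 * (Real.log (p : ℕ) * ((((q - 1) / (2 * r) : ℕ) : ℂ) *
        geomTail (gp q (2 * r) p) (((p : ℕ) : ℂ) ^ (-s)))) - Real.log (p : ℕ) *
        ((((q - 1) / r : ℕ) : ℂ) * geomTail (gp q r p) (((p : ℕ) : ℂ) ^ (-s)))) =
        Real.log (p : ℕ) * (geomTail (gp q (2 * r) p) (((p : ℕ) : ℂ) ^ (-s)) -
          geomTail (gp q r p) (((p : ℕ) : ℂ) ^ (-s))) := by
      rw [← h2] at hh ⊢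
      have hh' := right_ne_zero_of_mul hh
      field_simp
    change _ = _ - 1 / (((q - 1) / r : ℕ) : ℂ) * (2 * (Real.log (p : ℕ) *
      ((((q - 1) / (2 * r) : ℕ) : ℂ) *
        geomTail (gp q (2 * r) p) (((p : ℕ) : ℂ) ^ (-s)))) - Real.log (p : ℕ) *
        ((((q - 1) / r : ℕ) : ℂ) * geomTail (gp q r p) (((p : ℕ) : ℂ) ^ (-s)))) + _
    rw [h3]
    simp only [geomTail, one_mul, pow_one]
    ring
  rw [← hDV]
  refine hder.congr_deriv ?_
  ring

end EulerProducts

section LogDerivative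
open DirichletCharacter

lemma deriv_LFunctionTrivChar₁_one : deriv (LFunctionTrivChar₁ 1) 1 =
    Real.eulerMascheroniConstant := by
  have h1 := ((differentiable_LFunctionTrivChar₁ 1) 1).hasDerivAt
  rw [hasDerivAt_iff_tendsto_slope] at h1
  refine tendsto_nhds_unique h1 (tendsto_riemannZeta_sub_one_div.congr' ?_)
  filter_upwards [self_mem_nhdsWithin] with s hs
  have hs1 : s - 1 ≠ 0 := sub_ne_zero.mpr hs
  rw [slope_def_field, LFunctionTrivChar₁_one_apply_of_ne_one hs]
  simp only [Function.update_self, Nat.primeFactors_one, Finset.prod_empty]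
  field_simp

lemma LFunctionTrivChar₁_eq_mul (q : ℕ) [hq : Fact q.Prime] (s : ℂ) :
    LFunctionTrivChar₁ q s = (1 - (q : ℂ) ^ (-s)) * LFunctionTrivChar₁ 1 s := by
  rcases eq_or_ne s 1 with rfl | hs
  · simp [Nat.Prime.primeFactors hq.out, Complex.cpow_neg_one]
  · rw [LFunctionTrivChar₁_one_apply_of_ne_one hs, LFunctionTrivChar₁, Function.update_of_ne hs,
      LFunctionTrivChar_eq_mul_riemannZeta hs, Nat.Prime.primeFactors hq.out,
      Finset.prod_singleton]
    ring

lemma logDeriv_LFunctionTrivChar₁_one (q : ℕ) [hq : Fact q.Prime] :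
    deriv (LFunctionTrivChar₁ q) 1 / LFunctionTrivChar₁ q 1 =
      ((Real.eulerMascheroniConstant + Real.log q / ((q : ℝ) - 1) : ℝ) : ℂ) := by
  have hq0 : (q : ℂ) ≠ 0 := by exact_mod_cast hq.out.ne_zero
  have hq1 : (q : ℂ) - 1 ≠ 0 := sub_ne_zero.mpr (by exact_mod_cast hq.out.one_lt.ne')
  have h1 : HasDerivAt (fun s : ℂ => 1 - (q : ℂ) ^ (-s))
      (-((q : ℂ) ^ (-(1 : ℂ)) * Complex.log q * -1)) 1 :=
    ((hasDerivAt_id (1 : ℂ)).neg.const_cpow (Or.inl hq0)).const_sub 1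
  have h2 := ((differentiable_LFunctionTrivChar₁ 1) 1).hasDerivAt
  rw [deriv_LFunctionTrivChar₁_one] at h2
  have h3 := h1.mul h2
  have h4 : LFunctionTrivChar₁ q = fun s => (1 - (q : ℂ) ^ (-s)) * LFunctionTrivChar₁ 1 s :=
    funext (LFunctionTrivChar₁_eq_mul q)
  have h5 : LFunctionTrivChar₁ 1 1 = 1 := by simp
  have h6 : deriv (LFunctionTrivChar₁ q) 1 =
      -((q : ℂ) ^ (-(1 : ℂ)) * Complex.log q * -1) * LFunctionTrivChar₁ 1 1 +
        (1 - (q : ℂ) ^ (-(1 : ℂ))) * Real.eulerMascheroniConstant := by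
    rw [h4]; exact h3.deriv
  rw [h6, LFunctionTrivChar₁_eq_mul q, h5, Complex.cpow_neg_one]
  have h7 : 1 - (q : ℂ)⁻¹ ≠ 0 := by
    rw [show 1 - (q : ℂ)⁻¹ = ((q : ℂ) - 1) / q by field_simp]
    exact div_ne_zero hq1 hq0
  push_cast
  field_simp
  ring

lemma norm_sum_le_card_mul {q : ℕ} [NeZero q] (X : Finset (DirichletCharacter ℂ q))
    {f : DirichletCharacter ℂ q → ℂ} {B : ℝ} (hB : 0 ≤ B) (h : ∀ χ, ‖f χ‖ ≤ B) :
    ‖∑ χ ∈ X, f χ‖ ≤ Fintype.card (DirichletCharacter ℂ q) * B := by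
  refine (norm_sum_le_of_le X fun χ _ => h χ).trans ?_
  rw [Finset.sum_const, nsmul_eq_mul]
  gcongr
  exact X.card_le_univ

variable {q : ℕ} [hq : Fact q.Prime]

lemma differentiableAt_logDeriv_LFunction_of_im (χ : DirichletCharacter ℂ q) {s : ℂ}
    (hs : 0 < |s.im|) (h0 : LFunction χ s ≠ 0) :
    DifferentiableAt ℂ (fun s => deriv (LFunction χ) s / LFunction χ s) s := by
  have hU : IsOpen {s : ℂ | 0 < |s.im|} := isOpen_lt continuous_const (by fun_prop)
  have h1 : AnalyticAt ℂ (LFunction χ) s := DifferentiableOn.analyticAt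
    (fun z hz => (differentiableAt_LFunction_of_im χ hz).differentiableWithinAt) (hU.mem_nhds hs)
  exact (h1.deriv.div h1 h0).differentiableAt

lemma exists_uniform_norm_logDeriv_LFunction_le (q : ℕ) [hq : Fact q.Prime] {τ : ℝ} (hτ : 0 < τ) :
    ∃ C ρ₀ : ℝ, 0 < C ∧ 0 < ρ₀ ∧ ∀ (χ : DirichletCharacter ℂ q) (s₀ : ℂ), 1 < s₀.re →
      s₀.re ≤ 2 → τ ≤ |s₀.im| → ∀ s ∈ Metric.ball s₀ (ρ₀ / (1 + |s₀.im|) ^ (1 / 12 : ℝ)),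
        LFunction χ s ≠ 0 ∧
        ‖deriv (LFunction χ) s / LFunction χ s‖ ≤ C * (1 + |s₀.im|) ^ (1 / 12 : ℝ) := by
  choose C ρ hC hρ H using fun χ : DirichletCharacter ℂ q => exists_norm_logDeriv_LFunction_le χ hτ
  obtain ⟨χ₀, h₀⟩ := Finite.exists_min ρ
  obtain ⟨χ₁, h₁⟩ := Finite.exists_max C
  refine ⟨C χ₁, ρ χ₀, hC _, hρ _, fun χ s₀ h1 h2 h3 s hs => ?_⟩
  have h := H χ s₀ h1 h2 h3 s (Metric.ball_subset_ball (by have := h₀ χ; gcongr) hs)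
  exact ⟨h.1, h.2.trans (by have := h₁ χ; gcongr)⟩

lemma negLogDeriv_far {r : ℕ} (hq2 : q ≠ 2) (h2r : 2 * r ∣ q - 1) {τ : ℝ} (hτ : 0 < τ) :
    ∃ C ρ₀ : ℝ, 0 < C ∧ 0 < ρ₀ ∧ ∀ s₀ : ℂ, 1 < s₀.re → s₀.re ≤ 2 → τ ≤ |s₀.im| →
      DifferentiableOn ℂ (negLogDeriv q r)
        (Metric.ball s₀ (ρ₀ / (1 + |s₀.im|) ^ (1 / 12 : ℝ))) ∧
      ∀ s ∈ Metric.ball s₀ (ρ₀ / (1 + |s₀.im|) ^ (1 / 12 : ℝ)),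
        ‖negLogDeriv q r s‖ ≤ C * (1 + |s₀.im|) ^ (1 / 12 : ℝ) := by
  obtain ⟨C, ρ, hC, hρ, H⟩ := exists_uniform_norm_logDeriv_LFunction_le q hτ
  obtain ⟨A, hA⟩ := exists_norm_primeRemainder_le r hq2 ((dvd_mul_left r 2).trans h2r)
  have hHd := differentiableOn_primeRemainder hq2 h2r
  set N : ℝ := ((Fintype.card (DirichletCharacter ℂ q) : ℕ) : ℝ)
  set b : ℝ := ‖(1 / (((q - 1) / r : ℕ) : ℂ))‖ with hb
  refine ⟨C + b * (2 * (N * C) + N * C) + |A|, min ρ (min (1 / 10) (τ / 2)), by positivity,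
    by positivity, fun s₀ h1 h2 h3 => ?_⟩
  set T : ℝ := (1 + |s₀.im|) ^ (1 / 12 : ℝ) with hT
  have hT1 : 1 ≤ T := Real.one_le_rpow (by linarith [abs_nonneg s₀.im]) (by norm_num)
  have hT0 : 0 < T := by linarith
  have hball : ∀ s ∈ Metric.ball s₀ (min ρ (min (1 / 10) (τ / 2)) / T),
      s ∈ Metric.ball s₀ (ρ / T) ∧ 9 / 10 < s.re ∧ 0 < |s.im| := by
    intro s hs
    refine ⟨Metric.ball_subset_ball (by gcongr; exact min_le_left _ _) hs, ?_⟩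
    have h4 : ‖s - s₀‖ ≤ min (1 / 10) (τ / 2) := by
      rw [Metric.mem_ball, dist_eq_norm] at hs
      exact hs.le.trans ((div_le_self (by positivity) hT1).trans (min_le_right _ _))
    have h5 := (abs_re_le_of_norm_sub_le (h4.trans (min_le_left _ _))).1
    have h6 := (abs_im_le_of_norm_sub_le (h4.trans (min_le_right _ _))).1
    exact ⟨by linarith, by linarith⟩
  constructor
  · intro s hs
    obtain ⟨hs1, hs2, hs3⟩ := hball s hs
    have hd : ∀ χ : DirichletCharacter ℂ q,
        DifferentiableAt ℂ (fun s => -(deriv (LFunction χ) s / LFunction χ s)) s := fun χ =>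
      (differentiableAt_logDeriv_LFunction_of_im χ hs3 (H χ s₀ h1 h2 h3 s hs1).1).neg
    have hp : DifferentiableAt ℂ (primeRemainder q r) s := hHd.differentiableAt
      ((isOpen_lt continuous_const Complex.continuous_re).mem_nhds hs2)
    refine DifferentiableAt.differentiableWithinAt ?_
    unfold negLogDeriv
    exact ((hd 1).sub ((((DifferentiableAt.fun_sum fun χ _ => hd χ).const_mul 2).sub
      (DifferentiableAt.fun_sum fun χ _ => hd χ)).const_mul _)).add hp
  · intro s hs
    obtain ⟨hs1, hs2, hs3⟩ := hball s hs
    have hn : ∀ χ : DirichletCharacter ℂ q,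
        ‖-(deriv (LFunction χ) s / LFunction χ s)‖ ≤ C * T := fun χ => by
      rw [norm_neg]; exact (H χ s₀ h1 h2 h3 s hs1).2
    have hX := fun X => norm_sum_le_card_mul X (by positivity) hn
    have hp : ‖primeRemainder q r s‖ ≤ |A| * T :=
      (hA s hs2).trans ((le_abs_self A).trans (le_mul_of_one_le_right (abs_nonneg A) hT1))
    unfold negLogDeriv
    have h2n : ‖(2 : ℂ)‖ = 2 := by simp
    calc _ ≤ C * T + b * (2 * (N * (C * T)) + N * (C * T)) + |A| * T := by
          refine (norm_add_le _ _).trans (add_le_add ((norm_sub_le _ _).trans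
            (add_le_add (hn 1) ?_)) hp)
          rw [norm_mul, ← hb]
          refine mul_le_mul_of_nonneg_left ((norm_sub_le _ _).trans
            (add_le_add ?_ (hX _))) (norm_nonneg _)
          rw [norm_mul, h2n]
          exact mul_le_mul_of_nonneg_left (hX _) zero_le_two
      _ = _ := by ring

/-- The part of `negLogDeriv` which is holomorphic at `1`. -/
noncomputable def negLogDerivRegular (q r : ℕ) [NeZero q] (s : ℂ) : ℂ :=
  open Classical in
  -((1 - 1 / (((q - 1) / r : ℕ) : ℂ)) *
      (deriv (LFunctionTrivChar₁ q) s / LFunctionTrivChar₁ q s))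
    - (1 / (((q - 1) / r : ℕ) : ℂ)) *
      (2 * ∑ χ ∈ (charsTrivialOnRoots q (2 * r)).erase 1,
          -(deriv (LFunction χ) s / LFunction χ s)
        - ∑ χ ∈ (charsTrivialOnRoots q r).erase 1, -(deriv (LFunction χ) s / LFunction χ s))
    + primeRemainder q r s

lemma neg_logDeriv_LFunctionTrivChar_eq {s : ℂ} (hs : s ≠ 1)
    (h0 : LFunction (1 : DirichletCharacter ℂ q) s ≠ 0) :
    -(deriv (LFunction (1 : DirichletCharacter ℂ q)) s /
      LFunction (1 : DirichletCharacter ℂ q) s) =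
      1 / (s - 1) - deriv (LFunctionTrivChar₁ q) s / LFunctionTrivChar₁ q s := by
  have hs1 : s - 1 ≠ 0 := sub_ne_zero.mpr hs
  rw [deriv_LFunctionTrivChar₁_apply_of_ne_one q hs, LFunctionTrivChar₁, Function.update_of_ne hs]
  field_simp
  ring

lemma negLogDeriv_eq_add {r : ℕ} (hr : r ≠ 0) {s : ℂ} (hs : 1 < s.re) :
    negLogDeriv q r s = ((1 - 1 / (((q - 1) / r : ℕ) : ℝ) : ℝ) : ℂ) / (s - 1) +
      negLogDerivRegular q r s := by
  classical
  have hs1 : s ≠ 1 := by rintro rfl; simp at hs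
  have h1 := neg_logDeriv_LFunctionTrivChar_eq hs1
    (LFunction_ne_zero_of_one_le_re (1 : DirichletCharacter ℂ q) (Or.inr hs1) hs.le)
  unfold negLogDeriv negLogDerivRegular
  rw [← Finset.add_sum_erase _ _ (one_mem_charsTrivialOnRoots (q := q) (m := 2 * r) (by positivity)),
    ← Finset.add_sum_erase _ _ (one_mem_charsTrivialOnRoots (q := q) hr), h1]
  push_cast
  ring

lemma exists_differentiableOn_negLogDerivRegular {r : ℕ} (hq2 : q ≠ 2) (h2r : 2 * r ∣ q - 1) :
    ∃ ρ : ℝ, 0 < ρ ∧ DifferentiableOn ℂ (negLogDerivRegular q r) (Metric.ball 1 ρ) := by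
  classical
  have hne : ∀ᶠ s in 𝓝 (1 : ℂ), ∀ χ : DirichletCharacter ℂ q, χ ≠ 1 → LFunction χ s ≠ 0 := by
    rw [Filter.eventually_all]
    intro χ
    by_cases hχ : χ = 1
    · simp [hχ]
    filter_upwards [(differentiable_LFunction hχ).continuous.continuousAt.eventually_ne
      (LFunction_ne_zero_of_one_le_re χ (Or.inl hχ) (s := 1) (by simp))] with s hs _ using hs
  have hne1 : ∀ᶠ s in 𝓝 (1 : ℂ), LFunctionTrivChar₁ q s ≠ 0 :=
    (differentiable_LFunctionTrivChar₁ q).continuous.continuousAt.eventually_ne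
      (LFunctionTrivChar₁_apply_one_ne_zero q)
  have hre : ∀ᶠ s in 𝓝 (1 : ℂ), 9 / 10 < s.re :=
    (isOpen_lt continuous_const Complex.continuous_re).mem_nhds (by norm_num)
  obtain ⟨ρ, hρ, H⟩ := Metric.eventually_nhds_iff_ball.mp (hne.and (hne1.and hre))
  refine ⟨ρ, hρ, fun s hs => DifferentiableAt.differentiableWithinAt ?_⟩
  obtain ⟨h1, h2, h3⟩ := H s hs
  have hlog : ∀ {f : ℂ → ℂ}, Differentiable ℂ f → f s ≠ 0 →
      DifferentiableAt ℂ (fun s => deriv f s / f s) s := fun hf h0 =>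
    ((hf.analyticAt s).deriv.div (hf.analyticAt s) h0).differentiableAt
  have hd : ∀ χ : DirichletCharacter ℂ q, χ ≠ 1 →
      DifferentiableAt ℂ (fun s => -(deriv (LFunction χ) s / LFunction χ s)) s := fun χ hχ =>
    (hlog (differentiable_LFunction hχ) (h1 χ hχ)).neg
  have hp : DifferentiableAt ℂ (primeRemainder q r) s :=
    (differentiableOn_primeRemainder hq2 h2r).differentiableAt
      ((isOpen_lt continuous_const Complex.continuous_re).mem_nhds h3)
  unfold negLogDerivRegular
  exact ((((hlog (differentiable_LFunctionTrivChar₁ q) h2).const_mul _).neg).sub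
    ((((DifferentiableAt.fun_sum fun χ hχ => hd χ (Finset.ne_of_mem_erase hχ)).const_mul 2).sub
      (DifferentiableAt.fun_sum fun χ hχ => hd χ (Finset.ne_of_mem_erase hχ))).const_mul _)).add hp

open Classical in
lemma gammaK_eq (m : ℕ) : gammaK q m = Real.eulerMascheroniConstant +
    (∑ χ ∈ (charsTrivialOnRoots q m).erase 1, deriv (LFunction χ) 1 / LFunction χ 1).re := by
  unfold gammaK
  have h1 : {χ : DirichletCharacter ℂ q | χ ≠ 1 ∧ ∀ a : ZMod q, a ^ m = 1 → χ a = 1} =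
      ((charsTrivialOnRoots q m).erase 1 : Finset (DirichletCharacter ℂ q)) := by
    ext χ
    simp [mem_charsTrivialOnRoots, and_comm]
  have h2 : ∀ χ : DirichletCharacter ℂ q, Lfun χ = LFunction χ := by
    intro χ
    funext s
    unfold Lfun
    rw [dif_neg hq.out.ne_zero]
  rw [h1, finsum_mem_coe_finset]
  simp only [h2]

lemma re_negLogDerivRegular_one {k : ℕ} :
    (negLogDerivRegular q (k.gcd (q - 1)) 1).re = -gammakq' q k := by
  classical
  set r := k.gcd (q - 1) with hr
  have hh : (1 / (((q - 1) / r : ℕ) : ℂ)) = ((1 / (((q - 1) / r : ℕ) : ℝ) : ℝ) : ℂ) := by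
    push_cast; rfl
  have hone : (1 - 1 / (((q - 1) / r : ℕ) : ℂ)) = ((1 - 1 / (((q - 1) / r : ℕ) : ℝ) : ℝ) : ℂ) := by
    push_cast; rfl
  unfold negLogDerivRegular gammakq' gammakq
  rw [logDeriv_LFunctionTrivChar₁_one, primeRemainder_one (Nat.gcd_dvd_right k (q - 1)), gammaK_eq,
    gammaK_eq, ← hr, hone, hh, ← Complex.ofReal_mul]
  simp only [Finset.sum_neg_distrib]
  set S2 := ∑ χ ∈ (charsTrivialOnRoots q (2 * r)).erase 1, deriv (LFunction χ) 1 / LFunction χ 1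
  set S1 := ∑ χ ∈ (charsTrivialOnRoots q r).erase 1, deriv (LFunction χ) 1 / LFunction χ 1
  have h2 : (2 * -S2 - -S1).re = -(2 * S2.re - S1.re) := by simp; ring
  rw [Complex.add_re, Complex.sub_re, Complex.neg_re, Complex.ofReal_re, Complex.re_ofReal_mul,
    Complex.ofReal_re, h2]
  have hdiv : Real.log q / ((((q - 1) / r : ℕ) : ℝ) * ((q : ℝ) - 1)) =
      1 / (((q - 1) / r : ℕ) : ℝ) * (Real.log q / ((q : ℝ) - 1)) := by
    rw [div_mul_div_comm, one_mul]
  rw [hdiv]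
  ring

end LogDerivative

section Counting

lemma not_dvd_sigmak_self_pow {q k : ℕ} [hq : Fact q.Prime] (hk : k ≠ 0) (a : ℕ) :
    ¬ q ∣ sigmak k (q ^ a) := by
  rw [sigmak_prime_pow k hq.out, ← ZMod.natCast_eq_zero_iff, Finset.sum_range_succ']
  simp [hk]

lemma dvd_sigmak_self_mul_iff {q k m : ℕ} [hq : Fact q.Prime] (hk : k ≠ 0) (hm : m ≠ 0) :
    q ∣ sigmak k (q * m) ↔ q ∣ sigmak k m := by
  obtain ⟨a, u, hu, rfl⟩ := Nat.exists_eq_pow_mul_and_not_dvd hm q hq.out.ne_one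
  have hc : ∀ b, (q ^ b).Coprime u := fun b =>
    Nat.Coprime.pow_left b ((Nat.Prime.coprime_iff_not_dvd hq.out).mpr hu)
  rw [← mul_assoc, ← pow_succ', sigmak_mul_of_coprime k (hc _), sigmak_mul_of_coprime k (hc _),
    hq.out.dvd_mul, hq.out.dvd_mul]
  simp only [not_dvd_sigmak_self_pow hk, false_or]

lemma finite_setOf_natCast_le_and (x : ℝ) (P : ℕ → Prop) :
    {n : ℕ | 1 ≤ n ∧ (n : ℝ) ≤ x ∧ P n}.Finite :=
  (Set.finite_Iic ⌊x⌋₊).subset fun _ hn => Nat.le_floor hn.2.1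

lemma Skq_eq_add {q k : ℕ} [hq : Fact q.Prime] (hk : k ≠ 0) (x : ℝ) :
    Skq k q x = Skq' k q x + Skq k q (x / q) := by
  have hq0 : (0 : ℝ) < q := by exact_mod_cast hq.out.pos
  unfold Skq Skq'
  simp only [Nat.card_coe_set_eq]
  rw [← Set.ncard_image_of_injective {n : ℕ | 1 ≤ n ∧ (n : ℝ) ≤ x / q ∧ ¬ q ∣ sigmak k n}
    (mul_right_injective₀ hq.out.ne_zero), ← Set.ncard_union_eq ?_
    (finite_setOf_natCast_le_and x _) ((finite_setOf_natCast_le_and _ _).image _)]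
  · congr 1
    ext n
    simp only [Set.mem_union, Set.mem_image, Set.mem_ofPred_eq, hq.out.dvd_mul, not_or]
    constructor
    · rintro ⟨h1, h2, h3⟩
      by_cases hn : q ∣ n
      · obtain ⟨m, rfl⟩ := hn
        have hm : m ≠ 0 := by rintro rfl; simp at h1
        refine Or.inr ⟨m, ⟨Nat.one_le_iff_ne_zero.mpr hm, ?_,
          (dvd_sigmak_self_mul_iff hk hm).not.mp h3⟩, rfl⟩
        rw [le_div_iff₀ hq0, mul_comm]
        exact_mod_cast h2
      · exact Or.inl ⟨h1, h2, hn, h3⟩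
    · rintro (⟨h1, h2, -, h3⟩ | ⟨m, ⟨h1, h2, h3⟩, rfl⟩)
      · exact ⟨h1, h2, h3⟩
      · refine ⟨Nat.mul_pos hq.out.pos h1, ?_,
          (dvd_sigmak_self_mul_iff hk (Nat.one_le_iff_ne_zero.mp h1)).not.mpr h3⟩
        rw [le_div_iff₀ hq0, mul_comm] at h2
        exact_mod_cast h2
  · rw [Set.disjoint_left]
    rintro n ⟨-, -, h⟩ ⟨m, -, rfl⟩
    exact h ((dvd_mul_right q m).mul_right _)

lemma sum_coprimeIndicator_eq (k q : ℕ) {x : ℝ} (hx : 0 ≤ x) :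
    ∑ n ∈ Finset.Icc 1 ⌊x⌋₊, coprimeIndicator k q n = Skq' k q x := by
  have h : {n : ℕ | 1 ≤ n ∧ (n : ℝ) ≤ x ∧ ¬ q ∣ n * sigmak k n} =
      ((Finset.Icc 1 ⌊x⌋₊).filter fun n => ¬ q ∣ n * sigmak k n : Finset ℕ) := by
    ext n
    simp [Nat.le_floor_iff hx, and_assoc]
  unfold Skq' coprimeIndicator
  rw [Nat.card_coe_set_eq, h, Set.ncard_coe_finset, Finset.card_filter]
  push_cast
  exact Finset.sum_congr rfl fun n _ => by split_ifs <;> simp_all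

lemma tendsto_log_div_const_div_log {a : ℝ} (ha : 0 < a) :
    Tendsto (fun x : ℝ => Real.log (x / a) / Real.log x) atTop (𝓝 1) := by
  have h : Tendsto (fun x : ℝ => 1 - Real.log a / Real.log x) atTop (𝓝 (1 - 0)) :=
    (Real.tendsto_log_atTop.const_div_atTop _).const_sub 1
  rw [sub_zero] at h
  refine h.congr' ?_
  filter_upwards [eventually_gt_atTop 1] with x hx
  rw [Real.log_div (by positivity) ha.ne', sub_div, div_self (Real.log_pos hx).ne']

lemma tendsto_Skq'_div {q k : ℕ} [hq : Fact q.Prime] (hk : k ≠ 0) {C β : ℝ} (hC : C ≠ 0)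
    (h : Tendsto (fun x : ℝ => (Skq k q x : ℝ) / (C * x / Real.log x ^ β)) atTop (𝓝 1)) :
    Tendsto (fun x : ℝ => (Skq' k q x : ℝ) / (x * Real.log x ^ (-β))) atTop
      (𝓝 ((1 - 1 / (q : ℝ)) * C)) := by
  have hq1 : (1 : ℝ) < q := by exact_mod_cast hq.out.one_lt
  have hq0 : (0 : ℝ) < q := by linarith
  have h1 : Tendsto (fun x : ℝ => (Skq k q x : ℝ) / (x * Real.log x ^ (-β))) atTop (𝓝 C) := by
    have := h.const_mul C
    rw [mul_one] at this
    refine this.congr' ?_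
    filter_upwards [eventually_gt_atTop 1] with x hx
    have hl := Real.log_pos hx
    have := (Real.rpow_pos_of_pos hl β).ne'
    rw [Real.rpow_neg hl.le]
    field_simp
  have h2 := h1.comp (tendsto_id.atTop_div_const hq0)
  have h3 : Tendsto (fun x : ℝ => (Real.log (x / q) / Real.log x) ^ (-β)) atTop (𝓝 1) := by
    simpa using (tendsto_log_div_const_div_log hq0).rpow_const (p := -β) (Or.inl one_ne_zero)
  have h4 := h1.sub ((h2.mul h3).mul_const (1 / (q : ℝ)))
  rw [show C - C * 1 * (1 / (q : ℝ)) = (1 - 1 / (q : ℝ)) * C by ring] at h4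
  refine h4.congr' ?_
  filter_upwards [eventually_gt_atTop (q : ℝ)] with x hx
  have hx1 : 1 < x := hq1.trans hx
  have hl := Real.log_pos hx1
  have hl' : 0 < Real.log (x / q) := Real.log_pos ((one_lt_div hq0).mpr hx)
  have e1 := (Real.rpow_pos_of_pos hl (-β)).ne'
  have e2 := (Real.rpow_pos_of_pos hl' (-β)).ne'
  have hadd : (Skq k q x : ℝ) = Skq' k q x + Skq k q (x / q) := by
    exact_mod_cast Skq_eq_add hk x
  simp only [Function.comp_apply, id]
  rw [hadd, Real.div_rpow hl'.le hl.le]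
  have hx0 : x ≠ 0 := by positivity
  field_simp
  ring

/-- The leading coefficient of an asymptotic expansion is determined by the limit. -/
lemma eq_of_tendsto_div_of_sub_isBigO {S : ℝ → ℝ} {β a b L : ℝ}
    (hS : (fun x => S x - x * (a * Real.log x ^ (-β) + b * Real.log x ^ (-β - 1)))
      =O[atTop] fun x => x * Real.log x ^ (-β - 2))
    (hL : Tendsto (fun x => S x / (x * Real.log x ^ (-β))) atTop (𝓝 L)) : a = L := by
  have hlog := Real.tendsto_log_atTop
  have h1 : Tendsto (fun x : ℝ => Real.log x ^ (-2 : ℝ)) atTop (𝓝 0) :=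
    (tendsto_rpow_neg_atTop two_pos).comp hlog
  have h2 : Tendsto (fun x : ℝ => a + b * (Real.log x)⁻¹) atTop (𝓝 (a + b * 0)) :=
    ((tendsto_inv_atTop_zero.comp hlog).const_mul b).const_add a
  have h3 : (fun x => S x / (x * Real.log x ^ (-β)) - (a + b * (Real.log x)⁻¹))
      =O[atTop] fun x : ℝ => Real.log x ^ (-2 : ℝ) := by
    have := hS.mul (Asymptotics.isBigO_refl (fun x : ℝ => (x * Real.log x ^ (-β))⁻¹) atTop)
    refine this.congr' ?_ ?_
    · filter_upwards [eventually_gt_atTop 1] with x hx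
      have hl := Real.log_pos hx
      have e1 := (Real.rpow_pos_of_pos hl (-β)).ne'
      have hx0 : x ≠ 0 := by positivity
      rw [Real.rpow_sub_one hl.ne']
      field_simp
    · filter_upwards [eventually_gt_atTop 1] with x hx
      have hl := Real.log_pos hx
      have e1 := (Real.rpow_pos_of_pos hl (-β)).ne'
      have hx0 : x ≠ 0 := by positivity
      rw [sub_eq_add_neg, Real.rpow_add hl]
      field_simp
  have h4 := (h3.trans_tendsto h1).add h2
  simp only [sub_add_cancel, mul_zero, add_zero, zero_add] at h4
  exact tendsto_nhds_unique h4 hL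

end Counting

/-- With `q, k, r, h` as before (`h` even) and `C > 0` the constant with
`S_{k,q}(x) ∼ C·x/(log x)^{1/h}`, one has
`S'_{k,q}(x) = (1−1/q)·C·x/(log x)^{1/h} · (1 + (1 − γ'_{k,q})/(h·log x))
  + O(x/(log x)^{2+1/h})`. -/
theorem statement1 (q k r h : ℕ) (hq : q.Prime) (hq_odd : q ≠ 2) (hk : 1 ≤ k)
    (hr : r = Nat.gcd k (q - 1)) (hh : h = (q - 1) / r) (hheven : 2 ∣ h)
    (C : ℝ) (hC : 0 < C)
    (hasymp : Tendsto
      (fun x : ℝ => (Skq k q x : ℝ) / (C * x / Real.log x ^ ((1 : ℝ) / h)))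
      atTop (𝓝 1)) :
    (fun x : ℝ => (Skq' k q x : ℝ) -
        (1 - 1 / (q : ℝ)) * C * x / Real.log x ^ ((1 : ℝ) / h) *
          (1 + (1 - gammakq' q k) / (h * Real.log x)))
      =O[atTop] fun x : ℝ => x / Real.log x ^ (2 + (1 : ℝ) / h) := by
  have : Fact q.Prime := ⟨hq⟩
  have hk0 : k ≠ 0 := Nat.one_le_iff_ne_zero.mp hk
  have hr0 : r ≠ 0 := hr ▸ (Nat.gcd_pos_of_pos_left _ hk).ne'
  have hrq : r ∣ q - 1 := hr ▸ Nat.gcd_dvd_right k (q - 1)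
  have hhr : h * r = q - 1 := hh ▸ Nat.div_mul_cancel hrq
  have h2r : 2 * r ∣ q - 1 := hhr ▸ mul_dvd_mul_right hheven r
  have hh0 : h ≠ 0 := by
    rintro rfl
    have := hq.two_le
    omega
  have hh2 : (2 : ℝ) ≤ h := by exact_mod_cast Nat.le_of_dvd (Nat.pos_of_ne_zero hh0) hheven
  set β : ℝ := (1 : ℝ) / h with hβ
  have hβ0 : 0 < β := by positivity
  have hβ1 : β < 1 := by rw [hβ, div_lt_one (by linarith)]; linarith
  obtain ⟨ρ, hρ, hV₀⟩ := exists_differentiableOn_negLogDerivRegular (q := q) hq_odd h2r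
  obtain ⟨c, hc⟩ := sum_sub_isBigO_of_hasDerivAt_LSeries (coprimeIndicator_nonneg k q)
    (coprimeIndicator_le_one k q) (α := 1 - β) (by linarith) (by linarith) hρ
    (V := negLogDeriv q r) (V₀ := negLogDerivRegular q r)
    (fun s hs => by
      subst hr; exact hasDerivAt_LSeries_coprimeIndicator hk0 hq_odd h2r hs)
    hV₀ (fun s _ hs => by rw [negLogDeriv_eq_add hr0 hs, ← hh])
    (fun τ hτ => negLogDeriv_far hq_odd h2r hτ)
  have hreg : (negLogDerivRegular q r 1).re = -gammakq' q k := hr ▸ re_negLogDerivRegular_one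
  have hS : (fun x : ℝ => (Skq' k q x : ℝ) - x * (c * Real.log x ^ (-β) +
      β * c * (1 - gammakq' q k) * Real.log x ^ (-β - 1)))
        =O[atTop] fun x : ℝ => x * Real.log x ^ (-β - 2) := by
    refine (hc.congr' ?_ ?_)
    · filter_upwards [eventually_ge_atTop 0] with x hx
      rw [sum_coprimeIndicator_eq k q hx, hreg]
      ring_nf
    · exact Eventually.of_forall fun x => by ring_nf
  have hcC : c = (1 - 1 / (q : ℝ)) * C :=
    eq_of_tendsto_div_of_sub_isBigO hS (tendsto_Skq'_div hk0 hC.ne' hasymp)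
  refine hS.congr' ?_ ?_
  · filter_upwards [eventually_gt_atTop 1] with x hx
    have hl := Real.log_pos hx
    have e1 := (Real.rpow_pos_of_pos hl β).ne'
    rw [← hcC, Real.rpow_sub_one hl.ne', Real.rpow_neg hl.le, hβ]
    field_simp
  · filter_upwards [eventually_gt_atTop 1] with x hx
    have hl := Real.log_pos hx
    rw [show -β - 2 = -(2 + β) by ring, Real.rpow_neg hl.le, div_eq_mul_inv]
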